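/- arXiv:2407.15785 — 5 statements merged into one kernel-verified Lean document; each statement's English description precedes it below -/
import Mathlib

section
/- Let H be a finite abelian strongly sequenceable group, let m, k be positive integers, and let φ : H → Aut(Z_m) be a group homomorphism satisfying property (*). Then any subset S of size k of (Z_m ⋊_φ H) \ {0} is sequenceable provided that every prime factor of m is greater than k!. -/
/-- A finite subset `S` of a group is *sequenceable* if there is an ordering
`(x₁, …, x_k)` of its elements such that the partial products `s₀ = 1`,
`s_i = x₁ ⋯ x_i` are pairwise distinct, with the possible exception that
`s_k = s₀` is allowed. -/
def IsSequenceable {G : Type*} [Group G] (S : Finset G) : Prop :=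
  ∃ l : List G, l.Nodup ∧ (∀ x, x ∈ l ↔ x ∈ S) ∧
    ∀ i j : ℕ, i < j → j ≤ l.length → ¬(i = 0 ∧ j = l.length) →
      (l.take i).prod ≠ (l.take j).prod

/-- A group is *strongly sequenceable* if every finite subset not containing the
identity is sequenceable. -/
def StronglySequenceable (G : Type*) [Group G] : Prop :=
  ∀ S : Finset G, (1 : G) ∉ S → IsSequenceable S

theorem sum_smul_eq_zero_of_mem_span {ι X : Type*} [Fintype ι] [AddCommGroup X]
    (x : ι → X)
    (hX : ∀ d : ℤ, d ≠ 0 → |d| ≤ (Fintype.card ι).factorial → ∀ y : X, d • y = 0 → y = 0)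
    (c : ι → ℤ)
    (hc : (fun i => (c i : ℚ)) ∈ Submodule.span ℚ
      ((fun (a : ι → ℤ) (i : ι) => (a i : ℚ)) '' {a | (∀ i, |a i| ≤ 1) ∧ ∑ i, a i • x i = 0})) :
    ∑ i, c i • x i = 0 := by
  classical
  set v : (ι → ℤ) → ι → ℚ := fun a i => (a i : ℚ) with hv
  obtain ⟨s, hsA, -, hAs, hs⟩ := exists_linearIndepOn_extension (K := ℚ) (v := v)
    (linearIndepOn_empty ℚ v) (Set.empty_subset {a | (∀ i, |a i| ≤ 1) ∧ ∑ i, a i • x i = 0})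
  have hcs : v c ∈ Submodule.span ℚ (v '' s) := (Submodule.span_le.2 hAs) hc
  obtain ⟨b, hbT, hsb, hTb, hb⟩ := exists_linearIndepOn_extension (K := ℚ) (v := v) hs
    (show s ⊆ {a | ∀ i, |a i| ≤ 1} from fun a ha => (hsA ha).1)
  have hspan : ⊤ ≤ Submodule.span ℚ (Set.range fun i : b => v i) := by
    rw [← (Pi.basisFun ℚ ι).span_eq, Submodule.span_le]
    rintro _ ⟨i, rfl⟩
    have : v '' b = Set.range fun i : b => v i := by rw [Set.image_eq_range]
    rw [← this]
    apply hTb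
    refine ⟨Pi.single i 1, ?_, ?_⟩
    · intro j
      by_cases h : j = i
      · subst h; simp
      · simp [h]
    · ext j
      by_cases h : j = i
      · subst h; simp [hv]
      · simp [hv, h]
  let B : Module.Basis b ℚ (ι → ℚ) := Module.Basis.mk hb hspan
  have hB : ∀ i : b, B i = v i := fun i => Module.Basis.mk_apply hb hspan i
  let e : ι ≃ b := (Pi.basisFun ℚ ι).indexEquiv B
  let C := B.reindex e.symm
  have hC : ∀ i, C i = v (e i) := fun i => by simp [C, hB]
  let M : Matrix ι ι ℤ := Matrix.of fun i j => (e i).1 j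
  have hdet : M.det ≠ 0 := by
    have h1 : LinearIndependent ℚ (M.map (Int.castRingHom ℚ)).row := by
      have := C.linearIndependent
      convert this using 1
      ext i j
      simp [hC, M, hv]
    rw [Matrix.linearIndependent_rows_iff_isUnit, Matrix.isUnit_iff_isUnit_det] at h1
    rw [← RingHom.mapMatrix_apply, ← RingHom.map_det] at h1
    intro h0
    simp [h0] at h1
  have hbound : |M.det| ≤ (Fintype.card ι).factorial := by
    have := Matrix.det_le (A := M) (abv := AbsoluteValue.abs) (x := 1)
      (fun i j => hbT (e i).2 j)
    simpa using this
  apply hX _ hdet hbound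
  let q : ι → ℤ := Matrix.vecMul c M.adjugate
  have hq : Matrix.vecMul q M = M.det • c := by
    simp [q, Matrix.vecMul_vecMul, Matrix.adjugate_mul]
  have hq0 : ∀ j, (e j).1 ∉ s → q j = 0 := by
    intro j hj
    have hrepr : v c = Matrix.vecMul (C.repr (v c)) (M.map (Int.castRingHom ℚ)) := by
      conv_lhs => rw [← C.sum_repr (v c)]
      ext i
      simp [Matrix.vecMul, dotProduct, hC, M, hv]
    have hz : C.repr (v c) j = 0 := by
      have himg : v '' s = C '' {j | (e j).1 ∈ s} := by
        ext w
        constructor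
        · rintro ⟨a, ha, rfl⟩
          exact ⟨e.symm ⟨a, hsb ha⟩, by simpa using ha, by simp [hC]⟩
        · rintro ⟨j, hj, rfl⟩
          exact ⟨_, hj, (hC j).symm⟩
      rw [himg, C.mem_span_image] at hcs
      by_contra hne
      exact hj (hcs (Finsupp.mem_support_iff.2 hne))
    have hqv : v q = (M.det : ℚ) • ⇑(C.repr (v c)) := by
      have h1 : v q = Matrix.vecMul (v c) (M.adjugate.map (Int.castRingHom ℚ)) := by
        ext i
        simp [hv, q, Matrix.vecMul, dotProduct]
      rw [h1, hrepr, Matrix.vecMul_vecMul, ← Matrix.map_mul, Matrix.mul_adjugate, ← hrepr]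
      have h2 : (M.det • (1 : Matrix ι ι ℤ)).map (Int.castRingHom ℚ) = (M.det : ℚ) • 1 := by
        ext i k
        rw [Matrix.map_apply, Matrix.smul_apply, Matrix.smul_apply, Matrix.one_apply,
          Matrix.one_apply]
        split_ifs <;> simp
      rw [h2, Matrix.vecMul_smul, Matrix.vecMul_one]
    have := congrFun hqv j
    rw [Pi.smul_apply, hz, smul_zero] at this
    exact Int.cast_eq_zero.1 this
  calc M.det • ∑ i, c i • x i = ∑ i, (M.det • c) i • x i := by
        simp [Finset.smul_sum, mul_smul]
    _ = ∑ i, ∑ j, (q j * M j i) • x i := by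
        rw [← hq]; simp [Matrix.vecMul, dotProduct, Finset.sum_smul]
    _ = ∑ j, q j • ∑ i, M j i • x i := by
        rw [Finset.sum_comm]; simp [Finset.smul_sum, mul_smul]
    _ = 0 := by
        refine Finset.sum_eq_zero fun j _ => ?_
        by_cases hj : (e j).1 ∈ s
        · rw [show ∑ i, M j i • x i = 0 from (hsA hj).2, smul_zero]
        · rw [hq0 j hj, zero_smul]

/-- If `X` has no torsion of order at most `|ι|!`, then any family `ι → X` can be replaced by a
family of rationals satisfying the same linear relations with coefficients in `{-1, 0, 1}`. -/
theorem exists_rat_same_relations {ι X : Type*} [Fintype ι] [AddCommGroup X]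
    (x : ι → X)
    (hX : ∀ d : ℤ, d ≠ 0 → |d| ≤ (Fintype.card ι).factorial → ∀ y : X, d • y = 0 → y = 0) :
    ∃ x' : ι → ℚ, ∀ c : ι → ℤ, (∀ i, |c i| ≤ 1) →
      (∑ i, c i • x i = 0 ↔ ∑ i, c i • x' i = 0) := by
  classical
  set v : (ι → ℤ) → ι → ℚ := fun a i => (a i : ℚ) with hv
  set W := Submodule.span ℚ (v '' {a | (∀ i, |a i| ≤ 1) ∧ ∑ i, a i • x i = 0}) with hW
  have hfin : {a : ι → ℤ | ∀ i, |a i| ≤ 1}.Finite := by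
    refine (Set.Finite.pi' (fun _ : ι => Set.finite_Icc (-1 : ℤ) 1)).subset fun a ha i => ?_
    exact abs_le.1 (ha i)
  let T := {a : ι → ℤ // (∀ i, |a i| ≤ 1) ∧ v a ∉ W}
  have : Finite T :=
    (hfin.subset fun a ha => ha.1 : {a : ι → ℤ | (∀ i, |a i| ≤ 1) ∧ v a ∉ W}.Finite)
  obtain ⟨f, hf⟩ := Module.exists_dual_forall_apply_ne_zero (K := ℚ)
    (fun a : T => W.mkQ (v a.1)) (fun a => by simpa using a.2.2)
  have hsum : ∀ c : ι → ℤ, ∑ i, c i • f (W.mkQ (Pi.single i 1)) = f (W.mkQ (v c)) := by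
    intro c
    have : v c = ∑ i, c i • Pi.single (M := fun _ => ℚ) i (1 : ℚ) := by
      ext j
      simp [hv, Finset.sum_apply, Pi.single_apply]
    rw [this]
    simp only [map_sum, map_zsmul]
  refine ⟨fun i => f (W.mkQ (Pi.single i 1)), fun c hc => ?_⟩
  rw [hsum]
  constructor
  · intro h
    have : v c ∈ W := Submodule.subset_span ⟨c, ⟨hc, h⟩, rfl⟩
    rw [(Submodule.Quotient.mk_eq_zero W).2 this |> (show W.mkQ (v c) = 0 from ·), map_zero]
  · intro h
    refine sum_smul_eq_zero_of_mem_span x hX c ?_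
    by_contra hn
    exact hf ⟨c, hc, hn⟩ h

/-- The positions reached after each step of a walk that starts at `a`. -/
def stepSums {K : Type*} [Add K] (a : K) : List K → List K
  | [] => []
  | d :: l => (a + d) :: stepSums (a + d) l

section Walks

variable {K : Type*} [AddCommGroup K]

theorem stepSums_append (a : K) (l₁ l₂ : List K) :
    stepSums a (l₁ ++ l₂) = stepSums a l₁ ++ stepSums (a + l₁.sum) l₂ := by
  induction l₁ generalizing a with
  | nil => simp [stepSums]
  | cons d l ih => simp [stepSums, ih, add_assoc]

theorem mem_stepSums {a y : K} {l : List K} :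
    y ∈ stepSums a l ↔ ∃ u c w, l = u ++ c :: w ∧ y = a + u.sum + c := by
  induction l generalizing a with
  | nil => simp [stepSums]
  | cons d l ih =>
    simp only [stepSums, List.mem_cons, ih]
    constructor
    · rintro (rfl | ⟨u, c, w, rfl, rfl⟩)
      · exact ⟨[], d, l, by simp⟩
      · exact ⟨d :: u, c, w, by simp [add_assoc]⟩
    · rintro ⟨_ | ⟨e, u⟩, c, w, h, rfl⟩
      · simp only [List.nil_append, List.cons.injEq] at h
        simp [h.1]
      · simp only [List.cons_append, List.cons.injEq] at h
        exact Or.inr ⟨u, c, w, h.2, by simp [h.1, add_assoc]⟩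

theorem lt_of_mem_stepSums (lev : K →+ ℚ) {a y : K} {l : List K} (hl : ∀ d ∈ l, 0 < lev d)
    (hy : y ∈ stepSums a l) : lev a < lev y := by
  induction l generalizing a with
  | nil => simp [stepSums] at hy
  | cons d l ih =>
    have hd := hl d (by simp)
    simp only [stepSums, List.mem_cons] at hy
    rcases hy with rfl | hy
    · simpa using hd
    · have := ih (fun e he => hl e (by simp [he])) hy
      rw [map_add] at this
      linarith

theorem eq_or_lt_of_mem_stepSums (lev : K →+ ℚ) {a y : K} {l : List K}
    (hl : ∀ d ∈ l, 0 < lev d) (hy : y ∈ stepSums a l) :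
    y = a + l.sum ∨ lev y < lev (a + l.sum) := by
  induction l generalizing a with
  | nil => simp [stepSums] at hy
  | cons d l ih =>
    have hl' : ∀ e ∈ l, 0 < lev e := fun e he => hl e (by simp [he])
    simp only [stepSums, List.mem_cons] at hy
    rcases hy with rfl | hy
    · rcases l with _ | ⟨e, l⟩
      · simp
      · right
        have : 0 < lev (e :: l).sum := by
          rw [map_list_sum]
          exact List.sum_pos _ (by simpa using hl') (by simp)
        simp only [List.sum_cons, map_add] at this ⊢
        linarith
    · simpa [add_assoc] using ih hl' hy

theorem length_stepSums (a : K) (l : List K) : (stepSums a l).length = l.length := by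
  induction l generalizing a with
  | nil => rfl
  | cons d l ih => simp [stepSums, ih]

theorem sum_eq_of_toFinset_eq [DecidableEq K] {l : List K} {J : Finset K} (hl : l.Nodup)
    (h : l.toFinset = J) : l.sum = ∑ d ∈ J, d := by
  subst h
  rw [List.sum_toFinset _ hl, List.map_id']

/-- A form of the grasshopper problem: `J` is a set of upward jumps, `M` a set of fewer obstacles
at different levels. -/
theorem exists_walk_avoiding [DecidableEq K] (lev : K →+ ℚ) (n : ℕ) :
    ∀ (J M : Finset K) (a : K), J.card = n → (∀ d ∈ J, 0 < lev d) → Set.InjOn lev M →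
      M.card ≤ J.card - 1 → a + ∑ d ∈ J, d ∉ M →
      ∃ l : List K, l.Nodup ∧ l.toFinset = J ∧ ∀ y ∈ stepSums a l, y ∉ M := by
  induction n using Nat.strong_induction_on with
  | _ n ih =>
  intro J M a hn hJ hinj hM haM
  rcases M.eq_empty_or_nonempty with rfl | hMne
  · exact ⟨J.toList, J.nodup_toList, J.toList_toFinset, by simp⟩
  have hMpos := hMne.card_pos
  have hJne : J.Nonempty := Finset.card_pos.1 (by omega)
  obtain ⟨d, hd, hdmax⟩ := J.exists_max_image lev hJne
  have hdpos := hJ d hd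
  have hJ' : ∀ e ∈ J.erase d, 0 < lev e := fun e he => hJ e (Finset.mem_of_mem_erase he)
  have hcard' : (J.erase d).card = J.card - 1 := Finset.card_erase_of_mem hd
  set t := a + ∑ e ∈ J.erase d, e with ht
  have htd : a + ∑ e ∈ J, e = t + d := by
    rw [ht, ← Finset.sum_erase_add _ _ hd, add_assoc]
  rw [htd] at haM
  have hpos : ∀ {l : List K} {F : Finset K}, F ⊆ J → l.toFinset = F → ∀ e ∈ l, 0 < lev e :=
    fun hF hl e he => hJ e (hF (hl ▸ List.mem_toFinset.2 he))
  by_cases hhigh : ∃ y ∈ M, y ≠ t ∧ lev t ≤ lev y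
  · obtain ⟨y, hyM, hyt, hy⟩ := hhigh
    by_cases htM : t ∈ M
    · -- choose the last two jumps so that they step over `t`
      have hpairs : ∃ e ∈ J.erase d, t + d - e ∉ M ∧ t - e ∉ M := by
        by_contra! hcon
        have hmap : ∀ e ∈ J.erase d, (if t + d - e ∈ M then t + d - e else t - e) ∈ M.erase t := by
          intro e he
          have hed := (Finset.mem_erase.1 he).1
          have hepos := hJ' e he
          split_ifs with h
          · refine Finset.mem_erase.2 ⟨fun h' => hed ?_, h⟩
            rw [add_sub_assoc, add_eq_left, sub_eq_zero] at h'
            exact h'.symm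
          · refine Finset.mem_erase.2 ⟨fun h' => ?_, hcon e he h⟩
            rw [sub_eq_self] at h'
            simp [h'] at hepos
        have hlt : (M.erase t).card < (J.erase d).card := by
          rw [Finset.card_erase_of_mem htM]; omega
        obtain ⟨e, he, f, hf, hef, heq⟩ :=
          Finset.exists_ne_map_eq_of_card_lt_of_maps_to hlt hmap
        have h1 := hdmax e (Finset.mem_of_mem_erase he)
        have h2 := hdmax f (Finset.mem_of_mem_erase hf)
        have h3 := hJ' e he
        have h4 := hJ' f hf
        have hl := congrArg lev heq
        split_ifs at heq hl
        · exact hef (sub_right_injective heq)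
        · simp only [map_add, map_sub] at hl; linarith
        · simp only [map_add, map_sub] at hl; linarith
        · exact hef (sub_right_injective heq)
      obtain ⟨e, he, hte, hte'⟩ := hpairs
      have hepos := hJ' e he
      set F := (J.erase d).erase e with hF
      have hFcard : F.card = J.card - 2 := by
        rw [hF, Finset.card_erase_of_mem he, hcard']; omega
      have hFsub : F ⊆ J := (Finset.erase_subset _ _).trans (Finset.erase_subset _ _)
      have hFt : a + ∑ x ∈ F, x = t - e := by
        rw [ht, ← Finset.sum_erase_add _ _ he]; abel
      have hsub : M.filter (fun z => lev z < lev (t - e)) ⊆ (M.erase t).erase y := by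
        intro z hz
        obtain ⟨hzM, hzl⟩ := Finset.mem_filter.1 hz
        rw [map_sub] at hzl
        refine Finset.mem_erase.2 ⟨?_, Finset.mem_erase.2 ⟨?_, hzM⟩⟩
        · rintro rfl; linarith
        · rintro rfl; linarith
      have hcardM := Finset.card_le_card hsub
      rw [Finset.card_erase_of_mem (Finset.mem_erase.2 ⟨hyt, hyM⟩),
        Finset.card_erase_of_mem htM] at hcardM
      obtain ⟨l, hl, hlF, hlM⟩ := ih _ (by rw [← hn, hFcard]; omega) F
        (M.filter (fun z => lev z < lev (t - e))) a rfl (fun x hx => hJ x (hFsub hx))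
        (hinj.mono (Finset.coe_subset.2 (Finset.filter_subset _ _))) (by omega) (by rw [hFt]; simp)
      have hlsum : a + l.sum = t - e := by rw [sum_eq_of_toFinset_eq hl hlF, hFt]
      have hde : d ≠ e := fun h => (Finset.mem_erase.1 he).1 h.symm
      have hmem : ∀ x, x ∈ l ↔ x ≠ e ∧ x ≠ d ∧ x ∈ J := by
        intro x
        rw [← List.mem_toFinset, hlF, hF]; simp
      refine ⟨l ++ [d, e], ?_, ?_, ?_⟩
      · rw [List.nodup_append]
        refine ⟨hl, by simp [hde], ?_⟩
        intro x hx z hz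
        have := (hmem x).1 hx
        simp only [List.mem_cons, List.not_mem_nil, or_false] at hz
        rcases hz with rfl | rfl
        · exact this.2.1
        · exact this.1
      · ext x
        have heJ := Finset.mem_of_mem_erase he
        simp only [List.toFinset_append, Finset.mem_union, List.mem_toFinset, hmem, List.mem_cons,
          List.not_mem_nil, or_false]
        constructor
        · rintro (h | rfl | rfl)
          exacts [h.2.2, hd, heJ]
        · tauto
      · intro z hz
        rw [stepSums_append, List.mem_append, hlsum] at hz
        rcases hz with hz | hz
        · intro hzM
          rcases eq_or_lt_of_mem_stepSums lev (hpos hFsub hlF) hz with h | h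
          · exact hte' (by rwa [h, hlsum] at hzM)
          · rw [hlsum] at h
            exact hlM z hz (Finset.mem_filter.2 ⟨hzM, h⟩)
        · simp only [stepSums, List.mem_cons, List.not_mem_nil, or_false] at hz
          rcases hz with rfl | rfl
          · rwa [sub_add_eq_add_sub]
          · rwa [show t - e + d + e = t + d by abel]
    · have hsub : M.filter (fun z => lev z < lev t) ⊆ M.erase y := by
        intro z hz
        obtain ⟨hzM, hzl⟩ := Finset.mem_filter.1 hz
        refine Finset.mem_erase.2 ⟨?_, hzM⟩
        rintro rfl; linarith
      have hcardM := Finset.card_le_card hsub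
      rw [Finset.card_erase_of_mem hyM] at hcardM
      obtain ⟨l, hl, hlF, hlM⟩ := ih _ (by rw [← hn, hcard']; omega) (J.erase d)
        (M.filter (fun z => lev z < lev t)) a rfl hJ'
        (hinj.mono (Finset.coe_subset.2 (Finset.filter_subset _ _))) (by omega) (by rw [← ht]; simp)
      have hlsum : a + l.sum = t := by rw [sum_eq_of_toFinset_eq hl hlF, ht]
      refine ⟨l ++ [d], ?_, ?_, ?_⟩
      · have : d ∉ l := by rw [← List.mem_toFinset, hlF]; simp
        rw [List.nodup_append]
        refine ⟨hl, by simp, ?_⟩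
        intro x hx z hz
        rw [List.mem_singleton.1 hz]
        rintro rfl
        exact this hx
      · rw [List.toFinset_append, hlF]
        simp [Finset.insert_erase hd]
      · intro z hz
        rw [stepSums_append, List.mem_append, hlsum] at hz
        rcases hz with hz | hz
        · intro hzM
          rcases eq_or_lt_of_mem_stepSums lev (hpos (Finset.erase_subset _ _) hlF) hz with h | h
          · exact htM (by rwa [h, hlsum] at hzM)
          · rw [hlsum] at h
            exact hlM z hz (Finset.mem_filter.2 ⟨hzM, h⟩)
        · simp only [stepSums, List.mem_cons, List.not_mem_nil, or_false] at hz
          rwa [hz]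
  · push Not at hhigh
    obtain ⟨m, hm, hmmax⟩ := M.exists_max_image lev hMne
    have htM' : t ∉ M.erase m := by
      intro h
      obtain ⟨h1, h2⟩ := Finset.mem_erase.1 h
      exact absurd (hmmax t h2) (not_le.2 (hhigh m hm h1.symm))
    obtain ⟨l, hl, hlF, hlM⟩ := ih _ (by rw [← hn, hcard']; omega) (J.erase d) (M.erase m) a rfl
      hJ' (hinj.mono (by simp)) (by rw [Finset.card_erase_of_mem hm]; omega) htM'
    have hlsum : a + l.sum = t := by rw [sum_eq_of_toFinset_eq hl hlF, ht]
    have hdl : d ∉ l := by rw [← List.mem_toFinset, hlF]; simp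
    have hlpos := hpos (Finset.erase_subset _ _) hlF
    by_cases hml : m ∈ stepSums a l
    · -- jump over `m`, the highest obstacle
      obtain ⟨u, c, w, rfl, hmc⟩ := mem_stepSums.1 hml
      have hperm : (u ++ d :: c :: w).Perm (d :: (u ++ c :: w)) := List.perm_middle
      refine ⟨u ++ d :: c :: w, ?_, ?_, ?_⟩
      · rw [hperm.nodup_iff, List.nodup_cons]
        exact ⟨hdl, hl⟩
      · rw [List.toFinset_eq_of_perm _ _ hperm, List.toFinset_cons, hlF, Finset.insert_erase hd]
      · have hcl : c ∈ u ++ c :: w := by simp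
        have hcpos := hlpos c hcl
        have hcd : lev c ≤ lev d := hdmax c (Finset.mem_of_mem_erase
          (by rw [← hlF]; exact List.mem_toFinset.2 hcl))
        have hlevm : lev m = lev (a + u.sum) + lev c := by rw [hmc, map_add]
        intro z hz hzM
        rw [stepSums_append, List.mem_append] at hz
        rcases hz with hz | hz
        · refine hlM z ?_ (Finset.mem_erase.2 ⟨?_, hzM⟩)
          · rw [stepSums_append]; exact List.mem_append_left _ hz
          · rintro rfl
            rcases eq_or_lt_of_mem_stepSums lev
              (fun e he => hlpos e (List.mem_append_left _ he)) hz with h | h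
            · rw [← h] at hlevm; linarith
            · linarith
        · have hzl := hmmax z hzM
          simp only [stepSums, List.mem_cons] at hz
          rcases hz with rfl | hz
          · rw [map_add] at hzl
            have hcd' : lev c = lev d := by linarith
            have := hinj hzM hm (by rw [map_add]; linarith)
            rw [hmc, add_right_inj] at this
            exact hdl (this ▸ hcl)
          · have : lev (a + u.sum + d) < lev z := by
              rcases hz with rfl | hz
              · rw [map_add lev (a + u.sum + d)]; linarith
              · have := lt_of_mem_stepSums lev
                  (fun e he => hlpos e (by simp [he])) hz
                rw [map_add lev (a + u.sum + d)] at this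
                linarith
            rw [map_add] at this
            linarith
    · refine ⟨l ++ [d], ?_, ?_, ?_⟩
      · rw [List.nodup_append]
        refine ⟨hl, by simp, ?_⟩
        intro x hx z hz
        rw [List.mem_singleton.1 hz]
        rintro rfl
        exact hdl hx
      · rw [List.toFinset_append, hlF]
        simp [Finset.insert_erase hd]
      · intro z hz hzM
        rw [stepSums_append, List.mem_append, hlsum] at hz
        rcases hz with hz | hz
        · exact hlM z hz (Finset.mem_erase.2 ⟨fun h => hml (h ▸ hz), hzM⟩)
        · simp only [stepSums, List.mem_cons, List.not_mem_nil, or_false] at hz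
          exact haM (by rwa [hz] at hzM)


theorem pairwise_stepSums (lev : K →+ ℚ) {a : K} {l : List K} (hl : ∀ d ∈ l, 0 < lev d) :
    (a :: stepSums a l).Pairwise (fun x y => lev x < lev y) := by
  induction l generalizing a with
  | nil => simp [stepSums]
  | cons d l ih =>
    refine List.pairwise_cons.2 ⟨fun y hy => lt_of_mem_stepSums lev hl hy, ?_⟩
    exact ih fun e he => hl e (by simp [he])

theorem injOn_stepSums (lev : K →+ ℚ) {a : K} {l : List K} (hl : ∀ d ∈ l, 0 < lev d) :
    Set.InjOn lev {y | y ∈ a :: stepSums a l} := by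
  have : ((a :: stepSums a l).map lev).Nodup :=
    List.pairwise_map.2 ((pairwise_stepSums lev hl).imp fun h => h.ne)
  exact fun x hx y hy h => List.inj_on_of_nodup_map this hx hy h

theorem end_mem_stepSums {a : K} {l : List K} (hl : l ≠ []) : a + l.sum ∈ stepSums a l := by
  obtain ⟨u, c, rfl⟩ := (List.eq_nil_or_concat' l).resolve_left hl
  exact mem_stepSums.2 ⟨u, c, [], rfl, by simp [add_assoc]⟩

theorem map_eq_of_mem_stepSums (lev : K →+ ℚ) {a y : K} {l : List K} (hl : ∀ d ∈ l, lev d = 0)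
    (hy : y ∈ stepSums a l) : lev y = lev a := by
  obtain ⟨u, c, w, rfl, rfl⟩ := mem_stepSums.1 hy
  have : lev u.sum = 0 := by
    rw [map_list_sum]
    refine List.sum_eq_zero fun x hx => ?_
    obtain ⟨d, hd, rfl⟩ := List.mem_map.1 hx
    exact hl d (by simp [hd])
  simp [this, hl c (by simp)]

theorem infix_sum_ne_zero_of_stepSums {l : List K} (hl : (stepSums 0 l).Nodup)
    (h0 : 0 ∈ stepSums 0 l → l.sum = 0) :
    ∀ v, v <:+: l → v ≠ [] → v ≠ l → v.sum ≠ 0 := by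
  rintro v ⟨u, w, rfl⟩ hv hvl hsum
  rw [stepSums_append, stepSums_append, List.nodup_append, List.nodup_append] at hl
  rw [stepSums_append, stepSums_append] at h0
  obtain ⟨⟨-, -, h1⟩, -, h2⟩ := hl
  have hve := end_mem_stepSums (a := 0 + u.sum) hv
  rcases eq_or_ne u [] with rfl | hu
  · have hw : w ≠ [] := by rintro rfl; simp at hvl
    have hwe := end_mem_stepSums (a := 0 + ([] ++ v : List K).sum) hw
    have h00 := h0 (List.mem_append_left _ (List.mem_append_right _ (by simpa [hsum] using hve)))
    refine h2 _ (List.mem_append_right _ hve) _ hwe ?_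
    simpa [hsum] using h00.symm
  · exact h1 _ (end_mem_stepSums hu) _ hve (by simp [hsum])

theorem nodup_cons_stepSums {l : List K} (hl : ∀ v, v <:+: l → v ≠ [] → v.sum ≠ 0) (a : K) :
    (a :: stepSums a l).Nodup := by
  induction l generalizing a with
  | nil => simp [stepSums]
  | cons d l ih =>
    refine List.nodup_cons.2 ⟨fun h => ?_, ih (fun v hv => hl v (hv.trans
      (List.suffix_cons d l).isInfix)) _⟩
    obtain ⟨u, c, w, hu, ha⟩ := mem_stepSums.1 h
    refine hl (u ++ [c]) ⟨[], w, by simp [hu]⟩ (by simp) ?_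
    rw [add_assoc, left_eq_add] at ha
    simpa using ha

theorem exists_walk_avoiding_point [DecidableEq K] (lev : K →+ ℚ) {J : Finset K} {a w : K}
    (hJ : ∀ d ∈ J, 0 < lev d) (hw : a + ∑ d ∈ J, d ≠ w) :
    ∃ l : List K, l.Nodup ∧ l.toFinset = J ∧ w ∉ stepSums a l := by
  by_cases h : 2 ≤ J.card
  · obtain ⟨l, h1, h2, h3⟩ := exists_walk_avoiding lev _ J {w} a rfl hJ (by simp)
      (by rw [Finset.card_singleton]; omega) (by simpa using hw)
    exact ⟨l, h1, h2, fun h => by simpa using h3 w h⟩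
  · refine ⟨J.toList, J.nodup_toList, J.toList_toFinset, fun hmem => ?_⟩
    obtain ⟨u, c, v, huv, rfl⟩ := mem_stepSums.1 hmem
    have hlen := congrArg List.length huv
    simp only [Finset.length_toList, List.length_append, List.length_cons] at hlen
    obtain rfl := List.length_eq_zero_iff.1 (show u.length = 0 by omega)
    obtain rfl := List.length_eq_zero_iff.1 (show v.length = 0 by omega)
    have := sum_eq_of_toFinset_eq J.nodup_toList J.toList_toFinset
    apply hw
    rw [← this, huv]
    simp

/-- A finite set of nonzero elements of which every subset can be ordered with nonzero proper
segment sums can be split into two lists with nonzero segment sums, the first having at most one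
element, which can be chosen different from `w`. -/
theorem exists_split_of_segments [DecidableEq K] {Z : Finset K} (h0 : (0 : K) ∉ Z)
    (hZ : ∀ Y ⊆ Z, ∃ l : List K, l.Nodup ∧ l.toFinset = Y ∧
      ∀ v, v <:+: l → v ≠ [] → v ≠ l → v.sum ≠ 0) (w : K) :
    ∃ t r : List K, (t = [] ∨ ∃ u, u ≠ w ∧ t = [u]) ∧ (t ++ r).Nodup ∧ (t ++ r).toFinset = Z ∧
      (∀ v, v <:+: t → v ≠ [] → v.sum ≠ 0) ∧ (∀ v, v <:+: r → v ≠ [] → v.sum ≠ 0) := by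
  obtain ⟨l, hl, hlZ, hseg⟩ := hZ Z subset_rfl
  by_cases hs : l = [] ∨ l.sum ≠ 0
  · refine ⟨[], l, Or.inl rfl, hl, hlZ, fun v hv hv' => absurd (List.infix_nil.1 hv) hv',
      fun v hv hv' => ?_⟩
    by_cases hvl : v = l
    · subst hvl
      exact hs.resolve_left hv'
    · exact hseg v hv hv' hvl
  · push Not at hs
    obtain ⟨hne, hsum⟩ := hs
    rw [sum_eq_of_toFinset_eq hl hlZ] at hsum
    have hu : ∃ u ∈ Z, u ≠ w := by
      by_contra! hcon
      rcases Finset.subset_singleton_iff.1 (fun x hx => Finset.mem_singleton.2 (hcon x hx)) with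
        h | h
      · rw [h, List.toFinset_eq_empty_iff] at hlZ
        exact hne hlZ
      · rw [h, Finset.sum_singleton] at hsum
        exact h0 (by rw [h, hsum]; simp)
    obtain ⟨u, huZ, huw⟩ := hu
    have hu0 : u ≠ 0 := fun h => h0 (h ▸ huZ)
    obtain ⟨r, hr, hrZ, hrseg⟩ := hZ (Z.erase u) (Finset.erase_subset _ _)
    refine ⟨[u], r, Or.inr ⟨u, huw, rfl⟩, ?_, ?_, ?_, ?_⟩
    · rw [List.singleton_append, List.nodup_cons, ← List.mem_toFinset, hrZ]
      exact ⟨by simp, hr⟩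
    · simp [hrZ, Finset.insert_erase huZ]
    · intro v hv hv'
      rw [List.infix_cons_iff, List.infix_nil, List.prefix_cons_iff] at hv
      rcases hv with (rfl | ⟨v, rfl, hv⟩) | rfl
      · simp at hv'
      · rw [List.prefix_nil] at hv
        simpa [hv] using hu0
      · simp at hv'
    · intro v hv hv'
      by_cases hvr : v = r
      · rw [hvr, sum_eq_of_toFinset_eq hr hrZ]
        intro h
        rw [← Finset.add_sum_erase _ _ huZ, h, add_zero] at hsum
        exact hu0 hsum
      · exact hrseg v hv hv' hvr

theorem exists_ordering_of_card_le [DecidableEq K] (lev : K →+ ℚ)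
    (hZ : ∀ Y : Finset K, (∀ y ∈ Y, lev y = 0 ∧ y ≠ 0) → ∃ l : List K, l.Nodup ∧
      l.toFinset = Y ∧ ∀ v, v <:+: l → v ≠ [] → v ≠ l → v.sum ≠ 0)
    (S : Finset K) (h0 : (0 : K) ∉ S)
    (hcard : (S.filter fun d => lev d < 0).card ≤ (S.filter fun d => 0 < lev d).card)
    (hcard' : 0 < lev (∑ d ∈ S, d) →
      (S.filter fun d => lev d < 0).card < (S.filter fun d => 0 < lev d).card)
    (hP : (S.filter fun d => 0 < lev d).Nonempty) :
    ∃ l : List K, l.Nodup ∧ l.toFinset = S ∧ ∀ v, v <:+: l → v ≠ [] → v ≠ l → v.sum ≠ 0 := by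
  set N := S.filter fun d => lev d < 0 with hN
  set P := S.filter fun d => 0 < lev d with hPdef
  set σ := ∑ d ∈ S, d with hσ
  have hPpos : ∀ d ∈ P, 0 < lev d := fun d hd => (Finset.mem_filter.1 hd).2
  have hNneg : ∀ d ∈ N, 0 < (-lev) d := fun d hd => by
    simpa using (Finset.mem_filter.1 hd).2
  obtain ⟨t, r, ht, htr, htrZ, htseg, hrseg⟩ := exists_split_of_segments
    (Z := S.filter fun d => lev d = 0) (by simp [h0])
    (fun Y hY => hZ Y fun y hy => ⟨(Finset.mem_filter.1 (hY hy)).2,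
      fun h => h0 (h ▸ (Finset.mem_filter.1 (hY hy)).1)⟩) σ
  have hmemZ : ∀ x, (x ∈ t ∨ x ∈ r) ↔ x ∈ S ∧ lev x = 0 := fun x => by
    rw [← List.mem_append, ← List.mem_toFinset, htrZ, Finset.mem_filter]
  have ht0 : ∀ d ∈ t, lev d = 0 := fun d hd => ((hmemZ d).1 (Or.inl hd)).2
  have hr0 : ∀ d ∈ r, lev d = 0 := fun d hd => ((hmemZ d).1 (Or.inr hd)).2
  have hsum0 : ∀ {l : List K}, (∀ d ∈ l, lev d = 0) → lev l.sum = 0 := fun hl => by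
    rw [map_list_sum]
    refine List.sum_eq_zero fun x hx => ?_
    obtain ⟨d, hd, rfl⟩ := List.mem_map.1 hx
    exact hl d hd
  have htsum := hsum0 ht0
  have hrsum := hsum0 hr0
  have hPsum : 0 < lev (∑ d ∈ P, d) := by
    rw [map_sum]
    exact Finset.sum_pos hPpos hP
  have hσsum : σ = ∑ d ∈ N, d + r.sum + ∑ d ∈ P, d + t.sum := by
    have h1 := sum_eq_of_toFinset_eq htr htrZ
    rw [List.sum_append] at h1
    have h2 : S = (N ∪ P) ∪ S.filter fun d => lev d = 0 := by
      ext x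
      simp only [hN, hPdef, Finset.mem_union, Finset.mem_filter]
      have := lt_trichotomy (lev x) 0
      clear * - this
      tauto
    rw [hσ, h2, Finset.sum_union, Finset.sum_union, ← h1]
    · abel
    · rw [Finset.disjoint_left]
      intro x hx hx'
      exact absurd (Finset.mem_filter.1 hx).2 (Finset.mem_filter.1 hx').2.not_gt
    · rw [Finset.disjoint_left]
      intro x hx hx'
      have h3 := (Finset.mem_filter.1 hx').2
      rcases Finset.mem_union.1 hx with hx | hx
      · exact absurd (Finset.mem_filter.1 hx).2 h3.not_lt
      · exact absurd (Finset.mem_filter.1 hx).2 h3.not_gt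
  have hlevσ : lev σ = lev (∑ d ∈ N, d) + lev (∑ d ∈ P, d) := by
    rw [hσsum]; simp [htsum, hrsum]
  have hassemble : ∀ {n p : List K}, n.Nodup → n.toFinset = N → p.Nodup → p.toFinset = P →
      (t ++ n ++ r ++ p).Nodup ∧ (t ++ n ++ r ++ p).toFinset = S := by
    intro n p hn hnN hp hpP
    have hmn : ∀ x, x ∈ n ↔ x ∈ S ∧ lev x < 0 := fun x => by
      rw [← List.mem_toFinset, hnN, hN, Finset.mem_filter]
    have hmp : ∀ x, x ∈ p ↔ x ∈ S ∧ 0 < lev x := fun x => by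
      rw [← List.mem_toFinset, hpP, hPdef, Finset.mem_filter]
    constructor
    · rw [List.nodup_append'] at htr
      obtain ⟨h1, h2, h3⟩ := htr
      simp only [List.nodup_append', List.disjoint_append_left]
      refine ⟨⟨⟨h1, hn, ?_⟩, h2, h3, ?_⟩, hp, ⟨?_, ?_⟩, ?_⟩
      · intro x hx hx'
        have h4 := ((hmn x).1 hx').2
        rw [ht0 x hx] at h4
        exact h4.false
      · intro x hx hx'
        have h4 := ((hmn x).1 hx).2
        rw [hr0 x hx'] at h4
        exact h4.false
      · intro x hx hx'
        have h4 := ((hmp x).1 hx').2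
        rw [ht0 x hx] at h4
        exact h4.false
      · intro x hx hx'
        exact ((hmp x).1 hx').2.not_gt ((hmn x).1 hx).2
      · intro x hx hx'
        have h4 := ((hmp x).1 hx').2
        rw [hr0 x hx] at h4
        exact h4.false
    · ext x
      simp only [List.mem_toFinset, List.mem_append, hmn, hmp]
      have h1 := hmemZ x
      have h2 := lt_trichotomy (lev x) 0
      clear * - h1 h2
      tauto
  rcases lt_or_ge (lev σ) 0 with hneg | hnonneg
  · obtain ⟨n, hn, hnN, hnσ⟩ := exists_walk_avoiding_point (-lev) (a := t.sum) (w := σ) hNneg (by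
      intro h
      have := congrArg lev h
      rw [hlevσ, map_add, htsum] at this
      linarith)
    have hnsum := sum_eq_of_toFinset_eq hn hnN
    have hnneg : ∀ d ∈ n, 0 < (-lev) d := fun d hd => hNneg d (hnN ▸ List.mem_toFinset.2 hd)
    have hnlen : n.length = N.card := by rw [← hnN, List.toFinset_card_of_nodup hn]
    have hnlt : lev n.sum < 0 := by rw [hnsum]; linarith
    set M := (stepSums t.sum n).toFinset.erase (t.sum + n.sum) with hM
    have hMsub : ∀ y ∈ M, y ∈ t.sum :: stepSums t.sum n := fun y hy =>
      List.mem_cons_of_mem _ (List.mem_toFinset.1 (Finset.mem_of_mem_erase hy))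
    obtain ⟨p, hp, hpP, hpM⟩ := exists_walk_avoiding lev _ P M (t.sum + n.sum + r.sum) rfl hPpos
      (by
        intro x hx y hy h
        exact injOn_stepSums (-lev) hnneg (hMsub x hx) (hMsub y hy) (by simpa using h))
      (by
        have hne : n ≠ [] := by rintro rfl; simp at hnlt
        rw [hM, Finset.card_erase_of_mem (List.mem_toFinset.2 (end_mem_stepSums hne))]
        have := List.toFinset_card_le (stepSums t.sum n)
        rw [length_stepSums] at this
        omega)
      (by
        rw [hM, show t.sum + n.sum + r.sum + ∑ d ∈ P, d = σ by rw [hσsum, hnsum]; abel]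
        exact fun h => hnσ (List.mem_toFinset.1 (Finset.mem_of_mem_erase h)))
    have hpsum := sum_eq_of_toFinset_eq hp hpP
    have hppos : ∀ d ∈ p, 0 < lev d := fun d hd => hPpos d (hpP ▸ List.mem_toFinset.2 hd)
    have e1 : ∀ y ∈ stepSums 0 t, lev y = 0 := fun y hy => by
      simpa using map_eq_of_mem_stepSums lev ht0 hy
    have e2 : ∀ y ∈ stepSums t.sum n, lev y < 0 := fun y hy => by
      have := lt_of_mem_stepSums (-lev) hnneg hy
      simp only [AddMonoidHom.neg_apply, htsum] at this
      linarith
    have e3 : ∀ y ∈ stepSums (t.sum + n.sum) r, lev y = lev n.sum := fun y hy => by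
      rw [map_eq_of_mem_stepSums lev hr0 hy, map_add, htsum, zero_add]
    have e4 : ∀ y ∈ stepSums (t.sum + n.sum + r.sum) p, lev n.sum < lev y ∧ lev y < 0 :=
      fun y hy => by
        have h1 := lt_of_mem_stepSums lev hppos hy
        have h2 := eq_or_lt_of_mem_stepSums lev hppos hy
        have h3 : t.sum + n.sum + r.sum + p.sum = σ := by rw [hσsum, hnsum, hpsum]; abel
        rw [h3] at h2
        simp only [map_add, htsum, hrsum] at h1
        refine ⟨by linarith, ?_⟩
        rcases h2 with rfl | h2 <;> linarith
    have hdn := pairwise_stepSums (-lev) hnneg (a := t.sum)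
    have hnd : (stepSums t.sum n).Nodup :=
      (List.pairwise_cons.1 hdn).2.imp fun {a b} h => by rintro rfl; exact h.false
    have hpd : (stepSums (t.sum + n.sum + r.sum) p).Nodup :=
      (List.pairwise_cons.1 (pairwise_stepSums lev hppos)).2.imp
        fun {a b} h => by rintro rfl; exact h.false
    have htd := List.nodup_cons.1 (nodup_cons_stepSums htseg 0)
    have hrd := List.nodup_cons.1 (nodup_cons_stepSums hrseg (t.sum + n.sum))
    have hsteps : stepSums 0 (t ++ n ++ r ++ p) = stepSums 0 t ++ stepSums t.sum n ++
        stepSums (t.sum + n.sum) r ++ stepSums (t.sum + n.sum + r.sum) p := by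
      simp [stepSums_append]
    refine ⟨t ++ n ++ r ++ p, (hassemble hn hnN hp hpP).1, (hassemble hn hnN hp hpP).2,
      infix_sum_ne_zero_of_stepSums ?_ ?_⟩
    · rw [hsteps]
      simp only [List.nodup_append', List.disjoint_append_left]
      refine ⟨⟨⟨htd.2, hnd, ?_⟩, hrd.2, ?_, ?_⟩, hpd, ⟨?_, ?_⟩, ?_⟩
      · intro y h1 h2
        exact absurd (e1 y h1) (e2 y h2).ne
      · intro y h1 h2
        have := e1 y h1
        have := e3 y h2
        linarith
      · intro y h1 h2
        have h3 := e3 y h2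
        rcases eq_or_lt_of_mem_stepSums (-lev) hnneg h1 with h | h
        · exact hrd.1 (h ▸ h2)
        · simp only [AddMonoidHom.neg_apply, map_add, htsum] at h
          linarith
      · intro y h1 h2
        exact absurd (e1 y h1) (e4 y h2).2.ne
      · intro y h1 h2
        have h3 : y = t.sum + n.sum := by
          by_contra h
          exact hpM y h2 (Finset.mem_erase.2 ⟨h, List.mem_toFinset.2 h1⟩)
        have h4 := (e4 y h2).1
        rw [h3, map_add, htsum] at h4
        linarith
      · intro y h1 h2
        have := e3 y h1
        have := (e4 y h2).1
        linarith
    · rw [hsteps]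
      simp only [List.mem_append]
      rintro (((h | h) | h) | h)
      · exact absurd h htd.1
      · exact absurd (map_zero lev) (e2 0 h).ne
      · have := e3 0 h
        rw [map_zero] at this
        linarith
      · exact absurd (map_zero lev) (e4 0 h).2.ne
  · set n := N.toList with hndef
    have hn : n.Nodup := N.nodup_toList
    have hnN : n.toFinset = N := N.toList_toFinset
    have hnsum := sum_eq_of_toFinset_eq hn hnN
    have hnneg : ∀ d ∈ n, 0 < (-lev) d := fun d hd => hNneg d (hnN ▸ List.mem_toFinset.2 hd)
    have hnlen : n.length = N.card := Finset.length_toList _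
    have hnd : (stepSums 0 n).Nodup :=
      (List.pairwise_cons.1 (pairwise_stepSums (-lev) hnneg)).2.imp
        fun {a b} h => by rintro rfl; exact h.false
    have e1 : ∀ y ∈ stepSums 0 n, lev y < 0 := fun y hy => by
      simpa using lt_of_mem_stepSums (-lev) hnneg hy
    have hMex : ∃ M : Finset K, (∀ y ∈ M, y ∈ 0 :: stepSums 0 n) ∧ M.card ≤ P.card - 1 ∧
        (∀ y ∈ M, lev y < lev σ) ∧ (∀ y ∈ stepSums 0 n, y ≠ n.sum → y ∈ M) ∧
        (0 < lev σ → 0 ≠ n.sum → 0 ∈ M) := by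
      rcases hnonneg.eq_or_lt with hz | hpos
      · refine ⟨(stepSums 0 n).toFinset.erase n.sum, ?_, ?_, ?_, ?_, ?_⟩
        · intro y hy
          exact List.mem_cons_of_mem _ (List.mem_toFinset.1 (Finset.mem_of_mem_erase hy))
        · have hne : n ≠ [] := by
            intro h
            rw [h, List.sum_nil] at hnsum
            rw [← hnsum, map_zero] at hlevσ
            linarith
          have := end_mem_stepSums (a := 0) hne
          rw [zero_add] at this
          rw [Finset.card_erase_of_mem (List.mem_toFinset.2 this)]
          have := List.toFinset_card_le (stepSums 0 n)
          rw [length_stepSums] at this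
          omega
        · intro y hy
          rw [← hz]
          exact e1 y (List.mem_toFinset.1 (Finset.mem_of_mem_erase hy))
        · exact fun y hy hne => Finset.mem_erase.2 ⟨hne, List.mem_toFinset.2 hy⟩
        · exact fun h => absurd h hz.not_lt
      · refine ⟨(0 :: stepSums 0 n).toFinset.erase n.sum, ?_, ?_, ?_, ?_, ?_⟩
        · intro y hy
          exact List.mem_toFinset.1 (Finset.mem_of_mem_erase hy)
        · have : n.sum ∈ 0 :: stepSums 0 n := by
            rcases eq_or_ne n [] with h | h
            · simp [h]
            · have := end_mem_stepSums (a := 0) h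
              rw [zero_add] at this
              exact List.mem_cons_of_mem _ this
          rw [Finset.card_erase_of_mem (List.mem_toFinset.2 this)]
          have := List.toFinset_card_le (0 :: stepSums 0 n)
          rw [List.length_cons, length_stepSums] at this
          have := hcard' hpos
          omega
        · intro y hy
          rcases List.mem_cons.1 (List.mem_toFinset.1 (Finset.mem_of_mem_erase hy)) with rfl | h
          · simpa using hpos
          · exact (e1 y h).trans hpos
        · exact fun y hy hne => Finset.mem_erase.2 ⟨hne, by simp [hy]⟩
        · exact fun _ h => Finset.mem_erase.2 ⟨h, by simp⟩
    obtain ⟨M, hMsub, hMcard, hMlev, hMmem, hM0⟩ := hMex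
    set τ := n.sum + r.sum + ∑ d ∈ P, d with hτ
    have hτσ : τ + t.sum = σ := by rw [hτ, hσsum, hnsum]
    have hlevτ : lev τ = lev σ := by
      rw [hlevσ, hτ, map_add, map_add, hrsum, add_zero, hnsum]
    obtain ⟨p, hp, hpP, hpM⟩ := exists_walk_avoiding lev _ P M (n.sum + r.sum) rfl hPpos
      (by
        intro x hx y hy h
        exact injOn_stepSums (-lev) hnneg (hMsub x hx) (hMsub y hy) (by simpa using h))
      hMcard
      (fun h => (hMlev _ h).ne hlevτ)
    have hpsum := sum_eq_of_toFinset_eq hp hpP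
    have hppos : ∀ d ∈ p, 0 < lev d := fun d hd => hPpos d (hpP ▸ List.mem_toFinset.2 hd)
    have hpd : (stepSums (n.sum + r.sum) p).Nodup :=
      (List.pairwise_cons.1 (pairwise_stepSums lev hppos)).2.imp
        fun {a b} h => by rintro rfl; exact h.false
    have e2 : ∀ y ∈ stepSums n.sum r, lev y = lev n.sum := fun y hy =>
      map_eq_of_mem_stepSums lev hr0 hy
    have e3 : ∀ y ∈ stepSums (n.sum + r.sum) p, lev n.sum < lev y := fun y hy => by
      simpa [hrsum] using lt_of_mem_stepSums lev hppos hy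
    have e3' : ∀ y ∈ stepSums (n.sum + r.sum) p, y = τ ∨ lev y < lev σ := fun y hy => by
      have := eq_or_lt_of_mem_stepSums lev hppos hy
      rwa [hpsum, ← hτ, hlevτ] at this
    have e4 : ∀ y ∈ stepSums τ t, lev y = lev σ := fun y hy => by
      rw [map_eq_of_mem_stepSums lev ht0 hy, hlevτ]
    have hlevn : lev n.sum < lev σ := by
      rw [hlevσ, hnsum]; linarith
    have htd := List.nodup_cons.1 (nodup_cons_stepSums htseg τ)
    have hrd := List.nodup_cons.1 (nodup_cons_stepSums hrseg n.sum)
    have hperm : (n ++ r ++ p ++ t).Perm (t ++ n ++ r ++ p) := by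
      have := List.perm_append_comm (l₁ := n ++ r ++ p) (l₂ := t)
      simpa using this
    have hsteps : stepSums 0 (n ++ r ++ p ++ t) = stepSums 0 n ++ stepSums n.sum r ++
        stepSums (n.sum + r.sum) p ++ stepSums τ t := by
      simp [stepSums_append, hτ, hpsum, add_assoc]
    refine ⟨n ++ r ++ p ++ t, hperm.nodup_iff.2 (hassemble hn hnN hp hpP).1, ?_,
      infix_sum_ne_zero_of_stepSums ?_ ?_⟩
    · rw [List.toFinset_eq_of_perm _ _ hperm]
      exact (hassemble hn hnN hp hpP).2
    · rw [hsteps]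
      simp only [List.nodup_append', List.disjoint_append_left]
      refine ⟨⟨⟨hnd, hrd.2, ?_⟩, hpd, ?_, ?_⟩, htd.2, ⟨?_, ?_⟩, ?_⟩
      · intro y h1 h2
        have h3 := e2 y h2
        rcases eq_or_lt_of_mem_stepSums (-lev) hnneg h1 with h | h
        · rw [zero_add] at h
          exact hrd.1 (h ▸ h2)
        · simp only [AddMonoidHom.neg_apply, zero_add] at h
          linarith
      · intro y h1 h2
        have h3 : y = n.sum := by
          by_contra h
          exact hpM y h2 (hMmem y h1 h)
        have h4 := e3 y h2
        rw [h3] at h4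
        exact h4.false
      · intro y h1 h2
        exact (e3 y h2).ne' (e2 y h1)
      · intro y h1 h2
        have := e1 y h1
        have := e4 y h2
        linarith
      · intro y h1 h2
        have := e2 y h1
        have := e4 y h2
        linarith
      · intro y h1 h2
        rcases e3' y h1 with h | h
        · exact htd.1 (h ▸ h2)
        · exact h.ne (e4 y h2)
    · have hlsum : (n ++ r ++ p ++ t).sum = σ := by
        rw [← hτσ, hτ, ← hpsum]
        simp [add_assoc]
      rw [hsteps, hlsum]
      simp only [List.mem_append]
      rintro (((h | h) | h) | h)
      · exact absurd (map_zero lev) (e1 0 h).ne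
      · exfalso
        have h1 := e2 0 h
        rcases eq_or_ne n [] with hne | hne
        · rw [hne] at h hrd
          exact hrd.1 h
        · have := end_mem_stepSums (a := 0) hne
          rw [zero_add] at this
          have := e1 _ this
          rw [map_zero] at h1
          linarith
      · have h1 := e3 0 h
        rw [map_zero] at h1
        rcases hnonneg.eq_or_lt with hz | hpos
        · have h2 : τ = 0 := by
            rcases e3' 0 h with h2 | h2
            · exact h2.symm
            · rw [map_zero, ← hz] at h2
              exact absurd h2 (lt_irrefl _)
          rw [h2, zero_add] at hτσ
          rcases ht with rfl | ⟨u, hu, rfl⟩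
          · exact hτσ.symm
          · exact absurd (by simpa using hτσ) hu
        · refine absurd (hM0 hpos ?_) (hpM 0 h)
          intro h2
          rw [← h2, map_zero] at h1
          exact h1.false
      · rcases ht with rfl | ⟨u, hu, rfl⟩
        · simp [stepSums] at h
        · simp only [stepSums, List.mem_singleton] at h
          rw [← hτσ, h]
          simp

/-- A finite set of nonzero elements of an abelian group can be ordered with nonzero proper
segment sums if this holds for the sets in the kernel of a homomorphism to the rationals. -/
theorem exists_ordering_of_ker [DecidableEq K] (lev : K →+ ℚ)
    (hZ : ∀ Y : Finset K, (∀ y ∈ Y, lev y = 0 ∧ y ≠ 0) → ∃ l : List K, l.Nodup ∧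
      l.toFinset = Y ∧ ∀ v, v <:+: l → v ≠ [] → v ≠ l → v.sum ≠ 0)
    (S : Finset K) (h0 : (0 : K) ∉ S) :
    ∃ l : List K, l.Nodup ∧ l.toFinset = S ∧ ∀ v, v <:+: l → v ≠ [] → v ≠ l → v.sum ≠ 0 := by
  have hne : ∀ {f : K → Prop} [DecidablePred f], ¬(S.filter f).Nonempty → ∀ x ∈ S, ¬ f x := by
    intro f _ h
    rwa [Finset.not_nonempty_iff_eq_empty, Finset.filter_eq_empty_iff] at h
  by_cases hS : ∀ y ∈ S, lev y = 0
  · exact hZ S fun y hy => ⟨hS y hy, fun h => h0 (h ▸ hy)⟩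
  by_cases h : (S.filter fun d => lev d < 0).card ≤ (S.filter fun d => 0 < lev d).card ∧
      (0 < lev (∑ d ∈ S, d) →
        (S.filter fun d => lev d < 0).card < (S.filter fun d => 0 < lev d).card)
  · refine exists_ordering_of_card_le lev hZ S h0 h.1 h.2 ?_
    by_contra hP
    rw [Finset.not_nonempty_iff_eq_empty.1 hP, Finset.card_empty, Nat.le_zero,
      Finset.card_eq_zero, Finset.filter_eq_empty_iff] at h
    exact hS fun y hy => le_antisymm (not_lt.1 (hne hP y hy)) (not_lt.1 (h.1 hy))
  · have h' : (S.filter fun d => 0 < lev d).card ≤ (S.filter fun d => lev d < 0).card ∧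
      (lev (∑ d ∈ S, d) < 0 →
        (S.filter fun d => 0 < lev d).card < (S.filter fun d => lev d < 0).card) := by
      rw [not_and_or, not_le, Classical.not_imp, not_lt] at h
      rcases h with h | h
      · exact ⟨h.le, fun _ => h⟩
      · exact ⟨h.2, fun h' => absurd h' h.1.not_gt⟩
    refine exists_ordering_of_card_le (-lev) (by simpa using hZ) S h0 (by simpa using h'.1)
      (by simpa using h'.2) ?_
    by_contra hP
    simp only [AddMonoidHom.neg_apply, Left.neg_pos_iff] at hP
    rw [Finset.not_nonempty_iff_eq_empty.1 hP, Finset.card_empty, Nat.le_zero,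
      Finset.card_eq_zero, Finset.filter_eq_empty_iff] at h'
    exact hS fun y hy => le_antisymm (not_lt.1 (h'.1 hy)) (not_lt.1 (hne hP y hy))

end Walks

section TwistedSums

variable {ι H R : Type*} [CommGroup H] [AddCommGroup R]

/-- The first coordinate of the product of the elements `(x i, h i)`, where `h i` acts on the
first coordinate through the sign `ε (h i)`. -/
def twistedSum (ε : H →* ℤˣ) (h : ι → H) (x : ι → R) : List ι → R
  | [] => 0
  | i :: l => x i + ((ε (h i) : ℤˣ) : ℤ) • twistedSum ε h x l

/-- No proper nonempty segment of the list `l` has a trivial product. -/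
def HasNontrivialSegments (ε : H →* ℤˣ) (h : ι → H) (x : ι → R) (l : List ι) : Prop :=
  ∀ v, v <:+: l → v ≠ [] → v ≠ l → ¬(twistedSum ε h x v = 0 ∧ (v.map h).prod = 1)

/-- Starting from the sign `s`, no step of the walk along the list goes down. -/
def IsWeaklyUp (ε : H →* ℤˣ) (h : ι → H) (x : ι → ℚ) : ℤˣ → List ι → Prop
  | _, [] => True
  | s, i :: l => 0 ≤ ((s : ℤ) : ℚ) * x i ∧ IsWeaklyUp ε h x (s * ε (h i)) l

/-- Nonempty segments on which `x` vanishes have a nontrivial product. -/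
def HasNontrivialZeroSegments (h : ι → H) (x : ι → ℚ) (l : List ι) : Prop :=
  ∀ v, v <:+: l → v ≠ [] → (∀ i ∈ v, x i = 0) → (v.map h).prod ≠ 1

/-- Alternate the elements of two lists, starting with the first one. -/
def alternate : List ι → List ι → List ι
  | a :: as, b :: bs => a :: b :: alternate as bs
  | _, _ => []

theorem twistedSum_neg (ε : H →* ℤˣ) (h : ι → H) (x : ι → R) (l : List ι) :
    twistedSum ε h (fun i => -x i) l = -twistedSum ε h x l := by
  induction l with
  | nil => simp [twistedSum]
  | cons i l ih => simp [twistedSum, ih]; abel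

theorem hasNontrivialSegments_neg {ε : H →* ℤˣ} {h : ι → H} {x : ι → R} {l : List ι} :
    HasNontrivialSegments ε h (fun i => -x i) l ↔ HasNontrivialSegments ε h x l := by
  simp [HasNontrivialSegments, twistedSum_neg]

theorem alternate_perm {as bs : List ι} (hl : as.length = bs.length) :
    (alternate as bs).Perm (as ++ bs) := by
  induction as generalizing bs with
  | nil =>
    obtain rfl := List.length_eq_zero_iff.1 hl.symm
    simp [alternate]
  | cons a as ih =>
    rcases bs with _ | ⟨b, bs⟩
    · simp at hl
    · have := ih (bs := bs) (by simpa using hl)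
      refine List.Perm.cons a ?_
      exact (List.Perm.cons b this).trans List.perm_middle.symm

section Signs

variable {ε : H →* ℤˣ} {h : ι → H} {x : ι → ℚ}

theorem isWeaklyUp_append {s : ℤˣ} {u v : List ι} :
    IsWeaklyUp ε h x s (u ++ v) ↔
      IsWeaklyUp ε h x s u ∧ IsWeaklyUp ε h x (s * ε (u.map h).prod) v := by
  induction u generalizing s with
  | nil => simp [IsWeaklyUp]
  | cons i u ih => simp [IsWeaklyUp, ih, and_assoc, mul_assoc]

theorem IsWeaklyUp.twistedSum_nonneg {s : ℤˣ} {l : List ι} (hl : IsWeaklyUp ε h x s l) :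
    0 ≤ ((s : ℤ) : ℚ) * twistedSum ε h x l ∧
      (twistedSum ε h x l = 0 → ∀ i ∈ l, x i = 0) := by
  induction l generalizing s with
  | nil => simp [twistedSum]
  | cons i l ih =>
    obtain ⟨h1, h2⟩ := hl
    obtain ⟨h3, h4⟩ := ih h2
    have he : ((s : ℤ) : ℚ) * twistedSum ε h x (i :: l) =
        ((s : ℤ) : ℚ) * x i + (((s * ε (h i) : ℤˣ) : ℤ) : ℚ) * twistedSum ε h x l := by
      simp only [twistedSum, zsmul_eq_mul]
      push_cast
      ring
    refine ⟨by rw [he]; positivity, fun h0 => ?_⟩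
    rw [h0, mul_zero] at he
    have h5 : ((s : ℤ) : ℚ) * x i = 0 := by linarith
    have h6 : (((s * ε (h i) : ℤˣ) : ℤ) : ℚ) * twistedSum ε h x l = 0 := by linarith
    have hu : ∀ t : ℤˣ, ((t : ℤ) : ℚ) ≠ 0 := fun t => by exact_mod_cast t.ne_zero
    intro j hj
    rcases List.mem_cons.1 hj with rfl | hj
    · exact (mul_eq_zero.1 h5).resolve_left (hu _)
    · exact h4 ((mul_eq_zero.1 h6).resolve_left (hu _)) j hj

theorem IsWeaklyUp.hasNontrivialSegments {s : ℤˣ} {l : List ι} (hl : IsWeaklyUp ε h x s l)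
    (hz : HasNontrivialZeroSegments h x l) : HasNontrivialSegments ε h x l := by
  rintro v ⟨u, w, rfl⟩ hv - ⟨h1, h2⟩
  rw [isWeaklyUp_append, isWeaklyUp_append] at hl
  exact hz v ⟨u, w, rfl⟩ hv (hl.1.2.twistedSum_nonneg.2 h1) h2

theorem isWeaklyUp_of_zero {s : ℤˣ} {l : List ι} (hl : ∀ i ∈ l, x i = 0) :
    IsWeaklyUp ε h x s l := by
  induction l generalizing s with
  | nil => trivial
  | cons i l ih =>
    exact ⟨by simp [hl i], ih fun j hj => hl j (by simp [hj])⟩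

theorem map_prod_eq_one {l : List ι} (hl : ∀ i ∈ l, ε (h i) = 1) : ε (l.map h).prod = 1 := by
  rw [map_list_prod, List.map_map]
  exact List.prod_eq_one (by simpa using hl)

theorem map_prod_eq_pow {l : List ι} (hl : ∀ i ∈ l, ε (h i) = -1) :
    ε (l.map h).prod = (-1) ^ l.length := by
  induction l with
  | nil => simp
  | cons i l ih =>
    rw [List.map_cons, List.prod_cons, map_mul, ih fun j hj => hl j (by simp [hj]), hl i (by simp),
      List.length_cons, pow_succ']

theorem isWeaklyUp_of_fixed {s : ℤˣ} {l : List ι} (hε : ∀ i ∈ l, ε (h i) = 1)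
    (hl : ∀ i ∈ l, 0 ≤ ((s : ℤ) : ℚ) * x i) : IsWeaklyUp ε h x s l := by
  induction l with
  | nil => trivial
  | cons i l ih =>
    refine ⟨hl i (by simp), ?_⟩
    rw [hε i (by simp), mul_one]
    exact ih (fun j hj => hε j (by simp [hj])) fun j hj => hl j (by simp [hj])

theorem isWeaklyUp_alternate {s : ℤˣ} {as bs : List ι} (ha : ∀ i ∈ as, ε (h i) = -1)
    (hb : ∀ i ∈ bs, ε (h i) = -1) (ha' : ∀ i ∈ as, 0 ≤ ((s : ℤ) : ℚ) * x i)
    (hb' : ∀ i ∈ bs, ((s : ℤ) : ℚ) * x i ≤ 0) : IsWeaklyUp ε h x s (alternate as bs) := by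
  induction as generalizing bs with
  | nil => trivial
  | cons a as ih =>
    rcases bs with _ | ⟨b, bs⟩
    · trivial
    · refine ⟨ha' a (by simp), ?_, ?_⟩
      · rw [ha a (by simp)]
        have := hb' b (by simp)
        push_cast
        linarith
      · rw [ha a (by simp), hb b (by simp), mul_assoc]
        simp only [mul_neg, mul_one, neg_neg]
        exact ih (fun j hj => ha j (by simp [hj])) (fun j hj => hb j (by simp [hj]))
          (fun j hj => ha' j (by simp [hj])) (fun j hj => hb' j (by simp [hj]))

theorem hasNontrivialZeroSegments_cons_of_ne {i : ι} {l : List ι} (hi : x i ≠ 0)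
    (hl : HasNontrivialZeroSegments h x l) : HasNontrivialZeroSegments h x (i :: l) := by
  intro v hv hv' hv0
  rcases List.infix_cons_iff.1 hv with hp | hv
  · rcases List.prefix_cons_iff.1 hp with rfl | ⟨t, rfl, -⟩
    · exact absurd rfl hv'
    · exact absurd (hv0 i (by simp)) hi
  · exact hl v hv hv' hv0

theorem hasNontrivialZeroSegments_cons {i : ι} {l : List ι} (hi : h i ≠ 1)
    (hhead : ∀ j ∈ l.head?, x j ≠ 0) (hl : HasNontrivialZeroSegments h x l) :
    HasNontrivialZeroSegments h x (i :: l) := by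
  intro v hv hv' hv0
  rcases List.infix_cons_iff.1 hv with hp | hv
  · rcases List.prefix_cons_iff.1 hp with rfl | ⟨t, rfl, ht⟩
    · exact absurd rfl hv'
    · rcases t with _ | ⟨j, t⟩
      · simpa using hi
      · obtain ⟨r, rfl⟩ := ht
        exact absurd (hv0 j (by simp)) (hhead j (by simp))
  · exact hl v hv hv' hv0

theorem hasNontrivialZeroSegments_append {u l : List ι} (hu : ∀ i ∈ u, x i ≠ 0)
    (hl : HasNontrivialZeroSegments h x l) : HasNontrivialZeroSegments h x (u ++ l) := by
  induction u with
  | nil => exact hl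
  | cons i u ih =>
    exact hasNontrivialZeroSegments_cons_of_ne (hu i (by simp)) (ih fun j hj => hu j (by simp [hj]))

theorem hasNontrivialZeroSegments_append_right {u l : List ι} (hl : ∀ i ∈ l, x i ≠ 0)
    (hu : HasNontrivialZeroSegments h x u) : HasNontrivialZeroSegments h x (u ++ l) := by
  intro v hv hv' hv0
  refine hu v ?_ hv' hv0
  obtain ⟨a, b, hab⟩ := hv
  rw [List.append_assoc, List.append_eq_append_iff] at hab
  rcases hab with ⟨c, rfl, hc⟩ | ⟨c, rfl, hc⟩
  · rcases List.append_eq_append_iff.1 hc with ⟨d, rfl, -⟩ | ⟨d, rfl, hd⟩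
    · exact ⟨a, d, by simp⟩
    · rcases d with _ | ⟨j, d⟩
      · exact ⟨a, [], by simp⟩
      · exact absurd (hv0 j (by simp)) (hl j (by simp [hd]))
  · obtain ⟨j, hj⟩ := List.exists_mem_of_ne_nil v hv'
    exact absurd (hv0 j hj) (hl j (by simp [hc, hj]))

theorem hasNontrivialZeroSegments_alternate_append {as bs l : List ι} (ha : ∀ i ∈ as, h i ≠ 1)
    (hb : ∀ i ∈ bs, x i ≠ 0) (hl : HasNontrivialZeroSegments h x l) :
    HasNontrivialZeroSegments h x (alternate as bs ++ l) := by
  induction as generalizing bs with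
  | nil => exact hl
  | cons a as ih =>
    rcases bs with _ | ⟨b, bs⟩
    · exact hl
    · refine hasNontrivialZeroSegments_cons (ha a (by simp)) ?_
        (hasNontrivialZeroSegments_cons_of_ne (hb b (by simp)) ?_)
      · simpa using hb b (by simp)
      · exact ih (fun j hj => ha j (by simp [hj])) (fun j hj => hb j (by simp [hj]))

end Signs

end TwistedSums

section Orderings

variable {ι H : Type*} [CommGroup H] {ε : H →* ℤˣ} {h : ι → H} {x : ι → ℚ}

theorem ne_one_of_map_eq_neg_one {g : H} (hg : ε g = -1) : g ≠ 1 := by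
  rintro rfl
  rw [map_one] at hg
  exact absurd hg (by decide)

theorem exists_odd_ordering {F₀ Z₀ Y : List ι} (hF₀ : ∀ i ∈ F₀, ε (h i) = -1 ∧ x i = 0)
    (hZ₀ : ∀ i ∈ Z₀, ε (h i) = 1 ∧ x i = 0 ∧ h i ≠ 1)
    (hT : ∀ Y : List ι, Y.Subperm (F₀ ++ Z₀) → ∃ T : List ι, T.Perm Y ∧
      ∀ v, v <:+: T → v ≠ [] → v ≠ T → (v.map h).prod ≠ 1)
    (hY : Y.Sublist F₀) (hodd : Odd Y.length) :
    ∃ T : List ι, T.Perm (Y ++ Z₀) ∧ (∀ i ∈ T, x i = 0) ∧ HasNontrivialZeroSegments h x T ∧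
      ε (T.map h).prod = -1 := by
  obtain ⟨T, hTY, hseg⟩ := hT (Y ++ Z₀) (hY.append (List.Sublist.refl _)).subperm
  have hε : ε (T.map h).prod = -1 := by
    rw [(hTY.map h).prod_eq, List.map_append, List.prod_append, map_mul,
      map_prod_eq_one fun i hi => (hZ₀ i hi).1,
      map_prod_eq_pow fun i hi => (hF₀ i (hY.subset hi)).1, hodd.neg_one_pow, mul_one]
  refine ⟨T, hTY, fun i hi => ?_, fun v hv hv' _ => ?_, hε⟩
  · rcases List.mem_append.1 (hTY.mem_iff.1 hi) with hi | hi
    · exact (hF₀ i (hY.subset hi)).2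
    · exact (hZ₀ i hi).2.1
  · rcases eq_or_ne v T with rfl | hvT
    · exact ne_one_of_map_eq_neg_one hε
    · exact hseg v hv hv' hvT

theorem hasNontrivialSegments_of_flip {P N as bs T : List ι} {a : ι}
    (hP : ∀ i ∈ P, ε (h i) = 1 ∧ 0 < x i) (hN : ∀ i ∈ N, ε (h i) = 1 ∧ x i < 0)
    (ha : ε (h a) = -1) (ha' : 0 ≤ x a) (has : ∀ i ∈ as, ε (h i) = -1 ∧ x i ≤ 0)
    (hbs : ∀ i ∈ bs, ε (h i) = -1 ∧ 0 < x i) (hT : ∀ i ∈ T, x i = 0)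
    (hT' : HasNontrivialZeroSegments h x T)
    (hhead : x a ≠ 0 ∨ ∀ j ∈ (N ++ (alternate as bs ++ T)).head?, x j ≠ 0) :
    HasNontrivialSegments ε h x (P ++ a :: (N ++ (alternate as bs ++ T))) := by
  refine IsWeaklyUp.hasNontrivialSegments (s := 1) ?_ ?_
  · rw [isWeaklyUp_append, map_prod_eq_one fun i hi => (hP i hi).1, mul_one]
    refine ⟨isWeaklyUp_of_fixed (fun i hi => (hP i hi).1) fun i hi => ?_, by simpa using ha', ?_⟩
    · simpa using (hP i hi).2.le
    rw [ha, isWeaklyUp_append, map_prod_eq_one fun i hi => (hN i hi).1, mul_one, one_mul]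
    refine ⟨isWeaklyUp_of_fixed (fun i hi => (hN i hi).1) fun i hi => ?_, ?_⟩
    · simpa using (hN i hi).2.le
    rw [isWeaklyUp_append]
    refine ⟨isWeaklyUp_alternate (fun i hi => (has i hi).1) (fun i hi => (hbs i hi).1)
      (fun i hi => ?_) (fun i hi => ?_), isWeaklyUp_of_zero hT⟩
    · simpa using (has i hi).2
    · simpa using (hbs i hi).2.le
  · have h1 : HasNontrivialZeroSegments h x (N ++ (alternate as bs ++ T)) :=
      hasNontrivialZeroSegments_append (fun i hi => (hN i hi).2.ne)
        (hasNontrivialZeroSegments_alternate_append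
          (fun i hi => ne_one_of_map_eq_neg_one (has i hi).1) (fun i hi => (hbs i hi).2.ne') hT')
    refine hasNontrivialZeroSegments_append (fun i hi => (hP i hi).2.ne') ?_
    rcases hhead with h2 | h2
    · exact hasNontrivialZeroSegments_cons_of_ne h2 h1
    · exact hasNontrivialZeroSegments_cons (ne_one_of_map_eq_neg_one ha) h2 h1

theorem hasNontrivialSegments_of_two_flips {P N as bs T U : List ι} {a b : ι}
    (hU : U = [] ∨ x a ≠ 0 ∧ ∃ u, U = [u] ∧ ε (h u) = 1 ∧ h u ≠ 1 ∧ x u = 0)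
    (hP : ∀ i ∈ P, ε (h i) = 1 ∧ 0 < x i) (hN : ∀ i ∈ N, ε (h i) = 1 ∧ x i < 0)
    (ha : ε (h a) = -1) (ha' : 0 ≤ x a) (hb : ε (h b) = -1) (hb' : x b < 0)
    (has : ∀ i ∈ as, ε (h i) = -1 ∧ 0 ≤ x i) (hbs : ∀ i ∈ bs, ε (h i) = -1 ∧ x i < 0)
    (hT : ∀ i ∈ T, x i = 0) (hT' : HasNontrivialZeroSegments h x T) :
    HasNontrivialSegments ε h x (U ++ (P ++ a :: (N ++ b :: (alternate as bs ++ T)))) := by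
  refine IsWeaklyUp.hasNontrivialSegments (s := 1) ?_ ?_
  · have hU1 : ∀ i ∈ U, ε (h i) = 1 := by
      rcases hU with rfl | ⟨-, u, rfl, hu, -⟩
      · simp
      · simpa using hu
    have hU0 : ∀ i ∈ U, x i = 0 := by
      rcases hU with rfl | ⟨-, u, rfl, -, -, hu⟩
      · simp
      · simpa using hu
    rw [isWeaklyUp_append, map_prod_eq_one hU1, mul_one]
    refine ⟨isWeaklyUp_of_zero hU0, ?_⟩
    rw [isWeaklyUp_append, map_prod_eq_one fun i hi => (hP i hi).1, mul_one]
    refine ⟨isWeaklyUp_of_fixed (fun i hi => (hP i hi).1) fun i hi => ?_, by simpa using ha', ?_⟩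
    · simpa using (hP i hi).2.le
    rw [ha, isWeaklyUp_append, map_prod_eq_one fun i hi => (hN i hi).1, mul_one, one_mul]
    refine ⟨isWeaklyUp_of_fixed (fun i hi => (hN i hi).1) fun i hi => ?_, ?_, ?_⟩
    · simpa using (hN i hi).2.le
    · simpa using hb'.le
    rw [hb, isWeaklyUp_append, neg_mul_neg, mul_one]
    refine ⟨isWeaklyUp_alternate (fun i hi => (has i hi).1) (fun i hi => (hbs i hi).1)
      (fun i hi => ?_) (fun i hi => ?_), isWeaklyUp_of_zero hT⟩
    · simpa using (has i hi).2
    · simpa using (hbs i hi).2.le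
  · have h1 : HasNontrivialZeroSegments h x (N ++ b :: (alternate as bs ++ T)) :=
      hasNontrivialZeroSegments_append (fun i hi => (hN i hi).2.ne)
        (hasNontrivialZeroSegments_cons_of_ne hb'.ne (hasNontrivialZeroSegments_alternate_append
          (fun i hi => ne_one_of_map_eq_neg_one (has i hi).1) (fun i hi => (hbs i hi).2.ne) hT'))
    have h2 : HasNontrivialZeroSegments h x (P ++ a :: (N ++ b :: (alternate as bs ++ T))) := by
      refine hasNontrivialZeroSegments_append (fun i hi => (hP i hi).2.ne')
        (hasNontrivialZeroSegments_cons (ne_one_of_map_eq_neg_one ha) ?_ h1)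
      rcases N with _ | ⟨j, N⟩
      · simpa using hb'.ne
      · simpa using (hN j (by simp)).2.ne
    rcases hU with rfl | ⟨hxa, u, rfl, -, hu, -⟩
    · exact h2
    · refine hasNontrivialZeroSegments_cons hu ?_ h2
      rcases P with _ | ⟨j, P⟩
      · simpa using hxa
      · simpa using (hP j (by simp)).2.ne'

theorem hasNontrivialSegments_of_odd_block {P N as bs T : List ι}
    (hP : ∀ i ∈ P, ε (h i) = 1 ∧ 0 < x i) (hN : ∀ i ∈ N, ε (h i) = 1 ∧ x i < 0)
    (has : ∀ i ∈ as, ε (h i) = -1 ∧ x i < 0) (hbs : ∀ i ∈ bs, ε (h i) = -1 ∧ 0 < x i)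
    (hlen : as.length = bs.length) (hT : ∀ i ∈ T, x i = 0)
    (hT' : HasNontrivialZeroSegments h x T) (hTε : ε (T.map h).prod = -1) :
    HasNontrivialSegments ε h x (P ++ (T ++ (N ++ alternate as bs))) := by
  refine IsWeaklyUp.hasNontrivialSegments (s := 1) ?_ ?_
  · rw [isWeaklyUp_append, map_prod_eq_one fun i hi => (hP i hi).1, mul_one]
    refine ⟨isWeaklyUp_of_fixed (fun i hi => (hP i hi).1) fun i hi => ?_, ?_⟩
    · simpa using (hP i hi).2.le
    rw [isWeaklyUp_append, hTε, one_mul]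
    refine ⟨isWeaklyUp_of_zero hT, ?_⟩
    rw [isWeaklyUp_append, map_prod_eq_one fun i hi => (hN i hi).1, mul_one]
    refine ⟨isWeaklyUp_of_fixed (fun i hi => (hN i hi).1) fun i hi => ?_,
      isWeaklyUp_alternate (fun i hi => (has i hi).1) (fun i hi => (hbs i hi).1)
        (fun i hi => ?_) (fun i hi => ?_)⟩
    · simpa using (hN i hi).2.le
    · simpa using (has i hi).2.le
    · simpa using (hbs i hi).2.le
  · refine hasNontrivialZeroSegments_append (fun i hi => (hP i hi).2.ne')
      (hasNontrivialZeroSegments_append_right (fun i hi => ?_) hT')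
    rcases List.mem_append.1 hi with hi | hi
    · exact (hN i hi).2.ne
    · rcases List.mem_append.1 ((alternate_perm hlen).mem_iff.1 hi) with hi | hi
      · exact (has i hi).2.ne
      · exact (hbs i hi).2.ne'

/-- The case of an odd number of flips. -/
theorem exists_perm_of_odd {P N Fp Fm F₀ Z₀ : List ι} (hP : ∀ i ∈ P, ε (h i) = 1 ∧ 0 < x i)
    (hN : ∀ i ∈ N, ε (h i) = 1 ∧ x i < 0) (hFp : ∀ i ∈ Fp, ε (h i) = -1 ∧ 0 < x i)
    (hFm : ∀ i ∈ Fm, ε (h i) = -1 ∧ x i < 0) (hF₀ : ∀ i ∈ F₀, ε (h i) = -1 ∧ x i = 0)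
    (hZ₀ : ∀ i ∈ Z₀, ε (h i) = 1 ∧ x i = 0 ∧ h i ≠ 1)
    (hT : ∀ Y : List ι, Y.Subperm (F₀ ++ Z₀) → ∃ T : List ι, T.Perm Y ∧
      ∀ v, v <:+: T → v ≠ [] → v ≠ T → (v.map h).prod ≠ 1)
    (hodd : Odd (Fp.length + Fm.length + F₀.length)) (hle : Fp.length ≤ Fm.length)
    (hm : Fm.length ≤ Fp.length + F₀.length) :
    ∃ l : List ι, l.Perm (P ++ N ++ (Fp ++ Fm) ++ F₀ ++ Z₀) ∧ HasNontrivialSegments ε h x l := by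
  rcases hle.eq_or_lt with heq | hlt
  · obtain ⟨T, hTY, hT0, hTz, hTε⟩ := exists_odd_ordering hF₀ hZ₀ hT (List.Sublist.refl F₀)
      (by rw [heq] at hodd; grind)
    refine ⟨_, ?_, hasNontrivialSegments_of_odd_block hP hN hFm hFp heq.symm hT0 hTz hTε⟩
    have := alternate_perm heq.symm
    rw [← Multiset.coe_eq_coe] at this hTY ⊢
    simp only [← Multiset.coe_add] at this hTY ⊢
    rw [this, hTY]
    abel
  · rcases F₀ with _ | ⟨u, F₀⟩
    · simp at hm; omega
    rcases Fm with _ | ⟨b, Fm⟩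
    · simp at hlt
    set e := Fm.length - Fp.length with he
    simp only [List.length_cons] at hlt hm hodd
    have hsub : (F₀.drop e).Sublist (u :: F₀) := (List.drop_sublist _ _).trans
      (List.sublist_cons_self _ _)
    obtain ⟨T, hTY, hT0, hTz, hTε⟩ := exists_odd_ordering hF₀ hZ₀ hT hsub
      (by rw [List.length_drop]; grind)
    have hu := hF₀ u (by simp)
    have hb := hFm b (by simp)
    have hlen : (Fp ++ F₀.take e).length = Fm.length := by
      rw [List.length_append, List.length_take]; grind
    refine ⟨_, ?_, hasNontrivialSegments_of_two_flips (as := Fp ++ F₀.take e) (bs := Fm)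
      (Or.inl rfl) hP hN hu.1 hu.2.ge hb.1 hb.2 ?_ (fun i hi => hFm i (by simp [hi])) hT0 hTz⟩
    · have := alternate_perm hlen
      have h1 := List.take_append_drop e F₀
      rw [← Multiset.coe_eq_coe] at this hTY ⊢
      conv_rhs => rw [← h1]
      simp only [← Multiset.coe_add, ← Multiset.cons_coe, ← Multiset.singleton_add,
        Multiset.coe_nil] at this hTY ⊢
      rw [this, hTY]
      abel
    · intro i hi
      rcases List.mem_append.1 hi with hi | hi
      · exact ⟨(hFp i hi).1, (hFp i hi).2.le⟩
      · have := hF₀ i (List.mem_cons_of_mem _ (List.mem_of_mem_take hi))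
        exact ⟨this.1, this.2.ge⟩

/-- The case of a positive even number of flips. -/
theorem exists_perm_of_even {P N Fp Fm F₀ Z₀ : List ι} (hP : ∀ i ∈ P, ε (h i) = 1 ∧ 0 < x i)
    (hN : ∀ i ∈ N, ε (h i) = 1 ∧ x i < 0) (hFp : ∀ i ∈ Fp, ε (h i) = -1 ∧ 0 < x i)
    (hFm : ∀ i ∈ Fm, ε (h i) = -1 ∧ x i < 0) (hF₀ : ∀ i ∈ F₀, ε (h i) = -1 ∧ x i = 0)
    (hZ₀ : ∀ i ∈ Z₀, ε (h i) = 1 ∧ x i = 0 ∧ h i ≠ 1)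
    (hT : ∀ Y : List ι, Y.Subperm (F₀ ++ Z₀) → ∃ T : List ι, T.Perm Y ∧
      ∀ v, v <:+: T → v ≠ [] → v ≠ T → (v.map h).prod ≠ 1)
    (heven : Even (Fp.length + Fm.length + F₀.length))
    (hpos : 0 < Fp.length + Fm.length + F₀.length) (hle : Fm.length ≤ Fp.length)
    (hp : Fp.length ≤ Fm.length + F₀.length) (hNe : F₀ ≠ [] → Fp = [] → N ≠ []) :
    ∃ l : List ι, l.Perm (P ++ N ++ (Fp ++ Fm) ++ F₀ ++ Z₀) ∧ HasNontrivialSegments ε h x l := by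
  rcases hle.eq_or_lt with heq | hlt
  · rcases F₀ with _ | ⟨u, F₀⟩
    · rcases Fp with _ | ⟨a, Fp⟩
      · simp at heq hpos; simp [heq] at hpos
      rcases Fm with _ | ⟨b, Fm⟩
      · simp at heq
      obtain ⟨T, hTY, hseg⟩ := hT Z₀ (List.nil_append Z₀ ▸ List.Subperm.refl _)
      have ha := hFp a (by simp)
      have hb := hFm b (by simp)
      have hT0 : ∀ i ∈ T, ε (h i) = 1 ∧ x i = 0 ∧ h i ≠ 1 := fun i hi =>
        hZ₀ i (hTY.mem_iff.1 hi)
      have hlen : Fp.length = Fm.length := by simpa using heq.symm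
      have hsplit : ∃ U V, T = U ++ V ∧ HasNontrivialZeroSegments h x V ∧
          (U = [] ∨ x a ≠ 0 ∧ ∃ u, U = [u] ∧ ε (h u) = 1 ∧ h u ≠ 1 ∧ x u = 0) := by
        rcases T with _ | ⟨u, T⟩
        · refine ⟨[], [], rfl, fun v hv hv' => absurd (List.infix_nil.1 hv) hv', Or.inl rfl⟩
        · have hu := hT0 u (by simp)
          refine ⟨[u], T, rfl, fun v hv hv' _ => ?_,
            Or.inr ⟨ha.2.ne', u, rfl, hu.1, hu.2.2, hu.2.1⟩⟩
          refine hseg v (hv.trans (List.suffix_cons u T).isInfix) hv' ?_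
          rintro rfl
          have := hv.length_le
          simp at this
      obtain ⟨U, V, rfl, hV, hU⟩ := hsplit
      refine ⟨_, ?_, hasNontrivialSegments_of_two_flips (as := Fp) (bs := Fm) hU hP hN ha.1 ha.2.le
        hb.1 hb.2 (fun i hi => ?_) (fun i hi => hFm i (by simp [hi]))
        (fun i hi => (hT0 i (by simp [hi])).2.1) hV⟩
      · have := alternate_perm hlen
        rw [← Multiset.coe_eq_coe] at this hTY ⊢
        simp only [← Multiset.coe_add, ← Multiset.cons_coe, ← Multiset.singleton_add,
          Multiset.coe_nil] at this hTY ⊢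
        rw [this, ← hTY]
        abel
      · have := hFp i (by simp [hi])
        exact ⟨this.1, this.2.le⟩
    · have hu := hF₀ u (by simp)
      simp only [List.length_cons] at heven
      obtain ⟨T, hTY, hT0, hTz, hTε⟩ := exists_odd_ordering hF₀ hZ₀ hT
        (List.sublist_cons_self u F₀) (by grind)
      refine ⟨_, ?_, hasNontrivialSegments_of_flip (as := Fm) (bs := Fp) hP hN hu.1 hu.2.ge
        (fun i hi => ⟨(hFm i hi).1, (hFm i hi).2.le⟩) hFp hT0 hTz (Or.inr ?_)⟩
      · have := alternate_perm heq
        rw [← Multiset.coe_eq_coe] at this hTY ⊢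
        simp only [← Multiset.coe_add, ← Multiset.cons_coe, ← Multiset.singleton_add] at this hTY ⊢
        rw [this, hTY]
        abel
      · rcases N with _ | ⟨j, N⟩
        · rcases Fp with _ | ⟨a, Fp⟩
          · simp at hNe
          rcases Fm with _ | ⟨b, Fm⟩
          · simp at heq
          simpa [alternate] using (hFm b (by simp)).2.ne
        · simpa using (hN j (by simp)).2.ne
  · rcases Fp with _ | ⟨a, Fp⟩
    · simp at hlt
    set e := Fp.length - Fm.length with he
    simp only [List.length_cons] at hlt hp heven
    have ha := hFp a (by simp)
    obtain ⟨T, hTY, hT0, hTz, hTε⟩ := exists_odd_ordering hF₀ hZ₀ hT (List.drop_sublist e F₀)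
      (by rw [List.length_drop]; grind)
    have hlen : (Fm ++ F₀.take e).length = Fp.length := by
      rw [List.length_append, List.length_take]; grind
    refine ⟨_, ?_, hasNontrivialSegments_of_flip (as := Fm ++ F₀.take e) (bs := Fp) hP hN ha.1
      ha.2.le (fun i hi => ?_) (fun i hi => hFp i (by simp [hi])) hT0 hTz (Or.inl ha.2.ne')⟩
    · have := alternate_perm hlen
      have h1 := List.take_append_drop e F₀
      rw [← Multiset.coe_eq_coe] at this hTY ⊢
      conv_rhs => rw [← h1]
      simp only [← Multiset.coe_add, ← Multiset.cons_coe, ← Multiset.singleton_add] at this hTY ⊢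
      rw [this, hTY]
      abel
    · rcases List.mem_append.1 hi with hi | hi
      · exact ⟨(hFm i hi).1, (hFm i hi).2.le⟩
      · have := hF₀ i (List.mem_of_mem_take hi)
        exact ⟨this.1, this.2.le⟩

end Orderings

section Existence

variable {ι H : Type*} [CommGroup H] {ε : H →* ℤˣ} {h : ι → H} {x : ι → ℚ}

theorem exists_map_eq {α β : Type*} [DecidableEq α] [DecidableEq β] {f : α → β} {Y : Finset α}
    {L : List β} (hL : L.Nodup) (hLY : L.toFinset = Y.image f) (hf : Set.InjOn f Y) :
    ∃ T : List α, T.Nodup ∧ T.toFinset = Y ∧ T.map f = L := by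
  have key : ∀ L : List β, (∀ b ∈ L, ∃ a ∈ Y, f a = b) →
      ∃ T : List α, (∀ a ∈ T, a ∈ Y) ∧ T.map f = L := by
    intro L
    induction L with
    | nil => exact fun _ => ⟨[], by simp⟩
    | cons b L ih =>
      intro hb
      obtain ⟨a, ha, hab⟩ := hb b (by simp)
      obtain ⟨T, hT, hTL⟩ := ih fun c hc => hb c (by simp [hc])
      exact ⟨a :: T, by simpa [ha] using hT, by simp [hab, hTL]⟩
  obtain ⟨T, hT, rfl⟩ := key L fun b hb => by
    have hb' := List.mem_toFinset.2 hb
    rw [hLY] at hb'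
    simpa using hb'
  refine ⟨T, hL.of_map f, ?_, rfl⟩
  ext a
  rw [List.mem_toFinset]
  refine ⟨hT a, fun ha => ?_⟩
  have : f a ∈ (T.map f).toFinset := by
    rw [hLY]
    exact Finset.mem_image_of_mem f ha
  obtain ⟨b, hb, hab⟩ := List.mem_map.1 (List.mem_toFinset.1 this)
  rwa [← hf (hT b hb) ha hab]

theorem segment_map {α β : Type*} {f : α → β} {v T : List α} (hv : v <:+: T) (hv' : v ≠ [])
    (hvT : v ≠ T) : v.map f <:+: T.map f ∧ v.map f ≠ [] ∧ v.map f ≠ T.map f := by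
  refine ⟨hv.map f, by simpa using hv', fun h => hvT (hv.eq_of_length ?_)⟩
  simpa using congrArg List.length h

theorem exists_ordering_of_le [Fintype ι] [DecidableEq ι] (hne : ∀ i, x i = 0 → h i ≠ 1)
    (hT : ∀ Y : Finset ι, (∀ i ∈ Y, x i = 0) → ∃ T : List ι, T.Nodup ∧ T.toFinset = Y ∧
      ∀ v, v <:+: T → v ≠ [] → v ≠ T → (v.map h).prod ≠ 1)
    (hflip : ∃ i, ε (h i) = -1)
    (hp : (Finset.univ.filter fun i => ε (h i) = -1 ∧ 0 < x i).card ≤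
      (Finset.univ.filter fun i => ε (h i) = -1 ∧ x i ≤ 0).card)
    (hm : (Finset.univ.filter fun i => ε (h i) = -1 ∧ x i < 0).card ≤
      (Finset.univ.filter fun i => ε (h i) = -1 ∧ 0 ≤ x i).card) :
    ∃ l : List ι, l.Nodup ∧ (∀ i, i ∈ l) ∧ HasNontrivialSegments ε h x l := by
  set P := (Finset.univ.filter fun i => ε (h i) = 1 ∧ 0 < x i).toList with hPd
  set N := (Finset.univ.filter fun i => ε (h i) = 1 ∧ x i < 0).toList with hNd
  set Z₀ := (Finset.univ.filter fun i => ε (h i) = 1 ∧ x i = 0).toList with hZd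
  set Fp := (Finset.univ.filter fun i => ε (h i) = -1 ∧ 0 < x i).toList with hFpd
  set Fm := (Finset.univ.filter fun i => ε (h i) = -1 ∧ x i < 0).toList with hFmd
  set F₀ := (Finset.univ.filter fun i => ε (h i) = -1 ∧ x i = 0).toList with hF₀d
  have mP : ∀ i, i ∈ P ↔ ε (h i) = 1 ∧ 0 < x i := by simp [hPd]
  have mN : ∀ i, i ∈ N ↔ ε (h i) = 1 ∧ x i < 0 := by simp [hNd]
  have mZ : ∀ i, i ∈ Z₀ ↔ ε (h i) = 1 ∧ x i = 0 := by simp [hZd]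
  have mFp : ∀ i, i ∈ Fp ↔ ε (h i) = -1 ∧ 0 < x i := by simp [hFpd]
  have mFm : ∀ i, i ∈ Fm ↔ ε (h i) = -1 ∧ x i < 0 := by simp [hFmd]
  have mF₀ : ∀ i, i ∈ F₀ ↔ ε (h i) = -1 ∧ x i = 0 := by simp [hF₀d]
  have hmem : ∀ i, i ∈ P ++ N ++ (Fp ++ Fm) ++ F₀ ++ Z₀ := by
    intro i
    simp only [List.mem_append, mP, mN, mZ, mFp, mFm, mF₀]
    have h1 := Int.units_eq_one_or (ε (h i))
    have h2 := lt_trichotomy (x i) 0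
    clear * - h1 h2
    tauto
  have hne1 : ∀ i, ε (h i) = 1 → ε (h i) ≠ -1 := fun i hi => by rw [hi]; decide
  have hnodup : (P ++ N ++ (Fp ++ Fm) ++ F₀ ++ Z₀).Nodup := by
    have nP : P.Nodup := Finset.nodup_toList _
    have nN : N.Nodup := Finset.nodup_toList _
    have nZ : Z₀.Nodup := Finset.nodup_toList _
    have nFp : Fp.Nodup := Finset.nodup_toList _
    have nFm : Fm.Nodup := Finset.nodup_toList _
    have nF₀ : F₀.Nodup := Finset.nodup_toList _
    simp only [List.nodup_append', List.disjoint_left, List.mem_append, mP, mN, mZ, mFp, mFm, mF₀,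
      nP, nN, nZ, nFp, nFm, nF₀]
    clear * - hne1
    grind
  have hfin : ∀ l : List ι, l.Perm (P ++ N ++ (Fp ++ Fm) ++ F₀ ++ Z₀) →
      l.Nodup ∧ ∀ i, i ∈ l := fun l hl =>
    ⟨hl.nodup_iff.2 hnodup, fun i => hl.mem_iff.2 (hmem i)⟩
  have hT' : ∀ Y : List ι, Y.Subperm (F₀ ++ Z₀) → ∃ T : List ι, T.Perm Y ∧
      ∀ v, v <:+: T → v ≠ [] → v ≠ T → (v.map h).prod ≠ 1 := by
    intro Y hY
    have hYn : Y.Nodup := by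
      obtain ⟨Y', hY', hsub⟩ := hY
      rw [List.append_assoc] at hnodup
      exact hY'.nodup_iff.1 ((List.nodup_append'.1 hnodup).2.1.sublist hsub)
    obtain ⟨T, h1, h2, h3⟩ := hT Y.toFinset fun i hi => by
      rcases List.mem_append.1 (hY.subset (List.mem_toFinset.1 hi)) with hi | hi
      · exact ((mF₀ i).1 hi).2
      · exact ((mZ i).1 hi).2
    exact ⟨T, List.perm_of_nodup_nodup_toFinset_eq h1 hYn h2, h3⟩
  have hlep : Fp.length ≤ Fm.length + F₀.length := by
    simp only [hFpd, hFmd, hF₀d, Finset.length_toList]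
    refine hp.trans ((Finset.card_le_card ?_).trans (Finset.card_union_le _ _))
    intro i hi
    simpa [le_iff_lt_or_eq, and_or_left] using hi
  have hlem : Fm.length ≤ Fp.length + F₀.length := by
    simp only [hFpd, hFmd, hF₀d, Finset.length_toList]
    refine hm.trans ((Finset.card_le_card ?_).trans (Finset.card_union_le _ _))
    intro i hi
    simpa [le_iff_lt_or_eq, and_or_left, eq_comm] using hi
  have hpos : 0 < Fp.length + Fm.length + F₀.length := by
    obtain ⟨i, hi⟩ := hflip
    have := hmem i
    have h1 : i ∈ Fp ++ Fm ++ F₀ := by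
      simp only [List.mem_append, mP, mN, mZ, mFp, mFm, mF₀, hi] at this ⊢
      have h2 : (-1 : ℤˣ) ≠ 1 := by decide
      clear * - this h2
      tauto
    have := List.length_pos_of_mem h1
    simpa [add_assoc] using this
  have kP : ∀ i ∈ P, ε (h i) = 1 ∧ 0 < x i := fun i hi => (mP i).1 hi
  have kN : ∀ i ∈ N, ε (h i) = 1 ∧ x i < 0 := fun i hi => (mN i).1 hi
  have kZ : ∀ i ∈ Z₀, ε (h i) = 1 ∧ x i = 0 ∧ h i ≠ 1 := fun i hi =>
    ⟨((mZ i).1 hi).1, ((mZ i).1 hi).2, hne i ((mZ i).1 hi).2⟩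
  have kFp : ∀ i ∈ Fp, ε (h i) = -1 ∧ 0 < x i := fun i hi => (mFp i).1 hi
  have kFm : ∀ i ∈ Fm, ε (h i) = -1 ∧ x i < 0 := fun i hi => (mFm i).1 hi
  have kF₀ : ∀ i ∈ F₀, ε (h i) = -1 ∧ x i = 0 := fun i hi => (mF₀ i).1 hi
  have hneg : (∃ l : List ι, l.Perm (N ++ P ++ (Fm ++ Fp) ++ F₀ ++ Z₀) ∧
      HasNontrivialSegments ε h (fun i => -x i) l) →
      ∃ l : List ι, l.Perm (P ++ N ++ (Fp ++ Fm) ++ F₀ ++ Z₀) ∧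
        HasNontrivialSegments ε h x l := by
    rintro ⟨l, hl, hl'⟩
    refine ⟨l, hl.trans ?_, hasNontrivialSegments_neg.1 hl'⟩
    rw [← Multiset.coe_eq_coe]
    simp only [← Multiset.coe_add]
    abel
  suffices hs : ∃ l : List ι, l.Perm (P ++ N ++ (Fp ++ Fm) ++ F₀ ++ Z₀) ∧
      HasNontrivialSegments ε h x l by
    obtain ⟨l, hl, hl'⟩ := hs
    exact ⟨l, (hfin l hl).1, (hfin l hl).2, hl'⟩
  clear_value P N Z₀ Fp Fm F₀
  clear hp hm hPd hNd hZd hFpd hFmd hF₀d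
  have negP : ∀ i ∈ P, ε (h i) = 1 ∧ -x i < 0 := by simpa using kP
  have negN : ∀ i ∈ N, ε (h i) = 1 ∧ 0 < -x i := by simpa using kN
  have negFp : ∀ i ∈ Fp, ε (h i) = -1 ∧ -x i < 0 := by simpa using kFp
  have negFm : ∀ i ∈ Fm, ε (h i) = -1 ∧ 0 < -x i := by simpa using kFm
  have negF₀ : ∀ i ∈ F₀, ε (h i) = -1 ∧ -x i = 0 := by simpa using kF₀
  have negZ : ∀ i ∈ Z₀, ε (h i) = 1 ∧ -x i = 0 ∧ h i ≠ 1 := by simpa using kZ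
  rcases Nat.even_or_odd (Fp.length + Fm.length + F₀.length) with heven | hodd
  · by_cases hempty : (Fp = [] ∧ Fm = []) ∧ N = [] ∧ P = []
    · obtain ⟨⟨rfl, rfl⟩, rfl, rfl⟩ := hempty
      obtain ⟨T, hTY, hseg⟩ := hT' (F₀ ++ Z₀) (List.Subperm.refl _)
      exact ⟨T, by simpa using hTY, fun v hv hv' hvT hv1 => hseg v hv hv' hvT hv1.2⟩
    · have hlen : Fp = [] ↔ Fp.length = 0 := List.length_eq_zero_iff.symm
      have hlen' : Fm = [] ↔ Fm.length = 0 := List.length_eq_zero_iff.symm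
      rcases lt_trichotomy Fm.length Fp.length with hlt | heq | hlt
      · exact exists_perm_of_even kP kN kFp kFm kF₀ kZ hT' heven hpos hlt.le hlep
          (by intro _ h'; rw [hlen] at h'; omega)
      · by_cases hN : Fp = [] → N ≠ []
        · exact exists_perm_of_even kP kN kFp kFm kF₀ kZ hT' heven hpos heq.le hlep fun _ => hN
        · rw [Classical.not_imp, not_not] at hN
          refine hneg (exists_perm_of_even negN negP negFm negFp negF₀ negZ hT'
            (by rwa [add_comm Fm.length]) (by rwa [add_comm Fm.length]) heq.ge hlem ?_)
          intro _ _ hP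
          exact hempty ⟨⟨hN.1, by rw [hlen', heq, ← hlen]; exact hN.1⟩, hN.2, hP⟩
      · refine hneg (exists_perm_of_even negN negP negFm negFp negF₀ negZ hT'
            (by rwa [add_comm Fm.length]) (by rwa [add_comm Fm.length]) hlt.le hlem ?_)
        intro _ h'
        rw [hlen'] at h'
        omega
  · rcases le_total Fp.length Fm.length with hle | hle
    · exact exists_perm_of_odd kP kN kFp kFm kF₀ kZ hT' hodd hle hlem
    · exact hneg (exists_perm_of_odd negN negP negFm negFp negF₀ negZ hT'
        (by rwa [add_comm Fm.length]) hle hlep)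

theorem exists_median {α : Type*} (F : Finset α) (hF : F.Nonempty) (x : α → ℚ) :
    ∃ c, (F.filter fun i => c < x i).card ≤ (F.filter fun i => x i ≤ c).card ∧
      (F.filter fun i => x i < c).card ≤ (F.filter fun i => c ≤ x i).card := by
  have hne : (F.filter fun i => (F.filter fun j => x i < x j).card ≤
      (F.filter fun j => x j ≤ x i).card).Nonempty := by
    obtain ⟨i, hi, hmax⟩ := F.exists_max_image x hF
    refine ⟨i, Finset.mem_filter.2 ⟨hi, ?_⟩⟩
    rw [Finset.filter_eq_empty_iff.2 fun j hj => (hmax j hj).not_gt]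
    simp
  obtain ⟨i, hi, hmin⟩ := Finset.exists_min_image _ x hne
  obtain ⟨hiF, hi⟩ := Finset.mem_filter.1 hi
  refine ⟨x i, hi, ?_⟩
  rcases (F.filter fun j => x j < x i).eq_empty_or_nonempty with h | h
  · simp [h]
  · obtain ⟨j, hj, hmax⟩ := Finset.exists_max_image _ x h
    obtain ⟨hjF, hji⟩ := Finset.mem_filter.1 hj
    have h1 : ¬ (F.filter fun k => x j < x k).card ≤ (F.filter fun k => x k ≤ x j).card :=
      fun h1 => (hmin j (Finset.mem_filter.2 ⟨hjF, h1⟩)).not_gt hji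
    have h2 : (F.filter fun k => x j < x k) = F.filter fun k => x i ≤ x k := by
      refine Finset.filter_congr fun k hk => ⟨fun h3 => ?_, hji.trans_le⟩
      by_contra! h4
      exact (hmax k (Finset.mem_filter.2 ⟨hk, h4⟩)).not_gt h3
    have h3 : (F.filter fun k => x k ≤ x j) = F.filter fun k => x k < x i :=
      Finset.filter_congr fun k hk => ⟨fun h3 => h3.trans_lt hji,
        fun h3 => hmax k (Finset.mem_filter.2 ⟨hk, h3⟩)⟩
    rw [h2, h3] at h1
    omega

theorem twistedSum_sub (c : ℚ) (l : List ι) :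
    twistedSum ε h (fun i => x i - if ε (h i) = -1 then c else 0) l =
      twistedSum ε h x l - if ε (l.map h).prod = -1 then c else 0 := by
  induction l with
  | nil =>
    have : (1 : ℤˣ) ≠ -1 := by decide
    simp [twistedSum, this]
  | cons i l ih =>
    simp only [twistedSum, ih, List.map_cons, List.prod_cons, map_mul]
    have h1 : (1 : ℤˣ) ≠ -1 := by decide
    rcases Int.units_eq_one_or (ε (h i)) with hi | hi
    · simp only [hi, if_neg h1, one_mul, Units.val_one, one_smul]
      ring
    · rcases Int.units_eq_one_or (ε (l.map h).prod) with hl | hl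
      · simp [hi, hl, h1]
        ring
      · simp [hi, hl, h1]
        ring

end Existence

section Transfer

theorem prod_take_ne_iff {G : Type*} [Group G] (l : List G) :
    (∀ i j : ℕ, i < j → j ≤ l.length → ¬(i = 0 ∧ j = l.length) →
      (l.take i).prod ≠ (l.take j).prod) ↔
    ∀ v, v <:+: l → v ≠ [] → v ≠ l → v.prod ≠ 1 := by
  constructor
  · rintro hl v ⟨u, w, rfl⟩ hv hvl hprod
    have hpos := List.length_pos_iff.2 hv
    refine hl u.length (u.length + v.length) (by omega) (by simp) ?_ ?_
    · rintro ⟨h1, h2⟩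
      obtain rfl := List.length_eq_zero_iff.1 h1
      obtain rfl := List.length_eq_zero_iff.1 (show w.length = 0 by simp at h2; simp [h2])
      simp at hvl
    · rw [← List.length_append, List.take_left, List.append_assoc, List.take_left,
        List.prod_append, hprod, mul_one]
  · intro hl i j hij hj hne hprod
    have hsplit : l.take j = l.take i ++ (l.take j).drop i := by
      conv_lhs => rw [← List.take_append_drop i (l.take j)]
      rw [List.take_take, min_eq_left hij.le]
    have hlen : ((l.take j).drop i).length = j - i := by
      rw [List.length_drop, List.length_take, min_eq_left hj]
    refine hl ((l.take j).drop i) ?_ ?_ ?_ ?_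
    · exact (List.drop_suffix _ _).isInfix.trans (List.take_prefix _ _).isInfix
    · intro h
      rw [h, List.length_nil] at hlen
      omega
    · intro h
      rw [h] at hlen
      omega
    · rw [hsplit, List.prod_append] at hprod
      exact left_eq_mul.1 hprod

variable {ι H R : Type*} [CommGroup H] [AddCommGroup R] {ε : H →* ℤˣ} {h : ι → H}

theorem twistedSum_eq_sum_map (hε : ∀ i, ε (h i) = 1) (x : ι → R) (l : List ι) :
    twistedSum ε h x l = (l.map x).sum := by
  induction l with
  | nil => rfl
  | cons i l ih => simp [twistedSum, ih, hε]

theorem map_twistedSum {R' : Type*} [AddCommGroup R'] (f : R →+ R') (x : ι → R) (l : List ι) :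
    twistedSum ε h (fun i => f (x i)) l = f (twistedSum ε h x l) := by
  induction l with
  | nil => simp [twistedSum]
  | cons i l ih => simp [twistedSum, ih]

theorem twistedSum_single_bound [DecidableEq ι] {l : List ι} (hl : l.Nodup) (i : ι) :
    |twistedSum ε h (fun j => (Pi.single j 1 : ι → ℤ)) l i| ≤ 1 ∧
      (i ∉ l → twistedSum ε h (fun j => (Pi.single j 1 : ι → ℤ)) l i = 0) := by
  induction l with
  | nil => simp [twistedSum]
  | cons j l ih =>
    obtain ⟨hj, hl⟩ := List.nodup_cons.1 hl
    obtain ⟨h1, h2⟩ := ih hl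
    have hu : |((ε (h j) : ℤˣ) : ℤ)| = 1 := Int.isUnit_iff_abs_eq.1 (ε (h j)).isUnit
    simp only [twistedSum, Pi.add_apply, Pi.smul_apply, smul_eq_mul]
    rcases eq_or_ne i j with rfl | hij
    · rw [h2 hj]
      simp
    · rw [Pi.single_eq_of_ne hij, zero_add, abs_mul, hu, one_mul]
      refine ⟨h1, fun hi => ?_⟩
      rw [h2 fun h => hi (List.mem_cons_of_mem _ h), mul_zero]

theorem twistedSum_eq_sum_single [Fintype ι] [DecidableEq ι] (x : ι → R) (l : List ι) :
    twistedSum ε h x l =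
      ∑ i, twistedSum ε h (fun j => (Pi.single j 1 : ι → ℤ)) l i • x i := by
  let f : (ι → ℤ) →+ R :=
    { toFun := fun c => ∑ i, c i • x i
      map_zero' := by simp
      map_add' := fun a b => by simp [add_smul, Finset.sum_add_distrib] }
  have hf : ∀ i, f (Pi.single i 1) = x i := fun i => by
    simp [f, Pi.single_apply]
  have := map_twistedSum (ε := ε) (h := h) f (fun j => (Pi.single j 1 : ι → ℤ)) l
  simp only [hf] at this
  exact this

theorem exists_ordering_of_rat [Fintype ι] [DecidableEq ι] [DecidableEq H]
    (hH : ∀ Y : Finset H, 1 ∉ Y → ∃ L : List H, L.Nodup ∧ L.toFinset = Y ∧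
      ∀ v, v <:+: L → v ≠ [] → v ≠ L → v.prod ≠ 1)
    {x : ι → ℚ} (hinj : ∀ i j, x i = x j → h i = h j → i = j) (hne : ∀ i, x i = 0 → h i ≠ 1) :
    ∃ l : List ι, l.Nodup ∧ (∀ i, i ∈ l) ∧ HasNontrivialSegments ε h x l := by
  by_cases hflip : ∃ i, ε (h i) = -1
  · obtain ⟨c, hc1, hc2⟩ := exists_median (Finset.univ.filter fun i => ε (h i) = -1)
      (by simpa [Finset.Nonempty] using hflip) x
    set x' : ι → ℚ := fun i => x i - if ε (h i) = -1 then c else 0 with hx'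
    have hx'f : ∀ i, ε (h i) = -1 → x' i = x i - c := fun i hi => by simp [hx', hi]
    have hinj' : ∀ i j, x' i = x' j → h i = h j → i = j := by
      intro i j hij hhij
      refine hinj i j ?_ hhij
      simpa [hx', hhij] using hij
    have hne' : ∀ i, x' i = 0 → h i ≠ 1 := by
      intro i hi h1
      have h2 : (1 : ℤˣ) ≠ -1 := by decide
      simp only [hx', h1, map_one, if_neg h2, sub_zero] at hi
      exact hne i hi h1
    rw [Finset.filter_filter, Finset.filter_filter] at hc1 hc2
    refine (exists_ordering_of_le (ε := ε) (h := h) (x := x') hne' ?_ hflip ?_ ?_).elim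
      fun l ⟨h1, h2, h3⟩ => ?_
    · intro Y hY
      obtain ⟨L, hL, hLY, hseg⟩ := hH (Y.image h) fun h1 => by
        obtain ⟨i, hi, hi'⟩ := Finset.mem_image.1 h1
        exact hne' i (hY i hi) hi'
      obtain ⟨T, hT, hTY, rfl⟩ := exists_map_eq hL hLY fun i hi j hj hij =>
        hinj' i j ((hY i hi).trans (hY j hj).symm) hij
      refine ⟨T, hT, hTY, fun v hv hv' hvT => ?_⟩
      obtain ⟨h1, h2, h3⟩ := segment_map (f := h) hv hv' hvT
      exact hseg _ h1 h2 h3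
    · convert hc1 using 3 with i _ i _
      · refine and_congr_right fun hi => ?_
        rw [hx'f i hi, sub_pos]
      · refine and_congr_right fun hi => ?_
        rw [hx'f i hi, sub_nonpos]
    · convert hc2 using 3 with i _ i _
      · refine and_congr_right fun hi => ?_
        rw [hx'f i hi, sub_neg]
      · refine and_congr_right fun hi => ?_
        rw [hx'f i hi, sub_nonneg]
    · refine ⟨l, h1, h2, fun v hv hv' hvl h4 => h3 v hv hv' hvl ⟨?_, h4.2⟩⟩
      have h5 : (1 : ℤˣ) ≠ -1 := by decide
      rw [hx', twistedSum_sub, h4.1, h4.2, map_one, if_neg h5, sub_zero]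
  · have hε : ∀ i, ε (h i) = 1 := fun i =>
      (Int.units_eq_one_or _).resolve_right fun hi => hflip ⟨i, hi⟩
    set f : ι → ℚ × Additive H := fun i => (x i, Additive.ofMul (h i)) with hf
    have hsum : ∀ v : List ι, (v.map f).sum =
        (twistedSum ε h x v, Additive.ofMul (v.map h).prod) := by
      intro v
      rw [twistedSum_eq_sum_map hε]
      induction v with
      | nil => rfl
      | cons i v ih =>
        rw [List.map_cons, List.sum_cons, ih]
        rfl
    have hfinj : Function.Injective f := fun i j hij => by
      simp only [hf, Prod.mk.injEq] at hij
      exact hinj i j hij.1 (Additive.ofMul.injective hij.2)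
    refine (exists_ordering_of_ker (AddMonoidHom.fst ℚ (Additive H)) ?_
      (Finset.univ.image f) ?_).elim fun L ⟨hL, hLS, hseg⟩ => ?_
    · intro Y hY
      have hY0 : ∀ y ∈ Y, y.1 = 0 := fun y hy => (hY y hy).1
      obtain ⟨L, hL, hLY, hseg⟩ := hH (Y.image fun y => Additive.toMul y.2) fun h1 => by
        obtain ⟨y, hy, hy'⟩ := Finset.mem_image.1 h1
        exact (hY y hy).2 (Prod.ext (hY0 y hy) hy')
      obtain ⟨T, hT, hTY, rfl⟩ := exists_map_eq hL hLY fun y hy z hz hyz =>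
        Prod.ext ((hY0 y hy).trans (hY0 z hz).symm) hyz
      refine ⟨T, hT, hTY, fun v hv hv' hvT hv0 => ?_⟩
      obtain ⟨h1, h2, h3⟩ := segment_map (f := fun y : ℚ × Additive H => Additive.toMul y.2)
        hv hv' hvT
      refine hseg _ h1 h2 h3 ?_
      have h4 : v.sum.2 = (v.map Prod.snd).sum := map_list_sum (AddMonoidHom.snd ℚ (Additive H)) v
      rw [hv0] at h4
      have h5 := congrArg Additive.toMul h4
      rw [toMul_list_sum, List.map_map] at h5
      exact h5.symm
    · intro h0
      obtain ⟨i, -, hi⟩ := Finset.mem_image.1 h0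
      simp only [hf, Prod.mk_eq_zero] at hi
      exact hne i hi.1 hi.2
    · obtain ⟨T, hT, hTS, rfl⟩ := exists_map_eq hL hLS hfinj.injOn
      refine ⟨T, hT, fun i => ?_, fun v hv hv' hvT hv0 => ?_⟩
      · rw [← List.mem_toFinset, hTS]
        exact Finset.mem_univ i
      · obtain ⟨h1, h2, h3⟩ := segment_map (f := f) hv hv' hvT
        refine hseg _ h1 h2 h3 ?_
        rw [hsum, hv0.1, hv0.2]
        rfl

theorem sum_single_smul [Fintype ι] [DecidableEq ι] (x : ι → R) (i : ι) :
    ∑ k, (Pi.single i 1 : ι → ℤ) k • x k = x i := by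
  simp [Pi.single_apply]

theorem sum_single_sub_single_smul [Fintype ι] [DecidableEq ι] (x : ι → R) (i j : ι) :
    ∑ k, (Pi.single i 1 - Pi.single j 1 : ι → ℤ) k • x k = x i - x j := by
  simp [sub_smul, Finset.sum_sub_distrib, Pi.single_apply]

theorem exists_ordering_of_torsion_bound [Fintype ι] [DecidableEq ι] [DecidableEq H]
    (hH : ∀ Y : Finset H, 1 ∉ Y → ∃ L : List H, L.Nodup ∧ L.toFinset = Y ∧
      ∀ v, v <:+: L → v ≠ [] → v ≠ L → v.prod ≠ 1)
    (hR : ∀ d : ℤ, d ≠ 0 → |d| ≤ (Fintype.card ι).factorial → ∀ y : R, d • y = 0 → y = 0)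
    {x : ι → R} (hinj : ∀ i j, x i = x j → h i = h j → i = j) (hne : ∀ i, x i = 0 → h i ≠ 1) :
    ∃ l : List ι, l.Nodup ∧ (∀ i, i ∈ l) ∧ HasNontrivialSegments ε h x l := by
  obtain ⟨x', hx'⟩ := exists_rat_same_relations x hR
  refine (exists_ordering_of_rat (ε := ε) (h := h) hH (x := x') ?_ ?_).elim
    fun l ⟨h1, h2, h3⟩ => ?_
  · intro i j hij hhij
    by_contra hne
    refine hne (hinj i j ?_ hhij)
    rw [← sub_eq_zero, ← sum_single_sub_single_smul x, hx', ← sub_eq_zero.2 hij,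
      sum_single_sub_single_smul]
    intro k
    rcases eq_or_ne k i with rfl | hki
    · simp [hne]
    · rcases eq_or_ne k j with rfl | hkj
      · simp [hki]
      · simp [hki, hkj]
  · intro i hi
    refine hne i ?_
    rw [← sum_single_smul x, hx', sum_single_smul, hi]
    intro k
    rcases eq_or_ne k i with rfl | hki
    · simp
    · simp [hki]
  · refine ⟨l, h1, h2, fun v hv hv' hvl h4 => h3 v hv hv' hvl ⟨?_, h4.2⟩⟩
    have h5 := h4.1
    rw [twistedSum_eq_sum_single] at h5 ⊢
    exact (hx' _ fun i => (twistedSum_single_bound (h1.sublist hv.sublist) i).1).1 h5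

end Transfer

theorem exists_sign_hom {A H : Type*} [CommGroup A] [CommGroup H] (φ : H →* MulAut A)
    (hφ : ∀ h : H, (∀ x, φ h x = x) ∨ (∀ x, φ h x = x⁻¹)) :
    ∃ ε : H →* ℤˣ, ∀ h x, φ h x = x ^ ((ε h : ℤˣ) : ℤ) := by
  classical
  have hinv : ∀ {h : H}, (¬ ∀ x, φ h x = x) → ∀ x, φ h x = x⁻¹ := fun {h} => (hφ h).resolve_left
  refine ⟨{ toFun := fun h => if (∀ x, φ h x = x) then 1 else -1
            map_one' := by simp
            map_mul' := fun a b => ?_ }, fun h x => ?_⟩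
  · by_cases ha : ∀ x, φ a x = x
    · simp [ha]
    · by_cases hb : ∀ x, φ b x = x
      · simp [hb]
      · have hab : ∀ x, φ (a * b) x = x := fun x => by
          rw [map_mul, MulAut.mul_apply, hinv hb, hinv ha, inv_inv]
        simp only [if_neg ha, if_neg hb, if_pos hab]
        decide
  · by_cases hx : ∀ x, φ h x = x
    · simp [hx]
    · simp only [MonoidHom.coe_mk, OneHom.coe_mk, if_neg hx]
      simp [hinv hx]

theorem zmod_eq_zero_of_zsmul {m B : ℕ} (hm : ∀ p : ℕ, p.Prime → p ∣ m → B < p) {d : ℤ}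
    (hd : d ≠ 0) (hdB : |d| ≤ B) {y : ZMod m} (hy : d • y = 0) : y = 0 := by
  have hcop : IsCoprime d (m : ℤ) := by
    rw [Int.isCoprime_iff_gcd_eq_one]
    by_contra hne
    obtain ⟨p, hp, hpd⟩ := Nat.exists_prime_and_dvd hne
    have h1 : p ∣ d.natAbs := hpd.trans (Nat.gcd_dvd_left _ _)
    have h2 : p ∣ m := hpd.trans (Nat.gcd_dvd_right _ _)
    have h3 := Nat.le_of_dvd (Int.natAbs_pos.2 hd) h1
    have h4 := hm p hp h2
    rw [Int.abs_eq_natAbs] at hdB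
    omega
  obtain ⟨a, b, hab⟩ := hcop
  calc y = (a * d + b * m : ℤ) • y := by rw [hab, one_smul]
    _ = a • d • y + b • (m : ℤ) • y := by rw [add_smul, mul_smul, mul_smul]
    _ = 0 := by rw [hy]; simp

/-- If `H` is a finite abelian strongly sequenceable group and `φ : H → Aut(ℤ_m)`
satisfies property (*), then any subset of size `k` of `(ℤ_m ⋊_φ H) \ {0}` is
sequenceable, provided every prime factor of `m` exceeds `k!`. -/
theorem semidirect_zmod_sequenceable (m k : ℕ) (hm : 0 < m) (hk : 0 < k)
    (H : Type*) [CommGroup H] [Fintype H] (hH : StronglySequenceable H)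
    (φ : H →* MulAut (Multiplicative (ZMod m)))
    (hφ : ∀ h : H, (∀ x, φ h x = x) ∨ (∀ x, φ h x = x⁻¹))
    (hprime : ∀ p : ℕ, p.Prime → p ∣ m → Nat.factorial k < p)
    (S : Finset (SemidirectProduct (Multiplicative (ZMod m)) H φ))
    (hcard : S.card = k)
    (h1 : (1 : SemidirectProduct (Multiplicative (ZMod m)) H φ) ∉ S) :
    IsSequenceable S := by
  classical
  obtain ⟨ε, hε⟩ := exists_sign_hom φ hφ
  have hH' : ∀ Y : Finset H, 1 ∉ Y → ∃ L : List H, L.Nodup ∧ L.toFinset = Y ∧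
      ∀ v, v <:+: L → v ≠ [] → v ≠ L → v.prod ≠ 1 := by
    intro Y hY
    obtain ⟨L, hL, hLY, hseg⟩ := hH Y hY
    exact ⟨L, hL, by ext y; simp [hLY], (prod_take_ne_iff L).1 hseg⟩
  obtain ⟨l, hl, hmem, hseg⟩ := exists_ordering_of_torsion_bound (ι := S) (ε := ε)
    (h := fun s => s.1.right) (x := fun s => Multiplicative.toAdd s.1.left) hH'
    (fun d hd hdk y hy => zmod_eq_zero_of_zsmul hprime hd
      (by rwa [Fintype.card_coe, hcard] at hdk) hy)
    (fun s t hst hst' => Subtype.ext (SemidirectProduct.ext hst hst'))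
    (fun s hs hs' => h1 (by
      have : s.1 = 1 := SemidirectProduct.ext hs hs'
      exact this ▸ s.2))
  have hprod : ∀ v : List S, ((v.map Subtype.val).prod.left =
      Multiplicative.ofAdd (twistedSum ε (fun s : S => s.1.right)
        (fun s : S => Multiplicative.toAdd s.1.left) v)) ∧
      (v.map Subtype.val).prod.right = (v.map fun s : S => s.1.right).prod := by
    intro v
    induction v with
    | nil => exact ⟨rfl, rfl⟩
    | cons s v ih =>
      simp only [List.map_cons, List.prod_cons, SemidirectProduct.mul_left,
        SemidirectProduct.mul_right, ih.1, ih.2, hε, twistedSum]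
      exact ⟨rfl, trivial⟩
  refine ⟨l.map Subtype.val, hl.map Subtype.val_injective, fun s => ?_,
    (prod_take_ne_iff _).2 ?_⟩
  · simp [hmem]
  · rintro v hv hv' hvl hv1
    obtain ⟨w, hw, rfl⟩ := List.infix_map_iff.1 hv
    refine hseg w hw (by rintro rfl; exact hv' rfl) (by rintro rfl; exact hvl rfl) ⟨?_, ?_⟩
    · have := (hprod w).1
      rw [hv1] at this
      exact this.symm
    · rw [← (hprod w).2, hv1]
      rfl
end

section
/- Let m, k be positive integers. Any subset S of size k of the dihedral group D_{2m} not containing the identity is sequenceable provided that every prime factor of m is greater than k!. -/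
open Matrix in
/-- Let `x` satisfy a family `E` of linear equations modulo `m` with coefficients in `{-1, 0, 1}`.
If all prime factors of `m` exceed the factorial of the number of variables, then `x` satisfies
every integral equation which is a rational combination of those in `E`. -/
theorem sum_zsmul_eq_zero_of_mem_span {ι : Type} [Fintype ι] [DecidableEq ι] {m : ℕ}
    (hprime : ∀ p : ℕ, p.Prime → p ∣ m → (Fintype.card ι).factorial < p) (x : ι → ZMod m)
    {E : Set (ι → ℤ)} (hE : ∀ e ∈ E, (∀ i, |e i| ≤ 1) ∧ ∑ i, e i • x i = 0) {c : ι → ℤ}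
    (hc : (fun i => (c i : ℚ)) ∈ Submodule.span ℚ ((fun e i => (e i : ℚ)) '' E)) :
    ∑ i, c i • x i = 0 := by
  obtain ⟨b, hbE, hbspan, hbli⟩ :=
    exists_linearIndependent ℚ ((fun (e : ι → ℤ) i => (e i : ℚ)) '' E)
  rw [← hbspan] at hc
  set F : Set (ι → ℤ) := E ∪ Set.range fun i => Pi.single i 1
  have hFbound : ∀ e ∈ F, ∀ i, |e i| ≤ 1 := by
    rintro e (he | ⟨j, rfl⟩) i
    · exact (hE e he).1 i
    · by_cases h : i = j
      · subst h; simp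
      · simp [h]
  obtain ⟨b', hb'F, hbb', hFb', hb'li⟩ :=
    exists_linearIndepOn_id_extension (K := ℚ) (t := (fun (e : ι → ℤ) i => (e i : ℚ)) '' F) hbli
      (hbE.trans (Set.image_mono Set.subset_union_left))
  have htop : ⊤ ≤ Submodule.span ℚ b' := by
    rw [← (Pi.basisFun ℚ ι).span_eq, Submodule.span_le]
    rintro _ ⟨i, rfl⟩
    refine hFb' ⟨Pi.single i 1, Or.inr ⟨i, rfl⟩, ?_⟩
    ext j
    by_cases h : j = i
    · subst h; simp
    · simp [h]
  let B₀ : Module.Basis b' ℚ (ι → ℚ) := Module.Basis.mk hb'li (by simpa using htop)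
  let B : Module.Basis ι ℚ (ι → ℚ) := B₀.reindex (B₀.indexEquiv (Pi.basisFun ℚ ι))
  have hB : ∀ j, B j ∈ b' := fun j => by simp [B, B₀]
  have hbB : b ⊆ B '' {j | B j ∈ b} := by
    intro v hv
    refine ⟨B₀.indexEquiv (Pi.basisFun ℚ ι) ⟨v, hbb' hv⟩, ?_, ?_⟩ <;> simp [B, B₀, hv]
  choose a haF ha using fun j => hb'F (hB j)
  let M : Matrix ι ι ℤ := Matrix.of a
  have hrepr : ∀ j, B.repr (fun i => (c i : ℚ)) j ≠ 0 → B j ∈ b := fun j hj =>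
    B.repr_support_subset_of_mem_span _ (Submodule.span_mono hbB hc) (by simpa using hj)
  have hq : (B.repr (fun i => (c i : ℚ))) ᵥ* (M.map (Int.cast : ℤ → ℚ))
      = fun i => (c i : ℚ) := by
    conv_rhs => rw [← B.sum_repr (fun i => (c i : ℚ))]
    ext i
    simp [Matrix.vecMul, dotProduct, M, ← ha]
  have hMB : M.map (Int.cast : ℤ → ℚ) = ((Pi.basisFun ℚ ι).toMatrix B)ᵀ := by
    ext j i
    simp [Module.Basis.toMatrix_apply, M, ← ha]
  have hdet : M.det ≠ 0 := by
    have h : IsUnit (M.map (Int.cast : ℤ → ℚ)).det := by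
      rw [hMB, Matrix.det_transpose, ← Module.Basis.det_apply]
      exact (Pi.basisFun ℚ ι).isUnit_det B
    rw [← Int.cast_det] at h
    exact_mod_cast h.ne_zero
  have hcoprime : IsUnit ((M.det : ℤ) : ZMod m) := by
    have hbound : |M.det| ≤ (Fintype.card ι).factorial := by
      have := Matrix.det_le (A := M) (abv := AbsoluteValue.abs) (x := 1)
        fun j i => hFbound _ (haF j) i
      simpa using this
    rw [ZMod.coe_int_isUnit_iff_isCoprime, Int.isCoprime_iff_nat_coprime]
    refine Nat.coprime_of_dvd fun p hp hpm hpd => ?_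
    rw [Int.natAbs_natCast] at hpm
    have h₁ := Nat.le_of_dvd (Int.natAbs_pos.2 hdet) hpd
    have h₂ := hprime p hp hpm
    rw [Int.abs_eq_natAbs] at hbound
    omega
  have hC : ∀ j, (c ᵥ* M.adjugate) j ≠ 0 → ∑ i, a j i • x i = 0 := by
    intro j hj
    have h : ((c ᵥ* M.adjugate) j : ℚ) = M.det * B.repr (fun i => (c i : ℚ)) j := by
      have h₁ : (fun i => (c i : ℚ)) ᵥ* (M.map (Int.cast : ℤ → ℚ)).adjugate
          = (M.det : ℚ) • ⇑(B.repr fun i => (c i : ℚ)) := by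
        conv_lhs => rw [← hq]
        rw [Matrix.vecMul_vecMul, Matrix.mul_adjugate, Matrix.vecMul_smul, Matrix.vecMul_one,
          ← Int.cast_det]
      have h₂ := congrFun h₁ j
      have h₃ : M.adjugate.map (Int.cast : ℤ → ℚ) = (M.map (Int.cast : ℤ → ℚ)).adjugate :=
        RingHom.map_adjugate (Int.castRingHom ℚ) M
      rw [← h₃] at h₂
      simpa [Matrix.vecMul, dotProduct] using h₂
    have hjb : B j ∈ b := hrepr j fun h0 => hj (by simpa [h0] using h)
    obtain ⟨e, he, heB⟩ := hbE hjb
    have : e = a j := by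
      ext i
      have h := congrFun (heB.trans (ha j).symm) i
      exact Int.cast_injective h
    exact this ▸ (hE e he).2
  have key : M.det • ∑ i, c i • x i = 0 := by
    have h : M.det • c = (c ᵥ* M.adjugate) ᵥ* M := by
      rw [Matrix.vecMul_vecMul, Matrix.adjugate_mul, Matrix.vecMul_smul, Matrix.vecMul_one]
    calc M.det • ∑ i, c i • x i = ∑ i, (M.det • c) i • x i := by
          simp [Finset.smul_sum, mul_smul]
      _ = ∑ j, (c ᵥ* M.adjugate) j • ∑ i, a j i • x i := by
          rw [h]
          simp_rw [Finset.smul_sum]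
          rw [Finset.sum_comm]
          refine Finset.sum_congr rfl fun i _ => ?_
          rw [Matrix.vecMul, dotProduct, Finset.sum_smul]
          simp [M, mul_smul]
      _ = 0 := Finset.sum_eq_zero fun j _ => by
          by_cases hj : (c ᵥ* M.adjugate) j = 0
          · rw [hj, zero_smul]
          · rw [hC j hj, smul_zero]
  rw [zsmul_eq_mul] at key
  exact (hcoprime.mul_right_eq_zero).1 key

/-- A family `x` of residues modulo `m` can be modelled by rational numbers satisfying exactly the
same linear equations with coefficients in `{-1, 0, 1}`. -/
theorem exists_rat_model {ι : Type} [Fintype ι] [DecidableEq ι] {m : ℕ}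
    (hprime : ∀ p : ℕ, p.Prime → p ∣ m → (Fintype.card ι).factorial < p) (x : ι → ZMod m) :
    ∃ y : ι → ℚ, ∀ c : ι → ℤ, (∀ i, |c i| ≤ 1) →
      (∑ i, c i • x i = 0 ↔ ∑ i, c i • y i = 0) := by
  set E : Set (ι → ℤ) := {c | (∀ i, |c i| ≤ 1) ∧ ∑ i, c i • x i = 0}
  set L : Set (ι → ℤ) := {c | (∀ i, |c i| ≤ 1) ∧ ∑ i, c i • x i ≠ 0}
  have hfin : L.Finite := by
    refine (Set.finite_Icc (fun _ : ι => (-1 : ℤ)) (fun _ => 1)).subset fun c hc => ?_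
    exact ⟨fun i => (abs_le.1 (hc.1 i)).1, fun i => (abs_le.1 (hc.1 i)).2⟩
  have := hfin.to_subtype
  let φ : (ι → ℤ) → ι → ℚ := fun e i => (e i : ℚ)
  obtain ⟨f, hf, hfL⟩ := Module.Dual.exists_forall_mem_ne_zero_of_forall_exists
    (Submodule.span ℚ (φ '' E)).dualAnnihilator
    (fun c : L => Module.Dual.eval ℚ (ι → ℚ) (φ c)) (by
      rintro ⟨c, hc⟩
      have hc' : φ c ∉ Submodule.span ℚ (φ '' E) := fun h =>
        hc.2 (sum_zsmul_eq_zero_of_mem_span hprime x (fun e he => he) h)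
      obtain ⟨f, hf, hf'⟩ := Submodule.exists_dual_map_eq_bot_of_notMem hc' inferInstance
      refine ⟨f, ?_, by simpa using hf⟩
      rw [Submodule.mem_dualAnnihilator]
      intro w hw
      have : f w ∈ (Submodule.span ℚ (φ '' E)).map f := Submodule.mem_map_of_mem hw
      simpa [hf'] using this)
  have hval : ∀ c : ι → ℤ, ∑ i, c i • f (Pi.single i 1) = f (φ c) := by
    intro c
    conv_rhs => rw [← (Pi.basisFun ℚ ι).sum_repr (φ c)]
    simp [φ]
  refine ⟨fun i => f (Pi.single i 1), fun c hc => ?_⟩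
  rw [hval]
  constructor
  · intro h
    exact (Submodule.mem_dualAnnihilator f).1 hf _ (Submodule.subset_span ⟨c, ⟨hc, h⟩, rfl⟩)
  · intro h
    by_contra h'
    exact hfL ⟨c, hc, h'⟩ h

/-- The parity of the number of reflections among the entries of `l`. -/
def parity {ι : Type} (ρ : ι → Bool) : List ι → Bool
  | [] => false
  | i :: l => xor (ρ i) (parity ρ l)

/-- The rotation amount of the product of the elements `l` of a generalized dihedral group over
`A`, where `ρ` says which elements are reflections. -/
def amount {ι A : Type} [AddCommGroup A] (ρ : ι → Bool) (x : ι → A) : List ι → A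
  | [] => 0
  | i :: l => amount ρ x l + if parity ρ l then -x i else x i

variable {ι : Type} (ρ : ι → Bool)

theorem amount_neg {A : Type} [AddCommGroup A] (x : ι → A) (l : List ι) :
    amount ρ (-x) l = -amount ρ x l := by
  induction l with
  | nil => simp [amount]
  | cons i l ih => cases h : parity ρ l <;> simp [amount, ih, h, add_comm]

/-- The amount of a list without repetitions is a linear form with coefficients in `{-1, 0, 1}`. -/
theorem exists_coeff [Fintype ι] [DecidableEq ι] (l : List ι) (hl : l.Nodup) :
    ∃ c : ι → ℤ, (∀ i, |c i| ≤ 1) ∧ (∀ i ∉ l, c i = 0) ∧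
      ∀ (A : Type) [AddCommGroup A] (x : ι → A), amount ρ x l = ∑ i, c i • x i := by
  induction l with
  | nil => exact ⟨0, by simp, by simp, fun A _ x => by simp [amount]⟩
  | cons j l ih =>
    obtain ⟨hj, hl⟩ := List.nodup_cons.1 hl
    obtain ⟨c, hc, hc0, h⟩ := ih hl
    refine ⟨c + Pi.single j (if parity ρ l then -1 else 1), fun i => ?_, fun i hi => ?_,
      fun A _ x => ?_⟩
    · by_cases hij : i = j
      · subst hij
        cases h : parity ρ l <;> simp [hc0 i hj]
      · simpa [hij] using hc i
    · simp only [List.mem_cons, not_or] at hi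
      simp [hi.1, hc0 i hi.2]
    · simp only [amount, h, Pi.add_apply, add_smul, Finset.sum_add_distrib]
      congr 1
      rw [Finset.sum_eq_single j (fun i _ hi => by simp [hi]) (by simp)]
      cases parity ρ l <;> simp

/-- Every nonempty prefix of `l` with an even number of reflections satisfies `P`. -/
def EvenPrefixes (P : List ι → Prop) (l : List ι) : Prop :=
  ∀ b, b <+: l → b ≠ [] → parity ρ b = false → P b

/-- Every prefix of `l` with an odd number of reflections satisfies `P`. -/
def OddPrefixes (P : List ι → Prop) (l : List ι) : Prop :=
  ∀ b, b <+: l → parity ρ b = true → P b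

/-- No nonempty segment of `l` has trivial product. -/
def SegmentFree (x : ι → ℚ) (l : List ι) : Prop :=
  ∀ b, b <:+: l → b ≠ [] → parity ρ b = false → amount ρ x b ≠ 0

variable {ρ}

theorem SegmentFree.cons {x : ι → ℚ} {l : List ι} {i : ι} (hl : SegmentFree ρ x l)
    (h : EvenPrefixes ρ (fun b => amount ρ x b ≠ 0) (i :: l)) : SegmentFree ρ x (i :: l) := by
  intro b hb
  rcases List.infix_cons_iff.1 hb with hb | hb
  · exact h b hb
  · exact hl b hb

theorem evenPrefixes_cons_rotation {x : ι → ℚ} {l : List ι} {i : ι} (hρ : ρ i = false)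
    (hi : 0 < x i) (hl : EvenPrefixes ρ (fun b => 0 < amount ρ x b) l) :
    EvenPrefixes ρ (fun b => 0 < amount ρ x b) (i :: l) := by
  intro b hb hne hpar
  rcases List.prefix_cons_iff.1 hb with rfl | ⟨b, rfl, hb'⟩
  · exact absurd rfl hne
  · have hpb : parity ρ b = false := by simpa [parity, hρ] using hpar
    rcases eq_or_ne b [] with rfl | h
    · simpa [amount, parity] using hi
    · have := hl b hb' h hpb
      simp only [amount, hpb]
      simp; linarith

theorem evenPrefixes_cons_reflection {x : ι → ℚ} {l : List ι} {i : ι} (hρ : ρ i = true)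
    (hl : OddPrefixes ρ (fun b => x i < amount ρ x b) l) :
    EvenPrefixes ρ (fun b => 0 < amount ρ x b) (i :: l) := by
  intro b hb hne hpar
  rcases List.prefix_cons_iff.1 hb with rfl | ⟨b, rfl, hb'⟩
  · exact absurd rfl hne
  · have hpb : parity ρ b = true := by simpa [parity, hρ] using hpar
    have := hl b hb' hpb
    simp only [amount, hpb]
    simp; linarith

theorem oddPrefixes_cons_rotation {x : ι → ℚ} {l : List ι} {i : ι} {t : ℚ} (hρ : ρ i = false)
    (hi : x i < 0) (hl : OddPrefixes ρ (fun b => t < amount ρ x b) l) :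
    OddPrefixes ρ (fun b => t < amount ρ x b) (i :: l) := by
  intro b hb hpar
  rcases List.prefix_cons_iff.1 hb with rfl | ⟨b, rfl, hb'⟩
  · simp [parity] at hpar
  · have hpb : parity ρ b = true := by simpa [parity, hρ] using hpar
    have := hl b hb' hpb
    simp only [amount, hpb]
    simp; linarith

theorem oddPrefixes_cons_reflection {x : ι → ℚ} {l : List ι} {i : ι} {t : ℚ} (hρ : ρ i = true)
    (hi : t < x i) (hl : EvenPrefixes ρ (fun b => 0 < amount ρ x b) l) :
    OddPrefixes ρ (fun b => t < amount ρ x b) (i :: l) := by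
  intro b hb hpar
  rcases List.prefix_cons_iff.1 hb with rfl | ⟨b, rfl, hb'⟩
  · simp [parity] at hpar
  · have hpb : parity ρ b = false := by simpa [parity, hρ] using hpar
    rcases eq_or_ne b [] with rfl | h
    · simpa [amount, parity] using hi
    · have := hl b hb' h hpb
      simp only [amount, hpb]
      simp; linarith

/-- Reflections can be ordered so that the index alternately falls and rises. -/
theorem exists_zigzag [DecidableEq ι] (n : ℕ) : ∀ (x : ι → ℚ) (T : Finset ι), T.card = n →
    (∀ i ∈ T, ρ i = true) → Set.InjOn x T →
    ∃ l : List ι, l.Nodup ∧ (∀ i, i ∈ l ↔ i ∈ T) ∧ SegmentFree ρ x l ∧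
      EvenPrefixes ρ (fun b => 0 < amount ρ (-x) b) l ∧
      ∀ t, (∀ i ∈ T, t < x i) → OddPrefixes ρ (fun b => t < amount ρ x b) l := by
  induction n with
  | zero =>
    intro x T hT _ _
    obtain rfl := Finset.card_eq_zero.1 hT
    refine ⟨[], by simp, by simp, ?_, ?_, ?_⟩
    · intro b hb hne; exact absurd (List.infix_nil.1 hb) hne
    · intro b hb hne; exact absurd (List.prefix_nil.1 hb) hne
    · intro t _ b hb hp
      obtain rfl := List.prefix_nil.1 hb
      simp [parity] at hp
  | succ n ih =>
    intro x T hT hρ hinj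
    obtain ⟨i, hiT, hi⟩ := T.exists_max_image x (Finset.card_pos.1 (by omega))
    obtain ⟨l, hnd, hmem, hfree, heven, hodd⟩ := ih (-x) (T.erase i)
      (by rw [Finset.card_erase_of_mem hiT, hT]; rfl)
      (fun j hj => hρ j (Finset.mem_of_mem_erase hj))
      (fun j hj k hk h => hinj (Finset.mem_of_mem_erase hj) (Finset.mem_of_mem_erase hk)
        (neg_injective h))
    rw [neg_neg] at heven
    have hev : EvenPrefixes ρ (fun b => 0 < amount ρ (-x) b) (i :: l) := by
      refine evenPrefixes_cons_reflection (hρ i hiT) (hodd _ fun j hj => ?_)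
      obtain ⟨hji, hj⟩ := Finset.mem_erase.1 hj
      exact neg_lt_neg (lt_of_le_of_ne (hi j hj) fun h => hji (hinj hj hiT h))
    refine ⟨i :: l, ?_, ?_, SegmentFree.cons ?_ ?_, hev, fun t ht => ?_⟩
    · simp [hnd, hmem]
    · intro j
      by_cases hji : j = i <;> simp [hji, hmem, hiT]
    · intro b h₁ h₂ h₃ h₄
      exact hfree b h₁ h₂ h₃ (by simp [amount_neg, h₄])
    · intro b h₁ h₂ h₃ h₄
      have := hev b h₁ h₂ h₃
      simp [amount_neg, h₄] at this
    · exact oddPrefixes_cons_reflection (hρ i hiT) (ht i hiT) heven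

/-- If there is a reflection, then put the positive rotations first, then the least reflection, then
the negative rotations, then a zigzag of the other reflections. -/
theorem exists_segmentFree [Fintype ι] [DecidableEq ι] (x : ι → ℚ)
    (h0 : ∀ i, ρ i = false → x i ≠ 0) (hinj : ∀ i j, ρ i = true → ρ j = true → x i = x j → i = j)
    (href : ∃ i, ρ i = true) :
    ∃ l : List ι, l.Nodup ∧ (∀ i, i ∈ l) ∧ SegmentFree ρ x l := by
  let T : Finset ι := {i | ρ i = true}
  have hT : ∀ i, i ∈ T ↔ ρ i = true := fun i => by simp [T]
  obtain ⟨i, hiT, hi⟩ := T.exists_min_image x (by simpa [Finset.Nonempty, T] using href)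
  have hρi := (hT i).1 hiT
  obtain ⟨l, hnd, hmem, hfree, heven, hodd⟩ := exists_zigzag (ρ := ρ) _ x (T.erase i) rfl
    (fun j hj => (hT j).1 (Finset.mem_of_mem_erase hj))
    (fun j hj k hk h => hinj j k ((hT j).1 (Finset.mem_of_mem_erase hj))
      ((hT k).1 (Finset.mem_of_mem_erase hk)) h)
  replace hodd := hodd (x i) fun j hj => by
    obtain ⟨hji, hj⟩ := Finset.mem_erase.1 hj
    exact lt_of_le_of_ne (hi j hj) fun h => hji (hinj j i ((hT j).1 hj) hρi h.symm)
  have hneg : ∀ N : Finset ι, (∀ j ∈ N, ρ j = false ∧ x j < 0) →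
      ∃ l : List ι, l.Nodup ∧ (∀ j, j ∈ l ↔ j ∈ T.erase i ∨ j ∈ N) ∧ SegmentFree ρ x l ∧
        EvenPrefixes ρ (fun b => 0 < amount ρ (-x) b) l ∧
        OddPrefixes ρ (fun b => x i < amount ρ x b) l := by
    intro N
    induction N using Finset.induction with
    | empty => exact fun _ => ⟨l, hnd, by simpa using hmem, hfree, heven, hodd⟩
    | insert j N hj ih =>
      intro hN
      obtain ⟨l, hnd, hmem, hfree, heven, hodd⟩ := ih fun k hk => hN k (by simp [hk])
      obtain ⟨hρj, hxj⟩ := hN j (by simp)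
      have hev := evenPrefixes_cons_rotation (x := -x) hρj (by simpa using hxj) heven
      refine ⟨j :: l, ?_, ?_, hfree.cons ?_, hev, oddPrefixes_cons_rotation hρj hxj hodd⟩
      · simp [hnd, hmem, hj, hT, hρj]
      · intro k
        simp only [List.mem_cons, hmem, Finset.mem_insert]
        tauto
      · intro b h₁ h₂ h₃ h₄
        have := hev b h₁ h₂ h₃
        simp [amount_neg, h₄] at this
  obtain ⟨l, hnd, hmem, hfree, heven, hodd⟩ :=
    hneg {j | ρ j = false ∧ x j < 0} (by simp)
  have hpos : ∀ P : Finset ι, (∀ j ∈ P, ρ j = false ∧ 0 < x j) →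
      ∃ l : List ι, l.Nodup ∧ (∀ j, j ∈ l ↔ j ∈ T ∨ (ρ j = false ∧ x j < 0) ∨ j ∈ P) ∧
        SegmentFree ρ x l ∧ EvenPrefixes ρ (fun b => 0 < amount ρ x b) l := by
    intro P
    induction P using Finset.induction with
    | empty =>
      have hev := evenPrefixes_cons_reflection hρi hodd
      refine fun _ => ⟨i :: l, ?_, ?_, hfree.cons fun b h₁ h₂ h₃ => (hev b h₁ h₂ h₃).ne', hev⟩
      · simp [hnd, hmem, hρi]
      · intro j
        by_cases hji : j = i <;> simp [hji, hmem, hiT]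
    | insert j P hj ih =>
      intro hP
      obtain ⟨l, hnd, hmem, hfree, heven⟩ := ih fun k hk => hP k (by simp [hk])
      obtain ⟨hρj, hxj⟩ := hP j (by simp)
      have hev := evenPrefixes_cons_rotation hρj hxj heven
      refine ⟨j :: l, ?_, ?_, hfree.cons fun b h₁ h₂ h₃ => (hev b h₁ h₂ h₃).ne', hev⟩
      · simp [hnd, hmem, hj, hT, hρj, hxj.le]
      · intro k
        simp only [List.mem_cons, hmem, Finset.mem_insert]
        tauto
  obtain ⟨l, hnd, hmem, hfree, -⟩ := hpos {j | ρ j = false ∧ 0 < x j} (by simp)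
  refine ⟨l, hnd, fun j => (hmem j).2 ?_, hfree⟩
  cases h : ρ j
  · rcases lt_or_gt_of_ne (h0 j h) with h' | h' <;> simp [h, h']
  · simp [hT, h]

theorem sum_map_neg_fun (x : ι → ℚ) (l : List ι) : (l.map (-x)).sum = -(l.map x).sum := by
  induction l with
  | nil => simp
  | cons i l ih => simp [ih, add_comm]

theorem prefix_sum_pos_or {x : ι → ℚ} {b c : List ι}
    (hpair : (b ++ c).Pairwise fun i j => 0 < x j → 0 < x i) (h0 : ∀ i ∈ b ++ c, x i ≠ 0)
    (hb : b ≠ []) :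
    0 < (b.map x).sum ∨ (c = [] ∨ ((b ++ c).map x).sum < (b.map x).sum) := by
  by_cases hc : ∃ j ∈ c, 0 < x j
  · obtain ⟨j, hj, hxj⟩ := hc
    refine Or.inl (List.sum_pos _ ?_ (by simpa using hb))
    simp only [List.mem_map, forall_exists_index, and_imp, forall_apply_eq_imp_iff₂]
    exact fun i hi => (List.pairwise_append.1 hpair).2.2 i hi j hj hxj
  · push Not at hc
    refine Or.inr ((eq_or_ne c []).imp_right fun hcne => ?_)
    have : 0 < (c.map (-x)).sum := by
      refine List.sum_pos _ ?_ (by simpa using hcne)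
      simp only [List.mem_map, forall_exists_index, and_imp, forall_apply_eq_imp_iff₂]
      exact fun i hi => neg_pos.2 (lt_of_le_of_ne (hc i hi) (h0 i (by simp [hi])))
    rw [sum_map_neg_fun] at this
    simp only [List.map_append, List.sum_append]
    linarith

theorem suffix_sum_neg_or {x : ι → ℚ} {b c : List ι}
    (hpair : (b ++ c).Pairwise fun i j => 0 < x j → 0 < x i) (h0 : ∀ i ∈ b ++ c, x i ≠ 0)
    (hc : c ≠ []) :
    (c.map x).sum < 0 ∨ (b = [] ∨ (c.map x).sum < ((b ++ c).map x).sum) := by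
  have := prefix_sum_pos_or (x := -x) (b := c.reverse) (c := b.reverse) (by
    rw [← List.reverse_append, List.pairwise_reverse]
    refine hpair.imp_of_mem fun {i j} hi hj hij hi' => ?_
    simp only [Pi.neg_apply, Left.neg_pos_iff] at hi' ⊢
    exact lt_of_le_of_ne (not_lt.1 fun h => (hij h).not_gt hi') (h0 j hj)) (by
    intro i hi
    simpa using h0 i (by simpa [or_comm] using hi)) (by simpa using hc)
  rw [← List.reverse_append] at this
  simpa only [sum_map_neg_fun, List.map_reverse, List.sum_reverse, List.reverse_eq_nil_iff,
    neg_lt_neg_iff, neg_pos] using this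

theorem exists_pos_erase [DecidableEq ι] {x : ι → ℚ} {s : Finset ι} (h0 : ∀ i ∈ s, x i ≠ 0)
    (hinj : Set.InjOn x s) (hs : 0 < ∑ i ∈ s, x i) :
    ∃ i ∈ s, 0 < x i ∧ (∑ j ∈ s.erase i, x j ≠ 0 ∨ s.erase i = ∅) := by
  obtain ⟨i, his, hi⟩ := Finset.exists_lt_of_sum_lt (s := s) (f := fun _ => 0) (g := x)
    (by simpa using hs)
  by_cases h : ∑ j ∈ s.erase i, x j ≠ 0 ∨ s.erase i = ∅
  · exact ⟨i, his, hi, h⟩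
  push Not at h
  obtain ⟨k, hk⟩ := h.2
  obtain ⟨j, hj, hxj⟩ := Finset.exists_pos_of_sum_zero_of_exists_nonzero x h.1
    ⟨k, hk, h0 k (Finset.mem_of_mem_erase hk)⟩
  obtain ⟨hji, hjs⟩ := Finset.mem_erase.1 hj
  refine ⟨j, hjs, hxj, Or.inl fun hzero => hji (hinj hjs his ?_)⟩
  have h₁ := Finset.add_sum_erase s x his
  have h₂ := Finset.add_sum_erase s x hjs
  linarith [h.1]

/-- Nonzero rationals with nonzero sum can be ordered, positive ones first, so that no nonempty
segment has sum zero. -/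
theorem exists_ordering_of_sum_ne_zero [DecidableEq ι] {x : ι → ℚ} (n : ℕ) : ∀ s : Finset ι,
    s.card = n → (∀ i ∈ s, x i ≠ 0) → Set.InjOn x s → (∑ i ∈ s, x i ≠ 0 ∨ s = ∅) →
    ∃ l : List ι, l.Nodup ∧ (∀ i, i ∈ l ↔ i ∈ s) ∧ (l.Pairwise fun i j => 0 < x j → 0 < x i) ∧
      ∀ b, b <:+: l → b ≠ [] → (b.map x).sum ≠ 0 := by
  induction n with
  | zero =>
    intro s hs _ _ _
    obtain rfl := Finset.card_eq_zero.1 hs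
    exact ⟨[], by simp, by simp, by simp, fun b hb hne => absurd (List.infix_nil.1 hb) hne⟩
  | succ n ih =>
    intro s hs h0 hinj hsum
    have ih' : ∀ i ∈ s, (∑ j ∈ s.erase i, x j ≠ 0 ∨ s.erase i = ∅) → _ := fun i hi h =>
      ih (s.erase i) (by rw [Finset.card_erase_of_mem hi, hs]; rfl)
        (fun j hj => h0 j (Finset.mem_of_mem_erase hj))
        (hinj.mono (Finset.coe_subset.2 (Finset.erase_subset i s))) h
    have htotal : ∀ l : List ι, l.Nodup → (∀ i, i ∈ l ↔ i ∈ s) →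
        (l.map x).sum = ∑ i ∈ s, x i := fun l hl hmem => by
      rw [← List.sum_toFinset x hl]
      exact Finset.sum_congr (by ext; simp [hmem]) fun _ _ => rfl
    have hne : ∑ i ∈ s, x i ≠ 0 := hsum.resolve_right fun h => by simp [h] at hs
    rcases lt_or_gt_of_ne hne with hlt | hgt
    · obtain ⟨i, his, hi, h⟩ := exists_pos_erase (x := -x) (fun j hj => by simpa using h0 j hj)
        (fun j hj k hk h => hinj hj hk (neg_injective h)) (by simpa using hlt)
      simp only [Pi.neg_apply, Left.neg_pos_iff, Finset.sum_neg_distrib, ne_eq, neg_eq_zero] at hi h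
      obtain ⟨l, hnd, hmem, hpair, hl⟩ := ih' i his h
      have hnd' : (l ++ [i]).Nodup := by
        rw [List.nodup_append_comm]; simp [hnd, hmem]
      have hmem' : ∀ j, j ∈ l ++ [i] ↔ j ∈ s := fun j => by
        by_cases hji : j = i <;> simp [hji, hmem, his]
      have hpair' : (l ++ [i]).Pairwise fun i j => 0 < x j → 0 < x i :=
        List.pairwise_append.2 ⟨hpair, by simp, fun j _ k hk hk' => by
          obtain rfl := List.mem_singleton.1 hk
          exact absurd hk' hi.not_gt⟩
      refine ⟨l ++ [i], hnd', hmem', hpair', fun b hb hbne => ?_⟩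
      rcases List.infix_concat_iff.1 hb with ⟨c, hc⟩ | hb
      · rw [← hc] at hpair'
        rcases suffix_sum_neg_or hpair' (fun j hj => h0 j ((hmem' j).1 (hc ▸ hj))) hbne with
          h | rfl | h
        · exact h.ne
        · rw [List.nil_append] at hc
          rw [hc, htotal _ hnd' hmem']
          exact hne
        · rw [hc, htotal _ hnd' hmem'] at h
          exact (h.trans hlt).ne
      · exact hl b hb hbne
    · obtain ⟨i, his, hi, h⟩ := exists_pos_erase h0 hinj hgt
      obtain ⟨l, hnd, hmem, hpair, hl⟩ := ih' i his h
      have hnd' : (i :: l).Nodup := by simp [hnd, hmem]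
      have hmem' : ∀ j, j ∈ i :: l ↔ j ∈ s := fun j => by
        by_cases hji : j = i <;> simp [hji, hmem, his]
      have hpair' : (i :: l).Pairwise fun i j => 0 < x j → 0 < x i :=
        List.pairwise_cons.2 ⟨fun _ _ _ => hi, hpair⟩
      refine ⟨i :: l, hnd', hmem', hpair', fun b hb hbne => ?_⟩
      rcases List.infix_cons_iff.1 hb with ⟨c, hc⟩ | hb
      · rw [← hc] at hpair'
        rcases prefix_sum_pos_or hpair' (fun j hj => h0 j ((hmem' j).1 (hc ▸ hj))) hbne with
          h | rfl | h
        · exact h.ne'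
        · rw [List.append_nil] at hc
          rw [hc, htotal _ hnd' hmem']
          exact hne
        · rw [hc, htotal _ hnd' hmem'] at h
          exact (hgt.trans h).ne'
      · exact hl b hb hbne

theorem exists_ordering [DecidableEq ι] {x : ι → ℚ} {s : Finset ι} (h0 : ∀ i ∈ s, x i ≠ 0)
    (hinj : Set.InjOn x s) :
    ∃ l : List ι, l.Nodup ∧ (∀ i, i ∈ l ↔ i ∈ s) ∧
      ∀ b, b <:+: l → b ≠ [] → b ≠ l → (b.map x).sum ≠ 0 := by
  by_cases hsum : ∑ i ∈ s, x i ≠ 0 ∨ s = ∅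
  · obtain ⟨l, hnd, hmem, -, hl⟩ := exists_ordering_of_sum_ne_zero _ s rfl h0 hinj hsum
    exact ⟨l, hnd, hmem, fun b hb hne _ => hl b hb hne⟩
  push Not at hsum
  obtain ⟨hzero, k, hk⟩ := hsum
  obtain ⟨i, his, hi⟩ := Finset.exists_pos_of_sum_zero_of_exists_nonzero x hzero ⟨k, hk, h0 k hk⟩
  have herase := Finset.add_sum_erase s x his
  obtain ⟨l, hnd, hmem, hpair, hl⟩ := exists_ordering_of_sum_ne_zero _ (s.erase i) rfl
    (fun j hj => h0 j (Finset.mem_of_mem_erase hj))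
    (hinj.mono (Finset.coe_subset.2 (Finset.erase_subset i s))) (Or.inl (by intro h; linarith))
  have hnd' : (i :: l).Nodup := by simp [hnd, hmem]
  have hmem' : ∀ j, j ∈ i :: l ↔ j ∈ s := fun j => by
    by_cases hji : j = i <;> simp [hji, hmem, his]
  have hpair' : (i :: l).Pairwise fun i j => 0 < x j → 0 < x i :=
    List.pairwise_cons.2 ⟨fun _ _ _ => hi, hpair⟩
  have htotal : ((i :: l).map x).sum = 0 := by
    rw [← hzero, ← List.sum_toFinset x hnd']
    exact Finset.sum_congr (by ext j; rw [List.mem_toFinset, hmem']) fun _ _ => rfl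
  refine ⟨i :: l, hnd', hmem', fun b hb hbne hbl => ?_⟩
  rcases List.infix_cons_iff.1 hb with ⟨c, hc⟩ | hb
  · rw [← hc] at hpair'
    rcases prefix_sum_pos_or hpair' (fun j hj => h0 j ((hmem' j).1 (hc ▸ hj))) hbne with h | rfl | h
    · exact h.ne'
    · exact absurd (by simpa using hc) hbl
    · rw [hc, htotal] at h
      exact h.ne'
  · exact hl b hb hbne

theorem parity_eq_false {ρ : ι → Bool} (h : ∀ i, ρ i = false) (l : List ι) :
    parity ρ l = false := by
  induction l with
  | nil => rfl
  | cons i l ih => simp [parity, h, ih]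

theorem amount_eq_sum {A : Type} [AddCommGroup A] {ρ : ι → Bool} (h : ∀ i, ρ i = false)
    (x : ι → A) (l : List ι) : amount ρ x l = (l.map x).sum := by
  induction l with
  | nil => rfl
  | cons i l ih => simp [amount, parity_eq_false h, ih, add_comm]

theorem exists_ordering_dihedral [Fintype ι] [DecidableEq ι] {ρ : ι → Bool} (x : ι → ℚ)
    (h0 : ∀ i, ρ i = false → x i ≠ 0) (hinj : ∀ i j, ρ i = ρ j → x i = x j → i = j) :
    ∃ l : List ι, l.Nodup ∧ (∀ i, i ∈ l) ∧
      ∀ b, b <:+: l → b ≠ [] → b ≠ l → parity ρ b = false → amount ρ x b ≠ 0 := by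
  by_cases href : ∃ i, ρ i = true
  · obtain ⟨l, hnd, hmem, hl⟩ := exists_segmentFree x h0
      (fun i j hi hj => hinj i j (hi.trans hj.symm)) href
    exact ⟨l, hnd, hmem, fun b h₁ h₂ _ h₃ => hl b h₁ h₂ h₃⟩
  · have hρ : ∀ i, ρ i = false := by simpa using href
    obtain ⟨l, hnd, hmem, hl⟩ := exists_ordering (x := x) (s := Finset.univ)
      (fun i _ => h0 i (hρ i)) (fun i _ j _ => hinj i j ((hρ i).trans (hρ j).symm))
    refine ⟨l, hnd, fun i => (hmem i).2 (Finset.mem_univ i), fun b h₁ h₂ h₃ _ => ?_⟩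
    rw [amount_eq_sum hρ]
    exact hl b h₁ h₂ h₃

namespace DihedralGroup

variable {m : ℕ}

/-- Whether an element of a dihedral group is a reflection. -/
def isReflection : DihedralGroup m → Bool
  | r _ => false
  | sr _ => true

/-- The index `a` of the element `r a` or `sr a` of a dihedral group. -/
def index : DihedralGroup m → ZMod m
  | r a => a
  | sr a => a

@[simp] theorem isReflection_r (a : ZMod m) : (r a).isReflection = false := rfl

@[simp] theorem isReflection_sr (a : ZMod m) : (sr a).isReflection = true := rfl

@[simp] theorem index_r (a : ZMod m) : (r a).index = a := rfl

@[simp] theorem index_sr (a : ZMod m) : (sr a).index = a := rfl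

theorem ext_index {g h : DihedralGroup m} (h₁ : g.isReflection = h.isReflection)
    (h₂ : g.index = h.index) : g = h := by
  cases g <;> cases h <;> simp_all

theorem prod_map_eq (f : ι → DihedralGroup m) (l : List ι) :
    (l.map f).prod = if parity (fun i => (f i).isReflection) l
      then sr (amount (fun i => (f i).isReflection) (fun i => (f i).index) l)
      else r (amount (fun i => (f i).isReflection) (fun i => (f i).index) l) := by
  induction l with
  | nil => rfl
  | cons i l ih =>
    rw [List.map_cons, List.prod_cons, ih]
    cases hp : parity (fun i => (f i).isReflection) l <;> cases hf : f i <;>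
      simp [parity, amount, hp, hf, add_comm, sub_eq_add_neg]

end DihedralGroup

theorem isSequenceable_of_segments {G : Type*} [Group G] {S : Finset G} {l : List S}
    (hnd : l.Nodup) (hmem : ∀ i, i ∈ l)
    (hl : ∀ b, b <:+: l → b ≠ [] → b ≠ l → (b.map Subtype.val).prod ≠ 1) :
    IsSequenceable S := by
  refine ⟨l.map Subtype.val, hnd.map Subtype.val_injective, fun x => ?_, fun i j hij hj h => ?_⟩
  · simp [hmem]
  · intro heq
    rw [List.length_map] at hj h
    have hlen : ((l.take j).drop i).length = j - i := by simp [hj]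
    refine hl ((l.take j).drop i)
      ((List.drop_suffix _ _).isInfix.trans (List.take_prefix _ _).isInfix) ?_ ?_ ?_
    · intro h0
      rw [h0, List.length_nil] at hlen
      omega
    · intro h0
      rw [h0] at hlen
      omega
    · have hsplit := List.prod_take_mul_prod_drop ((l.map Subtype.val).take j) i
      rw [List.take_take, min_eq_left hij.le, heq, mul_eq_left] at hsplit
      rwa [List.map_drop, List.map_take]

/-- Any subset of size `k` of the dihedral group `D_{2m}` not containing the identity
is sequenceable, provided every prime factor of `m` exceeds `k!`. -/
theorem dihedral_sequenceable (m k : ℕ) (hm : 0 < m) (hk : 0 < k)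
    (hprime : ∀ p : ℕ, p.Prime → p ∣ m → Nat.factorial k < p)
    (S : Finset (DihedralGroup m)) (hcard : S.card = k)
    (h1 : (1 : DihedralGroup m) ∉ S) :
    IsSequenceable S := by
  let ρ : S → Bool := fun i => i.1.isReflection
  let x : S → ZMod m := fun i => i.1.index
  obtain ⟨y, hy⟩ := exists_rat_model (by simpa [hcard] using hprime) x
  have hy0 : ∀ i, ρ i = false → y i ≠ 0 := by
    intro i hi h
    have := (hy (Pi.single i 1) fun j => by
      by_cases hj : j = i
      · subst hj; simp
      · simp [hj]).2
      (by simpa [Pi.single_apply] using h)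
    have hxi : x i = 0 := by simpa [Pi.single_apply] using this
    have hone : i.1 = 1 := DihedralGroup.ext_index hi hxi
    exact h1 (hone ▸ i.2)
  have hyinj : ∀ i j, ρ i = ρ j → y i = y j → i = j := by
    intro i j hρ h
    by_contra hij
    have := (hy (Pi.single i 1 - Pi.single j 1) fun t => by
      by_cases hi : t = i
      · subst hi; simp [hij]
      · by_cases hj : t = j
        · subst hj; simp [hi]
        · simp [hi, hj]).2
      (by simpa [Pi.single_apply, sub_mul, sub_eq_zero] using h)
    have hx : x i = x j := by simpa [Pi.single_apply, sub_mul, sub_eq_zero] using this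
    exact hij (Subtype.ext (DihedralGroup.ext_index hρ hx))
  obtain ⟨l, hnd, hmem, hl⟩ := exists_ordering_dihedral y hy0 hyinj
  refine isSequenceable_of_segments hnd hmem fun b hb hne hbl hprod => ?_
  rw [DihedralGroup.prod_map_eq, DihedralGroup.one_def] at hprod
  cases hp : parity ρ b
  · obtain ⟨c, hc, -, hsum⟩ := exists_coeff ρ b (hnd.sublist hb.sublist)
    refine hl b hb hne hbl hp ?_
    rw [hsum ℚ y, ← hy c hc, ← hsum (ZMod m) x]
    have hp' : parity (fun i : S => i.1.isReflection) b = false := hp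
    simpa [hp', -DihedralGroup.r_zero] using hprod
  · have hp' : parity (fun i : S => i.1.isReflection) b = true := hp
    simp [hp', -DihedralGroup.r_zero] at hprod
end

section
/- Let m, k be positive integers and let S be a subset of size k of Z_{2m}, where every prime factor of m is greater than k^k. Then there exists an automorphism α of Z_{2m} such that α(S) ⊆ {−⌊m/k⌋, −⌊m/k⌋+1, …, ⌊m/k⌋} ∪ (m + {−⌊m/k⌋, −⌊m/k⌋+1, …, ⌊m/k⌋}), where the elements of these sets are interpreted as residues modulo 2m. -/
/-- Two natural numbers lying in the same of the `k` equal parts of `[0, m)` differ by at most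
`m / k`. -/
theorem abs_sub_le_div_of_mul_div_eq {m k a b : ℕ} (hm : 0 < m) (hk : 0 < k)
    (h : a * k / m = b * k / m) : |(a : ℤ) - b| ≤ (m / k : ℕ) := by
  wlog hab : a ≤ b generalizing a b
  · rw [abs_sub_comm]
    exact this h.symm (le_of_not_ge hab)
  obtain ⟨d, rfl⟩ := Nat.exists_eq_add_of_le hab
  have hd : d ≤ m / k := by
    rw [Nat.le_div_iff_mul_le hk]
    have h₁ := Nat.div_mul_le_self (a * k) m
    have h₂ := Nat.lt_div_mul_add hm (a := (a + d) * k)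
    rw [← h] at h₂
    linarith [add_mul a d k]
  have habs : |(a : ℤ) - (a + d : ℕ)| = d := by
    rw [Nat.cast_add, sub_add_cancel_left, abs_neg, Nat.abs_cast]
  rw [habs]
  exact_mod_cast hd

/-- Dirichlet's simultaneous approximation theorem for residues modulo `m`. -/
theorem exists_mul_modEq_abs_le_div {ι : Type*} [Fintype ι] {m k : ℕ} (hm : 0 < m) (hk : 0 < k)
    (v : ι → ℕ) :
    ∃ q : ℕ, 0 < q ∧ q ≤ k ^ Fintype.card ι ∧
      ∀ i, ∃ j : ℤ, |j| ≤ (m / k : ℕ) ∧ (q * v i : ℤ) ≡ j [ZMOD m] := by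
  classical
  let box : Fin (k ^ Fintype.card ι + 1) → ι → Fin k := fun q i =>
    ⟨(q * v i % m) * k / m, by
      rw [Nat.div_lt_iff_lt_mul hm, mul_comm k m]
      exact Nat.mul_lt_mul_of_pos_right (Nat.mod_lt _ hm) hk⟩
  obtain ⟨a, b, hne, hab⟩ := Fintype.exists_ne_map_eq_of_card_lt box (by simp)
  wlog hlt : a < b generalizing a b
  · exact this b a hne.symm hab.symm (lt_of_le_of_ne (not_lt.mp hlt) hne.symm)
  have hlt' : (a : ℕ) < b := hlt
  refine ⟨b - a, by omega, by omega, fun i => ?_⟩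
  refine ⟨((b * v i % m : ℕ) : ℤ) - (a * v i % m : ℕ), ?_, ?_⟩
  · exact abs_sub_le_div_of_mul_div_eq hm hk (congrArg Fin.val (congrFun hab i)).symm
  · rw [Nat.cast_sub hlt'.le, sub_mul]
    push_cast
    exact (Int.mod_modEq _ _).symm.sub (Int.mod_modEq _ _).symm

/-- A residue coprime to `m` lifts to one coprime to `2 * m`, unless it and `m` are both even. -/
theorem exists_coprime_two_mul_modEq {m q : ℕ} (hq : q.Coprime m) :
    ∃ u : ℕ, u.Coprime (2 * m) ∧ (u : ℤ) ≡ q [ZMOD m] := by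
  rcases Nat.even_or_odd q with he | ho
  · have hodd : Odd m := by
      rw [← Nat.not_even_iff_odd]
      intro hme
      exact Nat.not_coprime_of_dvd_of_dvd one_lt_two he.two_dvd hme.two_dvd hq
    refine ⟨q + m, Nat.Coprime.mul_right ?_ (by simpa using hq), by simp [Int.ModEq]⟩
    exact Nat.coprime_two_right.mpr (he.add_odd hodd)
  · exact ⟨q, Nat.Coprime.mul_right (Nat.coprime_two_right.mpr ho) hq, rfl⟩

/-- An integer congruent to `j` modulo `m` is `j` or `m + j` modulo `2 * m`. -/
theorem ZMod.intCast_eq_or_eq_add_of_modEq {m : ℕ} {a j : ℤ} (h : a ≡ j [ZMOD m]) :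
    (a : ZMod (2 * m)) = j ∨ (a : ZMod (2 * m)) = m + j := by
  obtain ⟨t, ht⟩ := h.symm.dvd
  obtain rfl : a = m * t + j := by linarith
  have hzero : (2 * m : ZMod (2 * m)) = 0 := by exact_mod_cast ZMod.natCast_self (2 * m)
  rcases Int.even_or_odd' t with ⟨s, rfl | rfl⟩
  · left
    push_cast
    linear_combination (s : ZMod (2 * m)) * hzero
  · right
    push_cast
    linear_combination (s : ZMod (2 * m)) * hzero

/-- Let `S` be a subset of size `k` of `ℤ_{2m}`, where every prime factor of `m`
exceeds `k^k`. Then there is an automorphism `α` of `ℤ_{2m}` mapping `S` into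
`{-⌊m/k⌋, …, ⌊m/k⌋} ∪ (m + {-⌊m/k⌋, …, ⌊m/k⌋})` (residues modulo `2m`). -/
theorem zmod_two_mul_automorphism_rectification (m k : ℕ) (hm : 0 < m) (hk : 0 < k)
    (hprime : ∀ p : ℕ, p.Prime → p ∣ m → k ^ k < p)
    (S : Finset (ZMod (2 * m))) (hcard : S.card = k) :
    ∃ α : ZMod (2 * m) ≃+ ZMod (2 * m),
      ∀ x ∈ S, ∃ j : ℤ, |j| ≤ (m / k : ℕ) ∧
        (α x = (j : ZMod (2 * m)) ∨ α x = (m : ZMod (2 * m)) + (j : ZMod (2 * m))) := by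
  obtain ⟨q, hq₀, hqk, hq⟩ := exists_mul_modEq_abs_le_div hm hk fun x : S => x.1.val
  rw [Fintype.card_coe, hcard] at hqk
  have hqm : q.Coprime m := Nat.coprime_of_dvd fun p hp hpq hpm =>
    absurd ((Nat.le_of_dvd hq₀ hpq).trans hqk) (hprime p hp hpm).not_ge
  obtain ⟨u, hu, huq⟩ := exists_coprime_two_mul_modEq hqm
  refine ⟨DistribMulAction.toAddEquiv _ (ZMod.unitOfCoprime u hu), fun x hx => ?_⟩
  obtain ⟨j, hj, hqj⟩ := hq ⟨x, hx⟩
  refine ⟨j, hj, ?_⟩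
  have : NeZero (2 * m) := ⟨by omega⟩
  have hux : DistribMulAction.toAddEquiv _ (ZMod.unitOfCoprime u hu) x =
      ((u * x.val : ℤ) : ZMod (2 * m)) := by
    simp [Units.smul_def]
  rw [hux]
  exact ZMod.intCast_eq_or_eq_add_of_modEq ((huq.mul_right _).trans hqj)
end

section
/- Let m, k be positive integers and let x₁,…,x_k be integers. If the smallest prime factor p of m satisfies p > k^k, then there exist integers a, a₁, …, a_k such that 1 ≤ |a| < p and |a·x_i/m − a_i| ≤ 1/k for all 1 ≤ i ≤ k. -/
/-- **Dirichlet's simultaneous approximation theorem**, proved by the pigeonhole principle. -/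
theorem exists_simultaneous_approximation {k : ℕ} (hk : 0 < k) (y : Fin k → ℚ) :
    ∃ (a : ℤ) (A : Fin k → ℤ), 1 ≤ a ∧ a ≤ (k : ℤ) ^ k ∧
      ∀ i, |(a : ℚ) * y i - (A i : ℚ)| ≤ 1 / (k : ℚ) := by
  have hk' : (0 : ℚ) < k := by exact_mod_cast hk
  have hbox (t : ℚ) : ⌊(k : ℚ) * Int.fract t⌋.toNat < k := by
    have h : ⌊(k : ℚ) * Int.fract t⌋ < (k : ℤ) := by
      rw [Int.floor_lt]
      push_cast
      nlinarith [Int.fract_lt_one t]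
    omega
  let f : Fin (k ^ k + 1) → Fin k → Fin k := fun a i => ⟨_, hbox ((a : ℚ) * y i)⟩
  obtain ⟨b, c, hbc, hf⟩ : ∃ b c, b < c ∧ f b = f c := by
    obtain ⟨b, c, hne, hf⟩ := Fintype.exists_ne_map_eq_of_card_lt f (by simp)
    rcases lt_or_gt_of_ne hne with h | h
    exacts [⟨b, c, h, hf⟩, ⟨c, b, h, hf.symm⟩]
  refine ⟨(c : ℤ) - b, fun i => ⌊(c : ℚ) * y i⌋ - ⌊(b : ℚ) * y i⌋, ?_, ?_, fun i => ?_⟩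
  · have : (b : ℕ) < c := hbc
    omega
  · have : ((c : ℕ) : ℤ) ≤ (k : ℤ) ^ k := by exact_mod_cast Nat.le_of_lt_succ c.isLt
    omega
  · have hnonneg (t : ℚ) : 0 ≤ ⌊(k : ℚ) * Int.fract t⌋ :=
      Int.floor_nonneg.2 (mul_nonneg hk'.le (Int.fract_nonneg t))
    have hfloor : ⌊(k : ℚ) * Int.fract ((c : ℚ) * y i)⌋ =
        ⌊(k : ℚ) * Int.fract ((b : ℚ) * y i)⌋ := by
      have h : ⌊(k : ℚ) * Int.fract ((b : ℚ) * y i)⌋.toNat =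
          ⌊(k : ℚ) * Int.fract ((c : ℚ) * y i)⌋.toNat :=
        congrArg Fin.val (congrFun hf i)
      have hb := hnonneg ((b : ℚ) * y i)
      have hc := hnonneg ((c : ℚ) * y i)
      omega
    have habs := Int.abs_sub_lt_one_of_floor_eq_floor hfloor
    rw [← mul_sub, abs_mul, abs_of_pos hk'] at habs
    rw [le_div_iff₀' hk']
    refine le_of_eq_of_le ?_ habs.le
    congr 2
    simp only [Int.fract]
    push_cast
    ring

/-- Simultaneous Diophantine approximation: if the smallest prime factor `p` of `m`
satisfies `p > k^k`, then there exist integers `a, a₁, …, a_k` with `1 ≤ |a| < p` and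
`|a·xᵢ/m − aᵢ| ≤ 1/k` for all `i`. -/
theorem minkowski_simultaneous_approximation (m k : ℕ) (hm : 0 < m) (hk : 0 < k)
    (x : Fin k → ℤ) (p : ℕ) (hp : p.Prime) (hpm : p ∣ m)
    (hmin : ∀ q : ℕ, q.Prime → q ∣ m → p ≤ q) (hpk : k ^ k < p) :
    ∃ (a : ℤ) (A : Fin k → ℤ), 1 ≤ |a| ∧ |a| < (p : ℤ) ∧
      ∀ i : Fin k, |(a : ℚ) * (x i : ℚ) / (m : ℚ) - (A i : ℚ)| ≤ 1 / (k : ℚ) := by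
  obtain ⟨a, A, ha, hak, hA⟩ :=
    exists_simultaneous_approximation hk fun i => (x i : ℚ) / (m : ℚ)
  have hpk' : (k : ℤ) ^ k < p := by exact_mod_cast hpk
  have habs : |a| = a := abs_of_nonneg (by omega)
  refine ⟨a, A, habs.symm ▸ ha, habs.symm ▸ hak.trans_lt hpk', fun i => ?_⟩
  rw [mul_div_assoc]
  exact hA i
end

section
/- Let m, k be positive integers with k ≥ 2. Any subset of size k of the dicyclic group Dic_m is weakly Freiman isomorphic of order k−1 to a subset of the semidirect product Z ⋊_φ Z_4, where φ : Z_4 → Aut(Z) is the homomorphism with φ(1)(x) = −x, provided that every prime factor of m is greater than k^k. -/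
/-- `f` is a weak Freiman homomorphism of order `k` from `S` (in the ambient group `V`)
to `S'` (in the ambient group `W`). -/
def IsWeakFreimanHom {V W : Type*} [Group V] [Group W] (k : ℕ)
    (S : Finset V) (S' : Finset W) (f : V → W) : Prop :=
  (∀ x ∈ S, f x ∈ S') ∧
    ∀ l : List V, l.Nodup → (∀ x ∈ l, x ∈ S) → l.length ≤ k →
      l.prod = 1 → (l.map f).prod = 1

/-- `f` is a weak Freiman isomorphism of order `k` from `S` to `S'`. -/
def IsWeakFreimanIso {V W : Type*} [Group V] [Group W] (k : ℕ)
    (S : Finset V) (S' : Finset W) (f : V → W) : Prop :=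
  Set.BijOn f ↑S ↑S' ∧ IsWeakFreimanHom k S S' f ∧
    ∃ g : W → V, (∀ x ∈ S, g (f x) = x) ∧ (∀ y ∈ S', f (g y) = y) ∧
      IsWeakFreimanHom k S' S g

open Matrix in
theorem exists_smul_mem_span_int_of_mem_span_rat {ι : Type*} [Fintype ι] [DecidableEq ι]
    {L : Set (ι → ℤ)} (hL : ∀ v ∈ L, ∀ i, |v i| ≤ 1) {c : ι → ℤ}
    (hc : (fun i => (c i : ℚ)) ∈ Submodule.span ℚ ((fun v i => ((v i : ℤ) : ℚ)) '' L)) :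
    ∃ d : ℤ, d ≠ 0 ∧ |d| ≤ (Fintype.card ι).factorial ∧ d • c ∈ Submodule.span ℤ L := by
  set e : (ι → ℤ) → ι → ℚ := fun v i => (v i : ℚ) with he
  obtain ⟨b₀, hb₀L, -, hLb₀, hb₀⟩ :=
    exists_linearIndepOn_extension (linearIndepOn_empty ℚ e) (Set.empty_subset L)
  obtain ⟨b, hbT, hb₀b, hTb, hb⟩ :=
    exists_linearIndepOn_extension (t := {v : ι → ℤ | ∀ i, |v i| ≤ 1}) hb₀
      (fun v hv => hL v (hb₀L hv))
  have hspan : ⊤ ≤ Submodule.span ℚ (Set.range fun v : b => e v) := by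
    rw [← (Pi.basisFun ℚ ι).span_eq, Submodule.span_le, ← Set.image_eq_range]
    rintro _ ⟨i, rfl⟩
    refine hTb ⟨Pi.single i 1, fun j => ?_, ?_⟩
    · by_cases h : j = i <;> simp [h]
    · ext j
      by_cases h : j = i <;> simp [he, h]
  let B₀ : Module.Basis b ℚ (ι → ℚ) := Module.Basis.mk hb hspan
  let σ : b ≃ ι := B₀.indexEquiv (Pi.basisFun ℚ ι)
  let B : Module.Basis ι ℚ (ι → ℚ) := B₀.reindex σ
  have hB : ∀ i, B i = e (σ.symm i) := fun i => by
    simp only [B, B₀, Module.Basis.reindex_apply]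
    exact Module.Basis.mk_apply hb hspan _
  let M : Matrix ι ι ℤ := Matrix.of fun i => (σ.symm i : ι → ℤ)
  have hdet : M.det ≠ 0 := by
    have h : LinearIndependent ℚ (M.map (Int.castRingHom ℚ)).row := by
      convert B.linearIndependent using 1
      ext i j
      simp [hB, M, he, Matrix.row]
    rw [linearIndependent_rows_iff_isUnit, isUnit_iff_isUnit_det, isUnit_iff_ne_zero,
      ← RingHom.mapMatrix_apply, ← RingHom.map_det] at h
    exact fun h0 => h (by simp [h0])
  refine ⟨M.det, hdet, ?_, ?_⟩
  · simpa using Matrix.det_le (A := M) (abv := AbsoluteValue.abs) (x := 1)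
      fun i j => hbT (σ.symm i).2 j
  have hw : ∑ i, (c ᵥ* M.adjugate) i • (σ.symm i : ι → ℤ) = M.det • c := by
    have h : (c ᵥ* M.adjugate) ᵥ* M = M.det • c := by
      rw [vecMul_vecMul, adjugate_mul, vecMul_smul, vecMul_one]
    rw [← h, vecMul_eq_sum (c ᵥ* M.adjugate)]
    rfl
  rw [← hw]
  refine Submodule.sum_mem _ fun i _ => ?_
  by_cases hi : (σ.symm i : ι → ℤ) ∈ b₀
  · exact Submodule.smul_mem _ _ (Submodule.subset_span (hb₀L hi))
  have hrepr : B.repr (e c) i = 0 := by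
    have hmem : e c ∈ Submodule.span ℚ (B '' {j | (σ.symm j : ι → ℤ) ∈ b₀}) := by
      refine Submodule.span_le.2 (hLb₀.trans (Submodule.span_mono ?_)) hc
      rintro _ ⟨v, hv, rfl⟩
      exact ⟨σ ⟨v, hb₀b hv⟩, by simpa using hv, by simp [hB]⟩
    by_contra h
    exact hi (B.repr_support_subset_of_mem_span _ hmem (Finsupp.mem_support_iff.2 h))
  have hwB : ∑ j, (((c ᵥ* M.adjugate) j : ℤ) : ℚ) • B j = (M.det : ℚ) • e c := by
    ext j
    have := congrArg (Int.cast : ℤ → ℚ) (congrFun hw j)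
    simpa [hB, he] using this
  have hwi := congrArg (fun v => B.repr v i) hwB
  simp only [B.repr_sum_self, map_smul, Finsupp.smul_apply, hrepr, smul_zero] at hwi
  rw [Int.cast_eq_zero.1 hwi, zero_smul]
  exact zero_mem _

theorem exists_int_sum_smul_eq_zero_iff {ι A : Type*} [Fintype ι] [AddCommGroup A]
    (hA : ∀ (d : ℤ) (a : A), d ≠ 0 → |d| ≤ (Fintype.card ι).factorial → d • a = 0 → a = 0)
    (x : ι → A) :
    ∃ y : ι → ℤ, ∀ c : ι → ℤ, (∀ i, |c i| ≤ 1) →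
      (∑ i, c i • y i = 0 ↔ ∑ i, c i • x i = 0) := by
  classical
  set e : (ι → ℤ) → ι → ℚ := fun v i => (v i : ℚ) with he
  let T : Set (ι → ℤ) := {c | ∀ i, |c i| ≤ 1}
  let L : Set (ι → ℤ) := {c ∈ T | ∑ i, c i • x i = 0}
  let W : Submodule ℚ (ι → ℚ) := Submodule.span ℚ (e '' L)
  have hT : T.Finite := (Set.finite_Icc (-1 : ι → ℤ) 1).subset fun c hc =>
    ⟨fun i => (abs_le.1 (hc i)).1, fun i => (abs_le.1 (hc i)).2⟩
  have hW : ∀ c ∈ T, e c ∈ W → c ∈ L := by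
    intro c hcT hcW
    obtain ⟨d, hd, hdk, hdc⟩ := exists_smul_mem_span_int_of_mem_span_rat (fun v hv => hv.1) hcW
    refine ⟨hcT, hA d _ hd hdk ?_⟩
    have hle : Submodule.span ℤ L ≤ LinearMap.ker (Fintype.linearCombination ℤ x) :=
      Submodule.span_le.2 fun v hv => by
        simpa [Fintype.linearCombination_apply] using hv.2
    simpa [Fintype.linearCombination_apply, Finset.smul_sum, mul_smul] using hle hdc
  have : Finite ↑(T \ L) := (hT.subset Set.sdiff_subset).to_subtype
  obtain ⟨f, hf⟩ := Module.exists_dual_forall_apply_ne_zero (K := ℚ)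
    (fun c : ↑(T \ L) => W.mkQ (e c)) fun c h =>
      c.2.2 (hW c c.2.1 ((Submodule.Quotient.mk_eq_zero W).1 h))
  let q : ι → ℚ := fun i => f (W.mkQ (Pi.single i 1))
  have hq : ∀ c : ι → ℤ, f (W.mkQ (e c)) = ∑ i, c i * q i := by
    intro c
    conv_lhs => rw [pi_eq_sum_univ' (e c)]
    simp [q, he]
  obtain ⟨D, hD⟩ := IsLocalization.exist_integer_multiples_of_finite (nonZeroDivisors ℤ) q
  choose y hy using hD
  have hD0 : ((D : ℤ) : ℚ) ≠ 0 := Int.cast_ne_zero.2 (nonZeroDivisors.coe_ne_zero D)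
  have hyf : ∀ c : ι → ℤ, ((∑ i, c i • y i : ℤ) : ℚ) = D * f (W.mkQ (e c)) := by
    intro c
    rw [hq, Finset.mul_sum, Int.cast_sum]
    refine Finset.sum_congr rfl fun i _ => ?_
    have := hy i
    simp only [algebraMap_int_eq, eq_intCast, zsmul_eq_mul] at this
    rw [smul_eq_mul, Int.cast_mul, this]
    ring
  refine ⟨y, fun c hc => ?_⟩
  rw [← Int.cast_eq_zero (α := ℚ), hyf, mul_eq_zero, or_iff_right hD0]
  constructor
  · intro h
    by_contra hcx
    exact hf ⟨c, hc, fun hL => hcx hL.2⟩ h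
  · intro h
    have : W.mkQ (e c) = 0 :=
      (Submodule.Quotient.mk_eq_zero W).2 (Submodule.subset_span ⟨c, ⟨hc, h⟩, rfl⟩)
    rw [this, map_zero]

theorem IsWeakFreimanIso.of_injOn {V W : Type*} [Group V] [Group W] [DecidableEq W] (k : ℕ)
    {S : Finset V} {f : V → W} (hinj : Set.InjOn f S)
    (h : ∀ l : List V, l.Nodup → (∀ x ∈ l, x ∈ S) → (l.prod = 1 ↔ (l.map f).prod = 1)) :
    IsWeakFreimanIso k S (S.image f) f := by
  have hgS : ∀ y ∈ S.image f, Function.invFunOn f S y ∈ S := fun y hy =>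
    Function.invFunOn_mem (by simpa using hy)
  have hfg : ∀ y ∈ S.image f, f (Function.invFunOn f S y) = y := fun y hy =>
    Function.invFunOn_eq (by simpa using hy)
  refine ⟨by rw [Finset.coe_image]; exact hinj.bijOn_image,
    ⟨fun x hx => Finset.mem_image_of_mem f hx, fun l hl hlS _ hp => (h l hl hlS).1 hp⟩,
    Function.invFunOn f S, fun x hx => hinj.leftInvOn_invFunOn hx, hfg, hgS,
    fun l hl hlS _ hp => ?_⟩
  have hmap : (l.map (Function.invFunOn f S)).map f = l := by
    rw [List.map_map]
    exact (List.map_congr_left fun y hy => hfg y (hlS y hy)).trans l.map_id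
  refine (h _ (hl.map_on fun a ha b hb hab => ?_) ?_).2 (by rw [hmap, hp])
  · rw [← hfg a (hlS a ha), ← hfg b (hlS b hb), hab]
  · simp only [List.mem_map]
    rintro _ ⟨y, hy, rfl⟩
    exact hgS y (hlS y hy)

/-- The sign by which `i : ℤ/4` acts when its generator acts by negation. -/
def zmodFourSign : ZMod 4 → ℤ := ![1, -1, 1, -1]

theorem abs_zmodFourSign (i : ZMod 4) : |zmodFourSign i| = 1 := by
  revert i
  decide

/-- The first coordinate of a product in `A ⋊ ℤ/4`, the generator acting by negation, of factors
with first coordinates given by `z` and second coordinates given by `h`. -/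
def signedSum {α A : Type*} [AddCommGroup A] (h : α → ZMod 4) (z : α → A) : List α → A
  | [] => 0
  | g :: l => z g + zmodFourSign (h g) • signedSum h z l

theorem exists_signedSum_eq_sum {α : Type*} [Fintype α] (h : α → ZMod 4) (l : List α)
    (hl : l.Nodup) :
    ∃ c : α → ℤ, (∀ a, |c a| ≤ 1) ∧ (∀ a ∉ l, c a = 0) ∧
      ∀ (A : Type) [AddCommGroup A] (z : α → A), signedSum h z l = ∑ a, c a • z a := by
  classical
  induction l with
  | nil => exact ⟨0, by simp, by simp, fun A _ z => by simp [signedSum]⟩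
  | cons g l ih =>
    obtain ⟨hg, hl⟩ := List.nodup_cons.1 hl
    obtain ⟨c, hc, hcl, hsum⟩ := ih hl
    refine ⟨Pi.single g 1 + zmodFourSign (h g) • c, fun a => ?_, fun a ha => ?_, fun A _ z => ?_⟩
    · by_cases hag : a = g
      · subst hag
        simp [hcl a hg]
      · simpa [hag, abs_mul, abs_zmodFourSign] using hc a
    · rw [List.mem_cons, not_or] at ha
      simp [ha.1, hcl a ha.2]
    · simp [signedSum, hsum, add_smul, Finset.sum_add_distrib, Finset.smul_sum, mul_smul,
        Pi.single_apply, ite_smul]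

namespace QuaternionGroup

variable {m : ℕ}

/-- Doubling, as a map `ℤ/2m → ℤ/4`. -/
def double (m : ℕ) : ZMod (2 * m) →+ ZMod 4 :=
  ZMod.lift (2 * m) ⟨zmultiplesHom (ZMod 4) 2, by
    have h : (4 : ZMod 4) = 0 := rfl
    simp only [zmultiplesHom_apply, zsmul_eq_mul]
    push_cast
    linear_combination (m : ZMod 4) * h⟩

theorem double_intCast (z : ℤ) : double m z = z * 2 := by
  simp [double]

theorem double_add_self (i : ZMod (2 * m)) : double m i + double m i = 0 := by
  obtain ⟨z, rfl⟩ := ZMod.intCast_surjective i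
  have h : (4 : ZMod 4) = 0 := rfl
  rw [double_intCast]
  linear_combination (z : ZMod 4) * h

theorem double_natCast_self (hm : Odd m) : double m (m : ZMod (2 * m)) = 2 := by
  obtain ⟨t, ht⟩ := hm
  have h : (4 : ZMod 4) = 0 := rfl
  have := double_intCast (m := m) m
  rw [Int.cast_natCast, Int.cast_natCast] at this
  rw [this, show (m : ZMod 4) = 2 * t + 1 by rw [ht]; push_cast; rfl]
  linear_combination (t : ZMod 4) * h

theorem double_eq_zero_or_two (i : ZMod (2 * m)) : double m i = 0 ∨ double m i = 2 := by
  have h : ∀ z : ZMod 4, z + z = 0 → z = 0 ∨ z = 2 := by decide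
  exact h _ (double_add_self i)

/-- The reduction map `ℤ/2m → ℤ/m`. -/
def reduce (m : ℕ) : ZMod (2 * m) →+* ZMod m :=
  ZMod.castHom (Dvd.intro_left 2 rfl) (ZMod m)

theorem eq_of_reduce_eq_of_double_eq (hm : Odd m) {i j : ZMod (2 * m)}
    (hr : reduce m i = reduce m j) (hd : double m i = double m j) : i = j := by
  obtain ⟨z, rfl⟩ := ZMod.intCast_surjective i
  obtain ⟨w, rfl⟩ := ZMod.intCast_surjective j
  rw [map_intCast, map_intCast, ZMod.intCast_eq_intCast_iff_dvd_sub] at hr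
  rw [double_intCast, double_intCast] at hd
  have hd' : ((z * 2 : ℤ) : ZMod 4) = ((w * 2 : ℤ) : ZMod 4) := by push_cast; exact hd
  rw [ZMod.intCast_eq_intCast_iff_dvd_sub] at hd'
  rw [ZMod.intCast_eq_intCast_iff_dvd_sub]
  push_cast
  refine IsCoprime.mul_dvd ?_ (by omega) hr
  exact_mod_cast Nat.isCoprime_iff_coprime.2 (Nat.coprime_two_left.2 hm)

/-- The first coordinate of the isomorphism `Dic_m ≅ ℤ/m ⋊ ℤ/4` for odd `m`. -/
def rotation : QuaternionGroup m → ZMod m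
  | a i => reduce m i
  | xa i => -reduce m i

/-- The second coordinate of the isomorphism `Dic_m ≅ ℤ/m ⋊ ℤ/4` for odd `m`. -/
def quarter : QuaternionGroup m → ZMod 4
  | a i => double m i
  | xa i => 1 + double m i

theorem quarter_mul (hm : Odd m) (g h : QuaternionGroup m) :
    quarter (g * h) = quarter g + quarter h := by
  rcases g with i | i <;> rcases h with j | j <;>
    simp only [a_mul_a, a_mul_xa, xa_mul_a, xa_mul_xa, quarter, map_add, map_sub,
      double_natCast_self hm]
  · linear_combination -double_add_self i
  · ring
  · linear_combination -double_add_self i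

theorem rotation_mul (g h : QuaternionGroup m) :
    rotation (g * h) = rotation g + zmodFourSign (quarter g) • rotation h := by
  have ha : ∀ i : ZMod (2 * m), zmodFourSign (double m i) = 1 := fun i => by
    rcases double_eq_zero_or_two i with h | h <;> rw [h] <;> rfl
  have hxa : ∀ i : ZMod (2 * m), zmodFourSign (1 + double m i) = -1 := fun i => by
    rcases double_eq_zero_or_two i with h | h <;> rw [h] <;> rfl
  have hm0 : reduce m (m : ZMod (2 * m)) = 0 := by simp
  rcases g with i | i <;> rcases h with j | j <;>
    simp only [a_mul_a, a_mul_xa, xa_mul_a, xa_mul_xa, quarter, rotation, map_add, map_sub,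
      ha, hxa, hm0, one_smul, neg_smul] <;> ring

theorem eq_of_rotation_eq_of_quarter_eq (hm : Odd m) {g h : QuaternionGroup m}
    (hr : rotation g = rotation h) (hq : quarter g = quarter h) : g = h := by
  have hne : ∀ i j : ZMod (2 * m), double m i ≠ 1 + double m j := fun i j => by
    rcases double_eq_zero_or_two i with h | h <;> rcases double_eq_zero_or_two j with h' | h' <;>
      rw [h, h'] <;> decide
  rcases g with i | i <;> rcases h with j | j
  · exact congrArg a (eq_of_reduce_eq_of_double_eq hm hr hq)
  · exact absurd hq (hne i j)
  · exact absurd hq.symm (hne j i)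
  · exact congrArg xa (eq_of_reduce_eq_of_double_eq hm (neg_injective hr) (add_left_cancel hq))

theorem rotation_one : rotation (1 : QuaternionGroup m) = 0 := map_zero (reduce m)

theorem quarter_one : quarter (1 : QuaternionGroup m) = 0 := map_zero (double m)

theorem list_prod_eq_one_iff (hm : Odd m) {α : Type*} (l : List α) (g : α → QuaternionGroup m) :
    (l.map g).prod = 1 ↔
      signedSum (quarter ∘ g) (rotation ∘ g) l = 0 ∧ (l.map (quarter ∘ g)).sum = 0 := by
  have hr : rotation (l.map g).prod = signedSum (quarter ∘ g) (rotation ∘ g) l := by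
    induction l with
    | nil => exact rotation_one
    | cons b l ih => rw [List.map_cons, List.prod_cons, rotation_mul, ih]; rfl
  have hq : quarter (l.map g).prod = (l.map (quarter ∘ g)).sum := by
    clear hr
    induction l with
    | nil => exact quarter_one
    | cons b l ih =>
      rw [List.map_cons, List.prod_cons, quarter_mul hm, ih, List.map_cons, List.sum_cons]; rfl
  rw [← hr, ← hq]
  refine ⟨fun h => by rw [h]; exact ⟨rotation_one, quarter_one⟩, fun h => ?_⟩
  exact eq_of_rotation_eq_of_quarter_eq hm (h.1.trans rotation_one.symm)
    (h.2.trans quarter_one.symm)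

end QuaternionGroup

theorem SemidirectProduct.list_prod_eq_one_iff
    {φ : Multiplicative (ZMod 4) →* MulAut (Multiplicative ℤ)}
    (hφ : ∀ x : Multiplicative ℤ, φ (Multiplicative.ofAdd 1) x = x⁻¹)
    {α : Type*} (l : List α) (y : α → ℤ) (q : α → ZMod 4) :
    (l.map fun s => (⟨.ofAdd (y s), .ofAdd (q s)⟩ :
      SemidirectProduct (Multiplicative ℤ) (Multiplicative (ZMod 4)) φ)).prod = 1 ↔
      signedSum q y l = 0 ∧ (l.map q).sum = 0 := by
  have hact : ∀ (i : ZMod 4) (z : ℤ),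
      φ (.ofAdd i) (.ofAdd z) = .ofAdd (zmodFourSign i • z) := by
    intro i z
    have h2 : (Multiplicative.ofAdd (2 : ZMod 4)) = .ofAdd 1 * .ofAdd 1 := rfl
    have h3 : (Multiplicative.ofAdd (3 : ZMod 4)) = .ofAdd 1 * .ofAdd 1 * .ofAdd 1 := rfl
    have h0 : (Multiplicative.ofAdd (0 : ZMod 4)) = 1 := rfl
    have hi : ∀ i : ZMod 4, i = 0 ∨ i = 1 ∨ i = 2 ∨ i = 3 := by decide
    rcases hi i with rfl | rfl | rfl | rfl
    · rw [h0, map_one, MulAut.one_apply, show zmodFourSign 0 = 1 from rfl, one_smul]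
    · rw [hφ, show zmodFourSign 1 = -1 from rfl, neg_one_smul, ofAdd_neg]
    · rw [h2, map_mul, MulAut.mul_apply, hφ, hφ, inv_inv, show zmodFourSign 2 = 1 from rfl,
        one_smul]
    · rw [h3, map_mul, map_mul, MulAut.mul_apply, MulAut.mul_apply, hφ, hφ, hφ, inv_inv,
        show zmodFourSign 3 = -1 from rfl, neg_one_smul, ofAdd_neg]
  have hprod : (l.map fun s => (⟨.ofAdd (y s), .ofAdd (q s)⟩ :
      SemidirectProduct (Multiplicative ℤ) (Multiplicative (ZMod 4)) φ)).prod =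
      ⟨.ofAdd (signedSum q y l), .ofAdd (l.map q).sum⟩ := by
    induction l with
    | nil => rfl
    | cons b l ih =>
      rw [List.map_cons, List.prod_cons, ih, SemidirectProduct.mul_def]
      simp only [hact, List.map_cons, List.sum_cons, signedSum, ofAdd_add]
  rw [hprod, SemidirectProduct.ext_iff]
  exact and_congr ofAdd_eq_one ofAdd_eq_one

theorem ZMod.eq_zero_of_zsmul_eq_zero {m n : ℕ} (hm : ∀ p : ℕ, p.Prime → p ∣ m → n < p)
    {d : ℤ} (hd : d ≠ 0) (hdn : |d| ≤ n) {x : ZMod m} (h : d • x = 0) : x = 0 := by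
  have hcop : IsCoprime d (m : ℤ) := by
    rw [Int.isCoprime_iff_nat_coprime, Int.natAbs_natCast]
    by_contra hnot
    obtain ⟨p, hp, hpd, hpm⟩ := Nat.Prime.not_coprime_iff_dvd.1 hnot
    have := Nat.le_of_dvd (Int.natAbs_pos.2 hd) hpd
    have := hm p hp hpm
    have := Int.abs_eq_natAbs d
    omega
  rw [zsmul_eq_mul] at h
  exact ((ZMod.coe_int_isUnit_iff_isCoprime d m).2 hcop.symm).mul_right_eq_zero.1 h

/-- Any subset of size `k ≥ 2` of the dicyclic group `Dic_m` (of order `4m`) is weakly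
Freiman isomorphic of order `k - 1` to a subset of the semidirect product `ℤ ⋊_φ ℤ₄`,
where `φ(1)` is negation, provided every prime factor of `m` exceeds `k^k`. -/
theorem dicyclic_weak_freiman_iso (m k : ℕ) (hm : 0 < m) (hk : 2 ≤ k)
    (φ : Multiplicative (ZMod 4) →* MulAut (Multiplicative ℤ))
    (hφ : ∀ x : Multiplicative ℤ, φ (Multiplicative.ofAdd 1) x = x⁻¹)
    (hprime : ∀ p : ℕ, p.Prime → p ∣ m → k ^ k < p)
    (S : Finset (QuaternionGroup m)) (hcard : S.card = k) :
    ∃ (S' : Finset (SemidirectProduct (Multiplicative ℤ) (Multiplicative (ZMod 4)) φ))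
      (f : QuaternionGroup m →
        SemidirectProduct (Multiplicative ℤ) (Multiplicative (ZMod 4)) φ),
      IsWeakFreimanIso (k - 1) S S' f := by
  classical
  have hodd : Odd m := by
    rw [← Nat.not_even_iff_odd, even_iff_two_dvd]
    intro h
    have := hprime 2 Nat.prime_two h
    have := Nat.pow_le_pow_left hk k
    have := Nat.pow_le_pow_right (n := 2) two_pos hk
    omega
  obtain ⟨y, hy⟩ := exists_int_sum_smul_eq_zero_iff (ι := S) (A := ZMod m)
    (fun d x hd hdk => ZMod.eq_zero_of_zsmul_eq_zero
      (fun p hp hpm => (Nat.factorial_le_pow _).trans_lt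
        (by simpa [hcard] using hprime p hp hpm)) hd hdk)
    (fun s => QuaternionGroup.rotation (s : QuaternionGroup m))
  let Y : QuaternionGroup m → ℤ := fun g => if hg : g ∈ S then y ⟨g, hg⟩ else 0
  have hY : ∀ s : S, Y s = y s := fun s => dif_pos s.2
  refine ⟨_, fun g => ⟨.ofAdd (Y g), .ofAdd (QuaternionGroup.quarter g)⟩,
    IsWeakFreimanIso.of_injOn (k - 1) (fun g hg h hh hgh => ?_) fun l hl hlS => ?_⟩
  · obtain ⟨hyg, hq⟩ := SemidirectProduct.ext_iff.1 hgh
    refine QuaternionGroup.eq_of_rotation_eq_of_quarter_eq hodd ?_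
      (Multiplicative.ofAdd.injective hq)
    lift g to S using hg
    lift h to S using hh
    have hyg' : y g = y h := by
      rw [← hY, ← hY]
      exact Multiplicative.ofAdd.injective hyg
    have hc : ∀ s, |(Pi.single g 1 - Pi.single h 1 : S → ℤ) s| ≤ 1 := fun s => by
      simp only [Pi.sub_apply, Pi.single_apply]
      split_ifs <;> simp
    have := hy _ hc
    simp only [Pi.sub_apply, sub_smul, Finset.sum_sub_distrib, Pi.single_apply, ite_smul,
      one_smul, zero_smul, Finset.sum_ite_eq', Finset.mem_univ, if_true, sub_eq_zero] at this
    exact this.1 hyg'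
  · lift l to List S using hlS
    rw [List.map_map]
    obtain ⟨c, hc, -, hsum⟩ := exists_signedSum_eq_sum
      (fun s : S => QuaternionGroup.quarter (s : QuaternionGroup m)) l (List.Nodup.of_map _ hl)
    have hsem := SemidirectProduct.list_prod_eq_one_iff hφ l y
      (fun s : S => QuaternionGroup.quarter (s : QuaternionGroup m))
    rw [hsum, hy c hc, ← hsum] at hsem
    refine (QuaternionGroup.list_prod_eq_one_iff hodd l Subtype.val).trans (hsem.symm.trans ?_)
    simp only [Function.comp_def, hY]
end
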